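/- Let h : S² → S² be a monotone map of the unit 2-sphere onto itself, let Q ⊆ S² be a Jordan domain, and set U = h⁻¹(Q). Then there exists a monotone map g : S² → S² such that g(x) = h(x) for every x ∈ S² \ U, and the restriction of g to U is a homeomorphism of U onto Q. -/

import Mathlib

section

open Set Filter Topology Metric

/-- `f` has a continuous logarithm on `K`. -/
def HasLogOn {X : Type*} [TopologicalSpace X] (f : X → ℂ) (K : Set X) : Prop :=
  ∃ L : X → ℂ, ContinuousOn L K ∧ ∀ z ∈ K, Complex.exp (L z) = f z

namespace HasLogOn

variable {X : Type*} [TopologicalSpace X] {f g : X → ℂ} {K K₁ K₂ : Set X}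

lemma mono (h : HasLogOn f K₁) (hK : K₂ ⊆ K₁) : HasLogOn f K₂ := by
  obtain ⟨L, hL, hf⟩ := h
  exact ⟨L, hL.mono hK, fun z hz => hf z (hK hz)⟩

lemma congr (h : HasLogOn f K) (hfg : ∀ z ∈ K, f z = g z) : HasLogOn g K := by
  obtain ⟨L, hL, hf⟩ := h
  exact ⟨L, hL, fun z hz => (hf z hz).trans (hfg z hz)⟩

lemma mul (hf : HasLogOn f K) (hg : HasLogOn g K) : HasLogOn (fun z => f z * g z) K := by
  obtain ⟨L, hL, hf⟩ := hf
  obtain ⟨M, hM, hg⟩ := hg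
  exact ⟨fun z => L z + M z, hL.add hM, fun z hz => by rw [Complex.exp_add, hf z hz, hg z hz]⟩

lemma const {c : ℂ} (hc : c ≠ 0) : HasLogOn (fun _ => c) K :=
  ⟨fun _ => Complex.log c, continuousOn_const, fun _ _ => Complex.exp_log hc⟩

lemma of_slitPlane (hf : ContinuousOn f K) (h : ∀ z ∈ K, f z ∈ Complex.slitPlane) :
    HasLogOn f K :=
  ⟨fun z => Complex.log (f z), hf.clog h,
    fun z hz => Complex.exp_log (Complex.slitPlane_ne_zero (h z hz))⟩

/-- A function whose values stay within `‖c‖` of a point `c` has a logarithm. -/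
lemma of_norm_sub_lt (hf : ContinuousOn f K) {c : ℂ} (h : ∀ z ∈ K, ‖f z - c‖ < ‖c‖) :
    HasLogOn f K := by
  rcases K.eq_empty_or_nonempty with rfl | ⟨z₀, hz₀⟩
  · exact ⟨0, continuousOn_empty _, by simp⟩
  have hc : c ≠ 0 := norm_pos_iff.1 ((norm_nonneg _).trans_lt (h z₀ hz₀))
  have h1 : HasLogOn (fun z => f z / c) K := by
    refine of_slitPlane (hf.div_const c) fun z hz => Complex.mem_slitPlane_of_norm_lt_one
      (z := f z / c - 1) ?_ |> fun h => by simpa using h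
    rw [div_sub_one hc, norm_div, div_lt_one (norm_pos_iff.2 hc)]
    exact h z hz
  exact (h1.mul (const hc)).congr fun z _ => by field_simp

end HasLogOn

/-- Two continuous logarithms of the same function on a preconnected set differ by a constant. -/
lemma eqOn_add_const_of_exp_eq {X : Type*} [TopologicalSpace X] {K : Set X}
    (hK : IsPreconnected K) {L M : X → ℂ} (hL : ContinuousOn L K) (hM : ContinuousOn M K)
    (h : ∀ z ∈ K, Complex.exp (L z) = Complex.exp (M z)) {x y : X} (hx : x ∈ K) (hy : y ∈ K) :
    L x - M x = L y - M y := by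
  have hd : ∀ z ∈ K, L z - M z ∈ range (fun n : ℤ => (n : ℂ) * (2 * Real.pi * Complex.I)) := by
    intro z hz
    obtain ⟨n, hn⟩ := Complex.exp_eq_exp_iff_exists_int.1 (h z hz)
    exact ⟨n, by simp [hn]⟩
  have hc : ContinuousOn (fun z => ((L z - M z) / (2 * Real.pi * Complex.I)).re) K := by
    fun_prop
  have hne : (2 * Real.pi * Complex.I : ℂ) ≠ 0 := Complex.two_pi_I_ne_zero
  have key := (hK.image _ hc)
  have hsub : (fun z => ((L z - M z) / (2 * Real.pi * Complex.I)).re) '' K ⊆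
      range ((↑) : ℤ → ℝ) := by
    rintro _ ⟨z, hz, rfl⟩
    obtain ⟨n, hn⟩ := hd z hz
    refine ⟨n, ?_⟩
    simp only [← hn]
    rw [mul_div_cancel_right₀ _ hne]; simp
  have hss := (Int.isClosedEmbedding_coe_real.isInducing.isPreconnected_image
    (s := ((↑) : ℤ → ℝ) ⁻¹' ((fun z => ((L z - M z) / (2 * Real.pi * Complex.I)).re) '' K))).1
    (by rwa [image_preimage_eq_of_subset hsub])
  have hss' := hss.subsingleton
  obtain ⟨n, hn⟩ := hd x hx
  obtain ⟨m, hm⟩ := hd y hy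
  have e : n = m := by
    apply hss'
    · refine ⟨x, hx, ?_⟩
      simp only [← hn]; rw [mul_div_cancel_right₀ _ hne]; simp
    · refine ⟨y, hy, ?_⟩
      simp only [← hm]; rw [mul_div_cancel_right₀ _ hne]; simp
  rw [← hn, ← hm, e]

/-- Logarithms on two closed sets with preconnected intersection can be glued. -/
lemma HasLogOn.union {X : Type*} [TopologicalSpace X] {f : X → ℂ} {K₁ K₂ : Set X}
    (h₁ : IsClosed K₁) (h₂ : IsClosed K₂) (hK : IsPreconnected (K₁ ∩ K₂))
    (hf₁ : HasLogOn f K₁) (hf₂ : HasLogOn f K₂) : HasLogOn f (K₁ ∪ K₂) := by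
  classical
  obtain ⟨L, hL, hLf⟩ := hf₁
  obtain ⟨M, hM, hMf⟩ := hf₂
  obtain ⟨c, hc1, hc⟩ : ∃ c : ℂ, Complex.exp c = 1 ∧ ∀ z ∈ K₁ ∩ K₂, L z = M z + c := by
    rcases (K₁ ∩ K₂).eq_empty_or_nonempty with he | ⟨z₀, hz₀⟩
    · exact ⟨0, by simp, by simp [he]⟩
    · refine ⟨L z₀ - M z₀, ?_, fun z hz => ?_⟩
      · rw [Complex.exp_sub, hLf _ hz₀.1, hMf _ hz₀.2, div_self]
        rw [← hLf _ hz₀.1]; exact Complex.exp_ne_zero _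
      · rw [← eqOn_add_const_of_exp_eq hK (hL.mono inter_subset_left) (hM.mono inter_subset_right)
          (fun z hz => by rw [hLf z hz.1, hMf z hz.2]) hz hz₀]; ring
  refine ⟨fun z => if z ∈ K₁ then L z else M z + c, ?_, ?_⟩
  · refine ContinuousOn.union_of_isClosed ?_ ?_ h₁ h₂
    · exact hL.congr fun z hz => by simp [hz]
    · refine (hM.add_const c).congr fun z hz => ?_
      by_cases h : z ∈ K₁
      · simp [h, hc z ⟨h, hz⟩]
      · simp [h]
  · rintro z hz
    by_cases h : z ∈ K₁
    · simp [h, hLf z h]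
    · simp [h, Complex.exp_add, hc1, hMf z (hz.resolve_left h)]

/-- A nowhere vanishing continuous function on a simply connected, locally path connected space
has a continuous logarithm. -/
lemma exists_continuous_log {X : Type*} [TopologicalSpace X] [SimplyConnectedSpace X]
    [LocallyPathConnectedSpace X] {f : X → ℂ} (hf : Continuous f) (h0 : ∀ z, f z ≠ 0) :
    ∃ L : X → ℂ, Continuous L ∧ ∀ z, Complex.exp (L z) = f z := by
  have x₀ : X := (inferInstance : Nonempty X).some
  rcases Complex.isCoveringMapOn_exp.existsUnique_continuousMap_lifts
    ⟨f, hf⟩ (Complex.exp_log (h0 x₀)) (fun x => h0 x) with ⟨L, ⟨-, hL⟩, -⟩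
  exact ⟨L, L.continuous, fun z => congrFun hL z⟩

/-- A nowhere vanishing continuous function on the plane does not agree with `z ↦ z - x`
near infinity. -/
lemma not_forall_ne_zero_of_eq_sub {f : ℂ → ℂ} (hf : Continuous f) {x : ℂ} {R : ℝ}
    (hR : ∀ z, R ≤ ‖z - x‖ → f z = z - x) : ∃ z, f z = 0 := by
  by_contra! h0
  obtain ⟨L, hL, hLf⟩ := exists_continuous_log hf h0
  set r : ℝ := |R| + 1
  have hr : 0 < r := by positivity
  have h := eqOn_add_const_of_exp_eq (K := (univ : Set ℝ)) isPreconnected_univ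
    (L := fun t => L (x + r * Complex.exp (t * Complex.I)))
    (M := fun t => Real.log r + t * Complex.I) (by fun_prop) (by fun_prop)
    (fun t _ => by
      rw [hLf, hR]
      · rw [Complex.exp_add, ← Complex.ofReal_exp, Real.exp_log hr]; ring
      · simp [Complex.norm_exp_ofReal_mul_I, abs_of_pos hr]
        exact (le_abs_self R).trans (by simp [r]))
    (mem_univ 0) (mem_univ (2 * Real.pi))
  have h2 : Complex.exp ((2 * Real.pi : ℝ) * Complex.I) = 1 := by
    push_cast; exact Complex.exp_two_pi_mul_I
  rw [h2] at h
  simp at h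

/-- The complement of every point is an embedded copy of the plane. -/
def IsSphereLike (X : Type*) [TopologicalSpace X] : Prop :=
  ∀ p : X, ∃ e : ℂ → X, IsOpenEmbedding e ∧ range e = {p}ᶜ

/-- `x` and `y` lie in a common connected set that avoids `K`. -/
def JoinedOff {X : Type*} [TopologicalSpace X] (K : Set X) (x y : X) : Prop :=
  ∃ C : Set X, IsPreconnected C ∧ C ⊆ Kᶜ ∧ x ∈ C ∧ y ∈ C

section Chart

variable {X : Type*} [TopologicalSpace X] {e : ℂ → X} {p : X}

lemma isCompact_preimage_chart [CompactSpace X] (he : IsOpenEmbedding e)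
    (hr : range e = {p}ᶜ) {K : Set X} (hK : IsClosed K) (hp : p ∉ K) : IsCompact (e ⁻¹' K) := by
  apply (he.isInducing.isCompact_preimage_iff _).2 hK.isCompact
  rw [hr]
  intro x hx h
  exact hp (h ▸ hx)

lemma tendsto_chart_cocompact [CompactSpace X] (he : IsOpenEmbedding e)
    (hr : range e = {p}ᶜ) : Tendsto e (cocompact ℂ) (𝓝 p) := by
  intro N hN
  obtain ⟨O, hON, hO, hpO⟩ := mem_nhds_iff.1 hN
  have := isCompact_preimage_chart he hr hO.isClosed_compl (fun h => h hpO)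
  rw [Filter.mem_map]
  filter_upwards [this.compl_mem_cocompact] with z hz
  apply hON
  by_contra h
  exact hz h

lemma chart_ne {X : Type*} {e : ℂ → X} {p : X} (hr : range e = {p}ᶜ) (z : ℂ) : e z ≠ p := by
  have : e z ∈ range e := mem_range_self z
  rw [hr] at this
  exact this

lemma exists_chart_eq {X : Type*} {e : ℂ → X} {p : X} (hr : range e = {p}ᶜ) {x : X}
    (hx : x ≠ p) : ∃ z, e z = x := by
  have : x ∈ range e := by rw [hr]; exact hx
  exact this

end Chart

/-- If `c'` is closer to `c` than `K` is, then `z - c'` has a logarithm on `K` as soon as `z - c`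
has one. -/
lemma HasLogOn.sub_of_near {K : Set ℂ} {c c' : ℂ} {r : ℝ} (hr : ∀ z ∈ K, r ≤ ‖z - c‖)
    (hc : ‖c' - c‖ < r) (h : HasLogOn (fun z => z - c) K) : HasLogOn (fun z => z - c') K := by
  have hne : ∀ z ∈ K, z - c ≠ 0 := fun z hz =>
    norm_pos_iff.1 ((norm_nonneg _).trans_lt (hc.trans_le (hr z hz)))
  have h1 : HasLogOn (fun z => (z - c') / (z - c)) K := by
    refine HasLogOn.of_norm_sub_lt (c := 1) ?_ fun z hz => ?_
    · exact ContinuousOn.div (by fun_prop) (by fun_prop) hne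
    · have : (z - c') / (z - c) - 1 = (c - c') / (z - c) := by
        rw [div_sub_one (hne z hz)]; ring
      rw [this, norm_div, norm_one, div_lt_one (norm_pos_iff.2 (hne z hz)), norm_sub_rev]
      exact hc.trans_le (hr z hz)
  exact (h1.mul h).congr fun z hz => div_mul_cancel₀ _ (hne z hz)

/-- A point joined to infinity off `K` gives a function `z - x` with a logarithm on `K`. -/
lemma HasLogOn.of_joinedOff {X : Type*} [TopologicalSpace X] [CompactSpace X] [T2Space X]
    {e : ℂ → X} {p : X} (he : IsOpenEmbedding e) (hr : range e = {p}ᶜ) {K : Set X}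
    (hK : IsClosed K) {x : ℂ} (h : JoinedOff K (e x) p) :
    HasLogOn (fun z => z - x) (e ⁻¹' K) := by
  obtain ⟨C, hC, hCK, hx, hp⟩ := h
  have hcomp := isCompact_preimage_chart he hr hK (hCK hp)
  set K' := e ⁻¹' K
  let G : Set ℂ := {c | c ∉ K' ∧ HasLogOn (fun z => z - c) K'}
  let B : Set ℂ := {c | c ∉ K' ∧ ¬ HasLogOn (fun z => z - c) K'}
  have hnear : ∀ c ∉ K', ∃ r > 0, ∀ z ∈ K', r ≤ ‖z - c‖ := by
    intro c hc
    obtain ⟨r, hr, hrK⟩ := Metric.isOpen_iff.1 hcomp.isClosed.isOpen_compl c hc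
    refine ⟨r, hr, fun z hz => ?_⟩
    by_contra! hlt
    exact hrK (by simpa [dist_eq_norm] using hlt) hz
  have hGo : IsOpen G := by
    refine Metric.isOpen_iff.2 fun c hc => ?_
    obtain ⟨r, hr, hrK⟩ := hnear c hc.1
    refine ⟨r, hr, fun c' hc' => ?_⟩
    rw [Metric.mem_ball, dist_eq_norm] at hc'
    refine ⟨fun hcK => ?_, hc.2.sub_of_near hrK hc'⟩
    exact absurd (hrK c' hcK) (not_le.2 hc')
  have hBo : IsOpen B := by
    refine Metric.isOpen_iff.2 fun c hc => ?_
    obtain ⟨r, hr, hrK⟩ := hnear c hc.1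
    refine ⟨r / 2, by positivity, fun c' hc' => ?_⟩
    rw [Metric.mem_ball, dist_eq_norm] at hc'
    refine ⟨fun hcK => absurd (hrK c' hcK) (by linarith), fun hL => hc.2 ?_⟩
    refine hL.sub_of_near (r := r / 2) (fun z hz => ?_) (by rwa [norm_sub_rev])
    have h1 := hrK z hz
    have h2 : ‖z - c‖ ≤ ‖z - c'‖ + ‖c' - c‖ := by
      simpa using norm_add_le (z - c') (c' - c)
    linarith
  obtain ⟨R, hR0, hR⟩ := hcomp.isBounded.exists_pos_norm_lt
  have hfar : ∀ c : ℂ, R ≤ ‖c‖ → c ∈ G := by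
    intro c hc
    refine ⟨fun hcK => absurd (hR c hcK) (not_lt.2 hc), ?_⟩
    refine HasLogOn.of_norm_sub_lt (c := -c) (by fun_prop) fun z hz => ?_
    simpa using (hR z hz).trans_le hc
  let G' : Set X := (e '' {c | c ∉ G})ᶜ
  by_contra hlog
  have hxB : x ∈ B := ⟨fun h => hCK hx h, hlog⟩
  have hcl : IsClosed (e '' {c | c ∉ G}) := by
    apply IsCompact.isClosed
    apply IsCompact.image _ he.continuous
    apply (isCompact_closedBall (0 : ℂ) R).of_isClosed_subset hGo.isClosed_compl
    intro c hc
    by_contra hn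
    exact hc (hfar c (by simpa using (not_le.1 (by simpa using hn)).le))
  obtain ⟨y, hyC, hyG, hyB⟩ := hC G' (e '' B) hcl.isOpen_compl (he.isOpenMap _ hBo) (by
      intro y hy
      by_cases hyG : y ∈ G'
      · exact Or.inl hyG
      · right
        obtain ⟨c, hc, rfl⟩ := not_not.1 hyG
        refine ⟨c, ⟨fun h => hCK hy h, fun h => hc ⟨fun h => hCK hy h, h⟩⟩, rfl⟩)
    ⟨p, hp, fun ⟨c, _, hc⟩ => chart_ne hr c hc⟩ ⟨e x, hx, x, hxB, rfl⟩
  obtain ⟨c, hc, rfl⟩ := hyB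
  exact hyG ⟨c, fun hG => hc.2 hG.2, rfl⟩

/-- If `z - x` has a logarithm on `K`, then `x` is joined to infinity off `K`. -/
lemma JoinedOff.of_hasLogOn {X : Type*} [TopologicalSpace X] [CompactSpace X] [T2Space X]
    {e : ℂ → X} {p : X} (he : IsOpenEmbedding e) (hr : range e = {p}ᶜ) {K : Set X}
    (hK : IsClosed K) (hp : p ∉ K) {x : ℂ} (hx : e x ∉ K)
    (h : HasLogOn (fun z => z - x) (e ⁻¹' K)) : JoinedOff K (e x) p := by
  classical
  have hcomp := isCompact_preimage_chart he hr hK hp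
  set K' := e ⁻¹' K with hK'
  set V := connectedComponentIn K'ᶜ x
  have hxV : x ∈ V := mem_connectedComponentIn hx
  have hVo : IsOpen V := hcomp.isClosed.isOpen_compl.connectedComponentIn
  have hVK : V ⊆ K'ᶜ := connectedComponentIn_subset _ _
  by_cases hb : Bornology.IsBounded V
  · exfalso
    obtain ⟨L, hL, hLf⟩ := h
    obtain ⟨M, hM⟩ := ContinuousMap.exists_restrict_eq hcomp.isClosed
      ⟨K'.domRestrict L, continuousOn_iff_continuous_domRestrict.1 hL⟩
    have hML : ∀ z ∈ K', M z = L z := fun z hz => congrArg (fun f => f ⟨z, hz⟩) hM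
    have hfr : frontier V ⊆ K' := by
      intro z hz
      by_contra hzK
      have hzV : z ∉ V := fun h => by
        rw [hVo.frontier_eq] at hz; exact hz.2 h
      have hW : connectedComponentIn K'ᶜ z ∈ 𝓝 z :=
        (hcomp.isClosed.isOpen_compl.connectedComponentIn).mem_nhds
          (mem_connectedComponentIn hzK)
      obtain ⟨w, hw1, hw2⟩ := mem_closure_iff_nhds.1 (frontier_subset_closure hz) _ hW
      have := connectedComponentIn_eq hw1
      have h2 := connectedComponentIn_eq hw2
      apply hzV
      change z ∈ connectedComponentIn K'ᶜ x
      rw [h2, ← this]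
      exact mem_connectedComponentIn hzK
    let f : ℂ → ℂ := V.piecewise (fun z => Complex.exp (M z)) (fun z => z - x)
    have hf : Continuous f := by
      refine Continuous.piecewise (fun z hz => ?_) (by fun_prop) (by fun_prop)
      rw [hML z (hfr hz), hLf z (hfr hz)]
    obtain ⟨R, hR⟩ := hb.subset_ball x
    obtain ⟨z, hz⟩ := not_forall_ne_zero_of_eq_sub hf (x := x) (R := R) (fun z hz => by
      refine piecewise_eq_of_notMem _ _ _ fun hzV => ?_
      have := hR hzV
      rw [Metric.mem_ball, dist_eq_norm] at this
      linarith)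
    by_cases hzV : z ∈ V
    · simp [f, hzV] at hz
    · simp only [f, piecewise_eq_of_notMem _ _ _ hzV, sub_eq_zero] at hz
      exact hzV (hz ▸ hxV)
  · refine ⟨insert p (e '' V), ?_, ?_, mem_insert_of_mem _ ⟨x, hxV, rfl⟩, mem_insert _ _⟩
    · have hc : IsPreconnected (e '' V) :=
        isPreconnected_connectedComponentIn.image _ he.continuous.continuousOn
      refine hc.subset_closure (subset_insert _ _) (insert_subset ?_ subset_closure)
      rw [mem_closure_iff_nhds]
      intro N hN
      have := (tendsto_chart_cocompact he hr) hN
      rw [Filter.mem_map, Metric.cobounded_eq_cocompact.symm] at this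
      by_contra hne
      rw [not_nonempty_iff_eq_empty] at hne
      apply hb
      have h2 : V ⊆ (e ⁻¹' N)ᶜ := fun z hz hzN =>
        notMem_empty (e z) (hne ▸ ⟨hzN, z, hz, rfl⟩)
      exact (Bornology.isBounded_def.2 (by simpa using this) :
        Bornology.IsBounded (e ⁻¹' N)ᶜ).subset h2
    · refine insert_subset hp ?_
      rintro _ ⟨z, hz, rfl⟩
      exact hVK hz

/-- **Janiszewski's theorem**: if two closed sets with connected intersection do not separate
two points, then neither does their union. -/
lemma JoinedOff.union {X : Type*} [TopologicalSpace X] [CompactSpace X] [T2Space X]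
    (hX : IsSphereLike X) {K₁ K₂ : Set X} (h₁ : IsClosed K₁) (h₂ : IsClosed K₂)
    (hK : IsPreconnected (K₁ ∩ K₂)) {x y : X} (hxy₁ : JoinedOff K₁ x y)
    (hxy₂ : JoinedOff K₂ x y) : JoinedOff (K₁ ∪ K₂) x y := by
  obtain ⟨e, he, hr⟩ := hX y
  have hx₁ : x ∉ K₁ := by obtain ⟨C, _, h, hx, _⟩ := hxy₁; exact h hx
  have hx₂ : x ∉ K₂ := by obtain ⟨C, _, h, hx, _⟩ := hxy₂; exact h hx
  have hy₁ : y ∉ K₁ := by obtain ⟨C, _, h, _, hx⟩ := hxy₁; exact h hx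
  have hy₂ : y ∉ K₂ := by obtain ⟨C, _, h, _, hx⟩ := hxy₂; exact h hx
  by_cases hxy : x = y
  · subst hxy
    exact ⟨{x}, isPreconnected_singleton, by simp [hx₁, hx₂], rfl, rfl⟩
  obtain ⟨x, rfl⟩ := exists_chart_eq hr hxy
  refine JoinedOff.of_hasLogOn he hr (h₁.union h₂) (by simp [hy₁, hy₂]) (by simp [hx₁, hx₂]) ?_
  rw [preimage_union]
  refine HasLogOn.union (h₁.preimage he.continuous) (h₂.preimage he.continuous) ?_
    (.of_joinedOff he hr h₁ hxy₁) (.of_joinedOff he hr h₂ hxy₂)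
  rw [← preimage_inter]
  refine hK.preimage_of_isOpenMap he.injective he.isOpenMap ?_
  rw [hr]
  rintro z hz h
  exact hy₁ (h ▸ hz.1)

lemma HasLogOn.zpow {X : Type*} [TopologicalSpace X] {f : X → ℂ} {K : Set X}
    (hf : HasLogOn f K) (n : ℤ) : HasLogOn (fun z => f z ^ n) K := by
  obtain ⟨L, hL, hf⟩ := hf
  exact ⟨fun z => n * L z, continuousOn_const.mul hL,
    fun z hz => by rw [Complex.exp_int_mul, hf z hz]⟩

/-- Gluing of logarithms along a vertical line, when the difference `2πi d` of the two logarithms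
is constant on the part of the line below `y₁ - n δ / 2`. -/
lemma HasLogOn.glue_of_jump {K S : Set ℂ} (hK : IsClosed K) (hS : IsClosed S)
    (hSc : Convex ℝ S) (hlog : ∀ x ∉ K, HasLogOn (fun z => z - x) K) {c y₁ δ : ℝ}
    (hy₁ : ∀ z ∈ K ∩ S, z.im ≤ y₁) (n : ℕ) : ∀ (f L₁ L₂ : ℂ → ℂ) (d : ℂ → ℤ) (v : ℤ),
    ContinuousOn L₁ (K ∩ S ∩ {z | z.re ≤ c}) → ContinuousOn L₂ (K ∩ S ∩ {z | c ≤ z.re}) →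
    (∀ z ∈ K ∩ S ∩ {z | z.re ≤ c}, Complex.exp (L₁ z) = f z) →
    (∀ z ∈ K ∩ S ∩ {z | c ≤ z.re}, Complex.exp (L₂ z) = f z) →
    (∀ z ∈ K ∩ S, z.re = c → L₁ z - L₂ z = d z * (2 * Real.pi * Complex.I)) →
    (∀ z ∈ K ∩ S, ∀ w ∈ K ∩ S, z.re = c → w.re = c → |z.im - w.im| < δ → d z = d w) →
    (∀ z ∈ K ∩ S, z.re = c → z.im ≤ y₁ - n * (δ / 2) → d z = v) →
    HasLogOn f (K ∩ S) := by
  classical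
  induction n with
  | zero =>
    intro f L₁ L₂ d v hL₁ hL₂ hf₁ hf₂ hd _ hv
    have hKS : K ∩ S ⊆ (K ∩ S ∩ {z | z.re ≤ c}) ∪ (K ∩ S ∩ {z | c ≤ z.re}) := by
      intro z hz
      rcases le_total z.re c with h | h
      · exact Or.inl ⟨hz, h⟩
      · exact Or.inr ⟨hz, h⟩
    refine HasLogOn.mono ⟨fun z => if z.re ≤ c then L₁ z else
      L₂ z + v * (2 * Real.pi * Complex.I), ?_, ?_⟩ hKS
    · refine ContinuousOn.union_of_isClosed ?_ ?_ ((hK.inter hS).inter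
        (isClosed_le Complex.continuous_re continuous_const)) ((hK.inter hS).inter
        (isClosed_le continuous_const Complex.continuous_re))
      · exact hL₁.congr fun z hz => if_pos hz.2
      · refine (hL₂.add_const (v * (2 * Real.pi * Complex.I))).congr fun z hz => ?_
        by_cases h : z.re ≤ c
        · have hzc : z.re = c := le_antisymm h hz.2
          have := hd z hz.1 hzc
          rw [hv z hz.1 hzc (by simpa using hy₁ z hz.1)] at this
          simp only [h, if_true]
          linear_combination this
        · simp [h]
    · intro z hz
      by_cases h : z.re ≤ c
      · simp only [h, if_true]
        refine hf₁ z ⟨?_, h⟩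
        rcases hz with hz | hz <;> exact hz.1
      · simp only [h, if_false]
        rw [Complex.exp_add, Complex.exp_int_mul_two_pi_mul_I, mul_one]
        refine hf₂ z ⟨?_, (not_le.1 h).le⟩
        rcases hz with hz | hz <;> exact hz.1
  | succ n ih =>
    intro f L₁ L₂ d v hL₁ hL₂ hf₁ hf₂ hd hdδ hv
    set Y : ℝ := y₁ - n * (δ / 2) with hY
    set Y' : ℝ := Y - δ / 2 with hY'
    have hYY : y₁ - ((n + 1 : ℕ) : ℝ) * (δ / 2) = Y' := by push_cast; rw [hY', hY]; ring
    rw [hYY] at hv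
    by_cases hall : ∀ z ∈ K ∩ S, z.re = c → z.im ≤ Y → d z = v
    · exact ih f L₁ L₂ d v hL₁ hL₂ hf₁ hf₂ hd hdδ hall
    push Not at hall
    obtain ⟨a, ha, hac, haY, hav⟩ := hall
    have haY' : Y' < a.im := by
      by_contra! h
      exact hav (hv a ha hac h)
    have hda : ∀ z ∈ K ∩ S, z.re = c → Y' < z.im → z.im ≤ Y → d z = d a := by
      intro z hz hzc h1 h2
      apply hdδ z hz a ha hzc hac
      rw [abs_lt]
      constructor <;> linarith
    by_cases hemp : ∃ b ∈ K ∩ S, b.re = c ∧ b.im ≤ Y'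
    swap
    · push Not at hemp
      exact ih f L₁ L₂ d (d a) hL₁ hL₂ hf₁ hf₂ hd hdδ
        fun z hz hzc h => hda z hz hzc (hemp z hz hzc) h
    obtain ⟨b, hb, hbc, hbY'⟩ := hemp
    -- lower points stay away from `a`
    have hgap : ∀ z ∈ K ∩ S, z.re = c → z.im ≤ Y' → ∀ w ∈ K ∩ S, w.re = c → Y' < w.im →
        δ ≤ w.im - z.im := by
      intro z hz hzc hzY w hw hwc hwY
      have hz1 : d z = v := hv z hz hzc hzY
      have hlow : z.im ≤ Y - δ := by
        by_contra! h
        apply hav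
        rw [← hz1]
        apply hdδ a ha z hz hac hzc
        rw [abs_lt]
        constructor <;> linarith
      by_cases hwY2 : w.im ≤ Y
      · by_contra! h
        apply hav
        rw [← hz1, ← hda w hw hwc hwY hwY2]
        apply hdδ w hw z hz hwc hzc
        rw [abs_lt]
        constructor <;> linarith
      · linarith
    set x : ℂ := ⟨c, Y'⟩ with hx
    have hxS : x ∈ S := by
      have hlt : 0 < a.im - b.im := by linarith
      have := hSc hb.2 ha.2 (a := (a.im - Y') / (a.im - b.im)) (b := (Y' - b.im) / (a.im - b.im))
        (div_nonneg (by linarith) hlt.le) (div_nonneg (by linarith) hlt.le)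
        (by field_simp; ring)
      convert this using 1
      apply Complex.ext
      · simp only [hx, Complex.add_re, Complex.smul_re, smul_eq_mul, hbc, hac]; field_simp; ring
      · simp only [hx, Complex.add_im, Complex.smul_im, smul_eq_mul]; field_simp; ring
    have hxK : x ∉ K := by
      intro h
      have := hgap x ⟨h, hxS⟩ rfl le_rfl a ha hac haY'
      have h2 : x.im = Y' := rfl
      rw [h2] at this
      linarith
    have hne : ∀ z ∈ K, z - x ≠ 0 := fun z hz h => hxK (sub_eq_zero.1 h ▸ hz)
    set k : ℤ := d a - v
    have hlogx := hlog x hxK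
    let l₁ : ℂ → ℂ := fun z => Complex.log (-(z - x)) + Real.pi * Complex.I
    let l₂ : ℂ → ℂ := fun z => Complex.log (z - x)
    have hsl₁ : ∀ z ∈ K ∩ S ∩ {z | z.re ≤ c}, -(z - x) ∈ Complex.slitPlane := by
      intro z hz
      have h0 := hne z hz.1.1
      rw [Complex.mem_slitPlane_iff]
      by_contra! h
      apply h0
      have h1 : z.re ≤ c := hz.2
      have h3 := h.1
      have h4 := h.2
      simp only [Complex.neg_re, Complex.sub_re, Complex.neg_im, Complex.sub_im, hx] at h3 h4
      apply Complex.ext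
      · simp only [Complex.sub_re, hx, Complex.zero_re]; linarith
      · simp only [Complex.sub_im, hx, Complex.zero_im]; linarith
    have hsl₂ : ∀ z ∈ K ∩ S ∩ {z | c ≤ z.re}, z - x ∈ Complex.slitPlane := by
      intro z hz
      have h0 := hne z hz.1.1
      rw [Complex.mem_slitPlane_iff]
      by_contra! h
      apply h0
      have h1 : c ≤ z.re := hz.2
      have h3 := h.1
      have h4 := h.2
      simp only [Complex.sub_re, Complex.sub_im, hx] at h3 h4
      apply Complex.ext
      · simp only [Complex.sub_re, hx, Complex.zero_re]; linarith
      · simp only [Complex.sub_im, hx, Complex.zero_im]; linarith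
    have hjump : ∀ z ∈ K ∩ S, z.re = c → l₁ z - l₂ z =
        ((if z.im ≤ Y' then 1 else 0 : ℤ) : ℂ) * (2 * Real.pi * Complex.I) := by
      intro z hz hzc
      have h0 := hne z hz.1
      have hre : (z - x).re = 0 := by simp [hx, hzc]
      have him : (z - x).im = z.im - Y' := by simp [hx]
      have him0 : z.im ≠ Y' := by
        intro h
        apply h0
        apply Complex.ext
        · exact hre
        · rw [him, h]; simp
      simp only [l₁, l₂, Complex.log, norm_neg]
      by_cases h : z.im ≤ Y'
      · have hlt : (z - x).im < 0 := by rw [him]; have := lt_of_le_of_ne h him0; linarith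
        rw [Complex.arg_neg_eq_arg_add_pi_of_im_neg hlt]
        simp only [h, if_true]
        push_cast
        ring
      · have hlt : 0 < (z - x).im := by rw [him]; linarith [not_le.1 h]
        rw [Complex.arg_neg_eq_arg_sub_pi_of_im_pos hlt]
        simp only [h, if_false]
        push_cast
        ring
    have hmain : HasLogOn (fun z => f z * (z - x) ^ k) (K ∩ S) := by
      refine ih _ (fun z => L₁ z + k * l₁ z) (fun z => L₂ z + k * l₂ z)
        (fun z => d z + k * (if z.im ≤ Y' then 1 else 0)) (d a) ?_ ?_ ?_ ?_ ?_ ?_ ?_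
      · refine hL₁.add (continuousOn_const.mul (ContinuousOn.add ?_ continuousOn_const))
        exact ContinuousOn.clog (by fun_prop) hsl₁
      · refine hL₂.add (continuousOn_const.mul ?_)
        exact ContinuousOn.clog (by fun_prop) hsl₂
      · intro z hz
        rw [Complex.exp_add, hf₁ z hz, Complex.exp_int_mul, Complex.exp_add,
          Complex.exp_log (Complex.slitPlane_ne_zero (hsl₁ z hz)), Complex.exp_pi_mul_I]
        congr 2
        ring
      · intro z hz
        rw [Complex.exp_add, hf₂ z hz, Complex.exp_int_mul,
          Complex.exp_log (Complex.slitPlane_ne_zero (hsl₂ z hz))]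
      · intro z hz hzc
        have h1 := hd z hz hzc
        have h2 := hjump z hz hzc
        push_cast at h2 ⊢
        linear_combination h1 + k * h2
      · intro z hz w hw hzc hwc hzw
        rw [abs_lt] at hzw
        have h1 := hdδ z hz w hw hzc hwc (abs_lt.2 hzw)
        by_cases h2 : z.im ≤ Y' <;> by_cases h3 : w.im ≤ Y'
        · simp [h1, h2, h3]
        · have := hgap z hz hzc h2 w hw hwc (not_le.1 h3); linarith
        · have := hgap w hw hwc h3 z hz hzc (not_le.1 h2); linarith
        · simp [h1, h2, h3]
      · intro z hz hzc hzY
        by_cases h2 : z.im ≤ Y'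
        · simp [h2, hv z hz hzc h2, k]
        · simp [h2, hda z hz hzc (not_le.1 h2) hzY]
    refine (hmain.mul ((hlogx.zpow (-k)).mono inter_subset_left)).congr fun z hz => ?_
    have := hne z hz.1
    rw [mul_assoc, ← zpow_add₀ this]
    simp

/-- Logarithms on the two parts of a convex window cut by a vertical line can be merged. -/
lemma HasLogOn.glue_re {K S : Set ℂ} (hK : IsCompact K) (hS : IsClosed S)
    (hSc : Convex ℝ S) (hlog : ∀ x ∉ K, HasLogOn (fun z => z - x) K) {c : ℝ} {f : ℂ → ℂ}
    (h₁ : HasLogOn f (K ∩ S ∩ {z | z.re ≤ c})) (h₂ : HasLogOn f (K ∩ S ∩ {z | c ≤ z.re})) :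
    HasLogOn f (K ∩ S) := by
  obtain ⟨L₁, hL₁, hf₁⟩ := h₁
  obtain ⟨L₂, hL₂, hf₂⟩ := h₂
  have hex : ∀ z : ℂ, ∃ n : ℤ, z ∈ K ∩ S → z.re = c →
      L₁ z - L₂ z = n * (2 * Real.pi * Complex.I) := by
    intro z
    by_cases hz : z ∈ K ∩ S ∧ z.re = c
    · have h := (hf₁ z ⟨hz.1, hz.2.le⟩).trans (hf₂ z ⟨hz.1, hz.2.ge⟩).symm
      obtain ⟨n, hn⟩ := Complex.exp_eq_exp_iff_exists_int.1 h
      exact ⟨n, fun _ _ => by rw [hn]; ring⟩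
    · exact ⟨0, fun h1 h2 => absurd ⟨h1, h2⟩ hz⟩
  choose d hd using hex
  set T : Set ℂ := K ∩ S ∩ {z | z.re = c}
  have hT : IsCompact T := (hK.inter_right hS).inter_right
    (isClosed_eq Complex.continuous_re continuous_const)
  have hc : ContinuousOn (fun z => L₁ z - L₂ z) T :=
    (hL₁.mono fun z hz => ⟨hz.1, le_of_eq hz.2⟩).sub (hL₂.mono fun z hz => ⟨hz.1, ge_of_eq hz.2⟩)
  have huc := hT.uniformContinuousOn_of_continuous hc
  obtain ⟨δ, hδ, hu⟩ := Metric.uniformContinuousOn_iff.1 huc 1 one_pos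
  obtain ⟨R, hR⟩ := hK.isBounded.exists_norm_le
  have him : ∀ z ∈ K ∩ S, |z.im| ≤ R := fun z hz => (Complex.abs_im_le_norm z).trans (hR z hz.1)
  obtain ⟨n, hn⟩ := exists_nat_gt ((2 * R + 1) / (δ / 2))
  rw [div_lt_iff₀ (by positivity)] at hn
  refine HasLogOn.glue_of_jump hK.isClosed hS hSc hlog (δ := δ) (y₁ := R)
    (fun z hz => (abs_le.1 (him z hz)).2) n f L₁ L₂ d 0 hL₁ hL₂ hf₁ hf₂ hd ?_ ?_
  · intro z hz w hw hzc hwc hzw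
    have h := hu z ⟨hz, hzc⟩ w ⟨hw, hwc⟩ (by
      rw [Complex.dist_of_re_eq (hzc.trans hwc.symm), Real.dist_eq]; exact hzw)
    rw [hd z hz hzc, hd w hw hwc, dist_eq_norm, ← sub_mul, norm_mul, Complex.norm_mul,
      Complex.norm_mul] at h
    simp only [Complex.norm_I, Complex.norm_real, Complex.norm_ofNat, mul_one,
      Real.norm_of_nonneg Real.pi_pos.le] at h
    by_contra hne
    have h1 : (1 : ℝ) ≤ ‖(d z : ℂ) - d w‖ := by
      rw [← Int.cast_sub, Complex.norm_intCast, ← Int.cast_abs]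
      exact_mod_cast Int.one_le_abs (sub_ne_zero.2 hne)
    nlinarith [Real.pi_gt_three]
  · intro z hz hzc h
    have := (abs_le.1 (him z hz)).1
    linarith

/-- Logarithms on the two parts of a convex window cut by a horizontal line can be merged. -/
lemma HasLogOn.glue_im {K S : Set ℂ} (hK : IsCompact K) (hS : IsClosed S)
    (hSc : Convex ℝ S) (hlog : ∀ x ∉ K, HasLogOn (fun z => z - x) K) {c : ℝ} {f : ℂ → ℂ}
    (h₁ : HasLogOn f (K ∩ S ∩ {z | z.im ≤ c})) (h₂ : HasLogOn f (K ∩ S ∩ {z | c ≤ z.im})) :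
    HasLogOn f (K ∩ S) := by
  let r : ℂ → ℂ := fun z => Complex.I * z
  have hr : Continuous r := by fun_prop
  have hcomp : ∀ {g : ℂ → ℂ} {A B : Set ℂ}, HasLogOn g A → (∀ z ∈ B, r z ∈ A) →
      HasLogOn (g ∘ r) B := by
    rintro g A B ⟨L, hL, hg⟩ hAB
    exact ⟨L ∘ r, hL.comp hr.continuousOn hAB, fun z hz => hg _ (hAB z hz)⟩
  have hrr : ∀ z, r (-(r z)) = z := fun z => by
    simp only [r, mul_neg, ← mul_assoc, Complex.I_mul_I]; ring
  have key : HasLogOn (f ∘ r) (r ⁻¹' K ∩ r ⁻¹' S) := by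
    refine HasLogOn.glue_re (c := c) ?_ (hS.preimage hr) ?_ ?_ ?_ ?_
    · have : r ⁻¹' K = (fun z => -(r z)) '' K := by
        ext z
        constructor
        · intro hz
          refine ⟨r z, hz, ?_⟩
          simp only [r, ← mul_assoc, Complex.I_mul_I]; ring
        · rintro ⟨w, hw, rfl⟩
          rw [mem_preimage, hrr]; exact hw
      rw [this]
      exact hK.image (by fun_prop)
    · intro z hz w hw a b ha hb hab
      have := hSc hz hw ha hb hab
      simp only [mem_preimage, r] at this ⊢
      convert this using 1
      simp; ring
    · intro x hx
      have h := (hcomp (B := r ⁻¹' K) (hlog (r x) hx) (fun z hz => hz)).mul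
        (HasLogOn.const (neg_ne_zero.2 Complex.I_ne_zero))
      refine h.congr fun z _ => ?_
      simp only [r, Function.comp_apply]
      linear_combination -(z - x) * Complex.I_mul_I
    · exact hcomp h₁ fun z hz => ⟨hz.1, by simpa [r] using hz.2⟩
    · exact hcomp h₂ fun z hz => ⟨hz.1, by simpa [r] using hz.2⟩
  obtain ⟨L, hL, hf⟩ := key
  refine ⟨fun z => L (-(r z)), hL.comp (by fun_prop) ?_, fun z hz => ?_⟩
  · intro z hz
    exact ⟨by simpa [hrr] using hz.1, by simpa [hrr] using hz.2⟩
  · rw [hf _ ⟨by simpa [hrr] using hz.1, by simpa [hrr] using hz.2⟩]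
    simp [hrr]

lemma HasLogOn.strip_re {K S : Set ℂ} (hK : IsCompact K) (hS : IsClosed S)
    (hSc : Convex ℝ S) (hlog : ∀ x ∉ K, HasLogOn (fun z => z - x) K) {a δ : ℝ} {f : ℂ → ℂ}
    (hδ : 0 ≤ δ) (ha : ∀ z ∈ K ∩ S, a ≤ z.re)
    (h : ∀ k : ℕ, HasLogOn f (K ∩ S ∩ {z | a + k * δ ≤ z.re ∧ z.re ≤ a + (k + 1) * δ})) (n : ℕ) :
    HasLogOn f (K ∩ (S ∩ {z | z.re ≤ a + n * δ})) := by
  induction n with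
  | zero =>
    refine (h 0).mono fun z hz => ⟨⟨hz.1, hz.2.1⟩, ?_⟩
    have h1 := ha z ⟨hz.1, hz.2.1⟩
    have h2 : z.re ≤ a + (0 : ℕ) * δ := hz.2.2
    simp only [Nat.cast_zero, zero_mul, mem_ofPred_eq, zero_add, one_mul] at h2 ⊢
    constructor <;> linarith
  | succ n ih =>
    refine HasLogOn.glue_re hK (hS.inter (isClosed_le Complex.continuous_re continuous_const))
      (hSc.inter (convex_halfSpace_re_le _)) hlog (c := a + n * δ) ?_ ?_
    · exact ih.mono fun z hz => ⟨hz.1.1, hz.1.2.1, hz.2⟩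
    · refine (h n).mono fun z hz => ⟨⟨hz.1.1, hz.1.2.1⟩, hz.2, ?_⟩
      have := hz.1.2.2
      simpa using this

lemma HasLogOn.strip_im {K S : Set ℂ} (hK : IsCompact K) (hS : IsClosed S)
    (hSc : Convex ℝ S) (hlog : ∀ x ∉ K, HasLogOn (fun z => z - x) K) {a δ : ℝ} {f : ℂ → ℂ}
    (hδ : 0 ≤ δ) (ha : ∀ z ∈ K ∩ S, a ≤ z.im)
    (h : ∀ k : ℕ, HasLogOn f (K ∩ S ∩ {z | a + k * δ ≤ z.im ∧ z.im ≤ a + (k + 1) * δ})) (n : ℕ) :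
    HasLogOn f (K ∩ (S ∩ {z | z.im ≤ a + n * δ})) := by
  induction n with
  | zero =>
    refine (h 0).mono fun z hz => ⟨⟨hz.1, hz.2.1⟩, ?_⟩
    have h1 := ha z ⟨hz.1, hz.2.1⟩
    have h2 : z.im ≤ a + (0 : ℕ) * δ := hz.2.2
    simp only [Nat.cast_zero, zero_mul, mem_ofPred_eq, zero_add, one_mul] at h2 ⊢
    constructor <;> linarith
  | succ n ih =>
    refine HasLogOn.glue_im hK (hS.inter (isClosed_le Complex.continuous_im continuous_const))
      (hSc.inter (convex_halfSpace_im_le _)) hlog (c := a + n * δ) ?_ ?_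
    · exact ih.mono fun z hz => ⟨hz.1.1, hz.1.2.1, hz.2⟩
    · refine (h n).mono fun z hz => ⟨⟨hz.1.1, hz.1.2.1⟩, hz.2, ?_⟩
      have := hz.1.2.2
      simpa using this

/-- If every `z - x` with `x ∉ K` has a logarithm on the compact set `K`, then so does every
nonvanishing continuous function. -/
theorem HasLogOn.of_forall_sub {K : Set ℂ} (hK : IsCompact K)
    (hlog : ∀ x ∉ K, HasLogOn (fun z => z - x) K) {f : ℂ → ℂ} (hf : ContinuousOn f K)
    (h0 : ∀ z ∈ K, f z ≠ 0) : HasLogOn f K := by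
  rcases K.eq_empty_or_nonempty with rfl | hne
  · exact ⟨0, continuousOn_empty _, by simp⟩
  obtain ⟨z₁, hz₁, hmin⟩ := hK.exists_isMinOn hne hf.norm
  have hm : 0 < ‖f z₁‖ := norm_pos_iff.2 (h0 z₁ hz₁)
  obtain ⟨δ, hδ, hu⟩ := Metric.uniformContinuousOn_iff.1
    (hK.uniformContinuousOn_of_continuous hf) _ hm
  obtain ⟨R, hR⟩ := hK.isBounded.exists_norm_le
  have hre : ∀ z ∈ K, |z.re| ≤ R := fun z hz => (Complex.abs_re_le_norm z).trans (hR z hz)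
  have him : ∀ z ∈ K, |z.im| ≤ R := fun z hz => (Complex.abs_im_le_norm z).trans (hR z hz)
  obtain ⟨n, hn⟩ := exists_nat_gt ((2 * R) / (δ / 3))
  rw [div_lt_iff₀ (by positivity)] at hn
  have hsq : ∀ k l : ℕ, HasLogOn f
      (K ∩ {z | -R + k * (δ / 3) ≤ z.im ∧ z.im ≤ -R + (k + 1) * (δ / 3)} ∩
        {z | -R + l * (δ / 3) ≤ z.re ∧ z.re ≤ -R + (l + 1) * (δ / 3)}) := by
    intro k l
    rcases (K ∩ {z | -R + k * (δ / 3) ≤ z.im ∧ z.im ≤ -R + (k + 1) * (δ / 3)} ∩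
        {z | -R + l * (δ / 3) ≤ z.re ∧ z.re ≤ -R + (l + 1) * (δ / 3)}).eq_empty_or_nonempty
      with he | ⟨z₀, hz₀⟩
    · rw [he]; exact ⟨0, continuousOn_empty _, by simp⟩
    refine HasLogOn.of_norm_sub_lt (c := f z₀) (hf.mono fun z hz => hz.1.1) fun z hz => ?_
    rw [← dist_eq_norm]
    refine (hu z hz.1.1 z₀ hz₀.1.1 ?_).trans_le (hmin hz₀.1.1)
    rw [dist_eq_norm]
    refine (Complex.norm_le_abs_re_add_abs_im _).trans_lt ?_
    have h1 : |(z - z₀).re| ≤ δ / 3 := by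
      rw [Complex.sub_re, abs_le]
      have := hz.2; have := hz₀.2
      simp only [mem_ofPred_eq] at *
      constructor <;> linarith
    have h2 : |(z - z₀).im| ≤ δ / 3 := by
      rw [Complex.sub_im, abs_le]
      have := hz.1.2; have := hz₀.1.2
      simp only [mem_ofPred_eq] at *
      constructor <;> linarith
    linarith
  have hrow : ∀ k : ℕ, HasLogOn f
      (K ∩ {z | -R + k * (δ / 3) ≤ z.im ∧ z.im ≤ -R + (k + 1) * (δ / 3)}) := by
    intro k
    refine (HasLogOn.strip_re hK (a := -R) (δ := δ / 3) (n := n)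
      ((isClosed_le continuous_const Complex.continuous_im).inter
        (isClosed_le Complex.continuous_im continuous_const))
      ((convex_halfSpace_im_ge _).inter (convex_halfSpace_im_le _)) hlog (by positivity)
      (fun z hz => (abs_le.1 (hre z hz.1)).1) (hsq k)).mono fun z hz => ⟨hz.1, hz.2, ?_⟩
    have := (abs_le.1 (hre z hz.1)).2
    simp only [mem_ofPred_eq]
    linarith
  refine (HasLogOn.strip_im hK (a := -R) (δ := δ / 3) (n := n) isClosed_univ convex_univ hlog
    (by positivity) (fun z hz => (abs_le.1 (him z hz.1)).1)
    (by simpa only [inter_univ] using hrow)).mono fun z hz => ⟨hz, mem_univ _, ?_⟩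
  have := (abs_le.1 (him z hz)).2
  simp only [mem_ofPred_eq]
  linarith

/-- Logarithms on all compact subsets of a domain patch to a logarithm on the domain. -/
lemma HasLogOn.of_forall_isCompact {U : Set ℂ} (hU : IsOpen U) (hc : IsConnected U) {f : ℂ → ℂ}
    (h : ∀ K ⊆ U, IsCompact K → HasLogOn f K) : HasLogOn f U := by
  obtain ⟨z₀, hz₀⟩ := hc.nonempty
  have hpc : IsPathConnected U := hU.isConnected_iff_isPathConnected.1 hc
  obtain ⟨L₀, -, hL₀⟩ := h {z₀} (by simpa using hz₀) isCompact_singleton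
  have h' : ∀ K ⊆ U, IsCompact K → z₀ ∈ K → ∃ L : ℂ → ℂ, ContinuousOn L K ∧
      (∀ z ∈ K, Complex.exp (L z) = f z) ∧ L z₀ = L₀ z₀ := by
    intro K hKU hK hzK
    obtain ⟨L, hL, hf⟩ := h K hKU hK
    refine ⟨fun z => L z + (L₀ z₀ - L z₀), hL.add continuousOn_const, fun z hz => ?_, by ring⟩
    have h1 := hf z₀ hzK
    have h2 := hL₀ z₀ rfl
    rw [Complex.exp_add, Complex.exp_sub, h2, h1, hf z hz, div_self, mul_one]
    rw [← h1]; exact Complex.exp_ne_zero _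
  have hP : ∀ z : ℂ, ∃ P : Set ℂ, z ∈ U → P ⊆ U ∧ IsCompact P ∧ IsPreconnected P ∧ z₀ ∈ P ∧ z ∈ P := by
    intro z
    by_cases hz : z ∈ U
    · obtain ⟨q, hq⟩ := hpc.joinedIn z₀ hz₀ z hz
      exact ⟨range q, fun _ => ⟨range_subset_iff.2 hq, isCompact_range q.continuous,
        isPreconnected_range q.continuous, ⟨0, q.source⟩, ⟨1, q.target⟩⟩⟩
    · exact ⟨∅, fun h => absurd h hz⟩
  choose P hP using hP
  have hL : ∀ z : ℂ, ∃ L : ℂ → ℂ, z ∈ U → ContinuousOn L (P z) ∧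
      (∀ w ∈ P z, Complex.exp (L w) = f w) ∧ L z₀ = L₀ z₀ := by
    intro z
    by_cases hz : z ∈ U
    · obtain ⟨h1, h2, h3, h4, h5⟩ := hP z hz
      obtain ⟨L, hL⟩ := h' (P z) h1 h2 h4
      exact ⟨L, fun _ => hL⟩
    · exact ⟨0, fun h => absurd h hz⟩
  choose L hL using hL
  refine ⟨fun z => L z z, fun z hz => ?_, fun z hz => (hL z hz).2.1 z (hP z hz).2.2.2.2⟩
  obtain ⟨h1, h2, h3, h4, h5⟩ := hP z hz
  obtain ⟨r, hr, hrU⟩ := Metric.nhds_basis_closedBall.mem_iff.1 (hU.mem_nhds hz)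
  have hB : IsPreconnected (P z ∪ closedBall z r) :=
    h3.union z h5 (mem_closedBall_self hr.le) (convex_closedBall z r).isPreconnected
  have hBc : IsCompact (P z ∪ closedBall z r) := h2.union (isCompact_closedBall z r)
  obtain ⟨M, hM, hMf, hM0⟩ := h' _ (union_subset h1 hrU) hBc (Or.inl h4)
  have hMz : ContinuousAt M z := by
    refine hM.continuousAt (mem_of_superset (closedBall_mem_nhds z hr) subset_union_right)
  refine (hMz.congr ?_).continuousWithinAt
  filter_upwards [closedBall_mem_nhds z hr] with w hw
  have hwU := hrU hw
  obtain ⟨g1, g2, g3, g4, g5⟩ := hP w hwU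
  obtain ⟨k1, k2, k3⟩ := hL w hwU
  obtain ⟨N, hN, hNf, hN0⟩ := h' (P w ∪ (P z ∪ closedBall z r))
    (union_subset g1 (union_subset h1 hrU)) (g2.union hBc) (Or.inl g4)
  have e1 := eqOn_add_const_of_exp_eq g3 k1 (hN.mono subset_union_left)
    (fun x hx => (k2 x hx).trans (hNf x (Or.inl hx)).symm) g4 g5
  have e2 := eqOn_add_const_of_exp_eq hB hM (hN.mono subset_union_right)
    (fun x hx => (hMf x hx).trans (hNf x (Or.inr hx)).symm) (Or.inl h4) (Or.inr hw)
  rw [k3, hN0, sub_self] at e1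
  rw [hM0, hN0, sub_self] at e2
  linear_combination e1 - e2

section FilledDomain

variable {X : Type*} [TopologicalSpace X] {e : ℂ → X} {p : X} {U : Set X}

lemma isConnected_preimage_chart (he : IsOpenEmbedding e) (hr : range e = {p}ᶜ)
    (hc : IsConnected U) (hp : p ∉ U) : IsConnected (e ⁻¹' U) := by
  have hsub : U ⊆ range e := by
    rw [hr]; intro x hx h; exact hp (h ▸ hx)
  have him : e '' (e ⁻¹' U) = U := image_preimage_eq_of_subset hsub
  refine ⟨?_, ?_⟩
  · obtain ⟨x, hx⟩ := hc.nonempty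
    obtain ⟨z, rfl⟩ := hsub hx
    exact ⟨z, hx⟩
  · rw [← he.isInducing.isPreconnected_image, him]
    exact hc.isPreconnected

/-- On a planar domain whose complement in the sphere is connected, every nonvanishing continuous
function has a logarithm. -/
theorem hasLogOn_of_isPreconnected_compl [CompactSpace X] [T2Space X] [LocallyConnectedSpace X]
    (he : IsOpenEmbedding e) (hr : range e = {p}ᶜ) (hU : IsOpen U) (hc : IsConnected U)
    (hcc : IsPreconnected Uᶜ) (hp : p ∉ U) {f : ℂ → ℂ} (hf : ContinuousOn f (e ⁻¹' U))
    (h0 : ∀ z ∈ e ⁻¹' U, f z ≠ 0) : HasLogOn f (e ⁻¹' U) := by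
  refine HasLogOn.of_forall_isCompact (hU.preimage he.continuous)
    (isConnected_preimage_chart he hr hc hp) fun K hKU hK => ?_
  have hKc : IsClosed (e '' K) := (hK.image he.continuous).isClosed
  have hpK : p ∈ (e '' K)ᶜ := by
    rintro ⟨z, -, hz⟩; exact chart_ne hr z hz
  set V := connectedComponentIn (e '' K)ᶜ p
  have hV : IsOpen V := hKc.isOpen_compl.connectedComponentIn
  have hpV : p ∈ V := mem_connectedComponentIn hpK
  have hUV : Uᶜ ⊆ V := by
    refine hcc.subset_connectedComponentIn hp ?_
    rintro x hx ⟨z, hz, rfl⟩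
    exact hx (hKU hz)
  have hVK : V ⊆ (e '' K)ᶜ := connectedComponentIn_subset _ _
  have hsub : e ⁻¹' Vᶜ ⊆ e ⁻¹' U := fun z hz => by
    by_contra h; exact hz (hUV h)
  have hcomp : IsCompact (e ⁻¹' Vᶜ) :=
    isCompact_preimage_chart he hr hV.isClosed_compl (fun h => h hpV)
  refine (HasLogOn.of_forall_sub hcomp (fun x hx => ?_) (hf.mono hsub)
    fun z hz => h0 z (hsub hz)).mono fun z hz hzV => hVK hzV (mem_image_of_mem e hz)
  refine HasLogOn.of_joinedOff he hr hV.isClosed_compl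
    ⟨V, isPreconnected_connectedComponentIn, by simp, ?_, hpV⟩
  by_contra h
  exact hx h

end FilledDomain

/-- A continuous logarithm of a holomorphic function is holomorphic. -/
lemma DifferentiableOn.of_exp_eq {U : Set ℂ} (hU : IsOpen U) {f L : ℂ → ℂ}
    (hf : DifferentiableOn ℂ f U) (hL : ContinuousOn L U)
    (h : ∀ z ∈ U, Complex.exp (L z) = f z) : DifferentiableOn ℂ L U := by
  intro z hz
  have hne : f z ≠ 0 := by rw [← h z hz]; exact Complex.exp_ne_zero _
  have hfz : DifferentiableAt ℂ f z := hf.differentiableAt (hU.mem_nhds hz)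
  have hLz : ContinuousAt L z := hL.continuousAt (hU.mem_nhds hz)
  have hd : DifferentiableAt ℂ (fun w => Complex.log (f w / f z) + L z) z := by
    refine (DifferentiableAt.clog (hfz.div_const _) ?_).add_const _
    rw [div_self hne]; exact Complex.one_mem_slitPlane
  refine (hd.congr_of_eventuallyEq ?_).differentiableWithinAt
  have hn : ∀ᶠ w in 𝓝 z, L w ∈ ball (L z) 1 := hLz (Metric.ball_mem_nhds _ one_pos)
  filter_upwards [hU.mem_nhds hz, hn] with w hw hwn
  have him : |(L w - L z).im| < 1 := by
    rw [mem_ball, dist_eq_norm] at hwn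
    exact (Complex.abs_im_le_norm _).trans_lt hwn
  rw [abs_lt] at him
  rw [← h w hw, ← h z hz, ← Complex.exp_sub, Complex.log_exp]
  · ring
  · linarith [Real.pi_gt_three]
  · linarith [Real.pi_gt_three]

/-- Every nonvanishing continuous function on `U` has a continuous logarithm. -/
def HasLogs (U : Set ℂ) : Prop :=
  ∀ f : ℂ → ℂ, ContinuousOn f U → (∀ z ∈ U, f z ≠ 0) → HasLogOn f U

lemma HasLogs.exists_sq_eq {U : Set ℂ} (hU : IsOpen U) (hlog : HasLogs U) {f : ℂ → ℂ}
    (hf : DifferentiableOn ℂ f U) (h0 : ∀ z ∈ U, f z ≠ 0) :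
    ∃ s : ℂ → ℂ, DifferentiableOn ℂ s U ∧ ∀ z ∈ U, s z ^ 2 = f z := by
  obtain ⟨L, hL, h⟩ := hlog f hf.continuousOn h0
  have hLd := DifferentiableOn.of_exp_eq hU hf hL h
  refine ⟨fun z => Complex.exp (L z / 2), (hLd.div_const 2).cexp, fun z hz => ?_⟩
  rw [← Complex.exp_nat_mul, ← h z hz]
  congr 1
  push_cast
  ring

lemma isOpen_image_of_injOn {U : Set ℂ} (hU : IsOpen U) (hc : IsConnected U) {f : ℂ → ℂ}
    (hf : DifferentiableOn ℂ f U) (hi : InjOn f U) {s : Set ℂ} (hs : s ⊆ U) (hso : IsOpen s) :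
    IsOpen (f '' s) := by
  rcases (hf.analyticOnNhd hU).is_constant_or_isOpen hc.isPreconnected with ⟨w, hw⟩ | h
  · exfalso
    obtain ⟨z, hz⟩ := hc.nonempty
    obtain ⟨r, hr, hrU⟩ := Metric.isOpen_iff.1 hU z hz
    have h1 : z + (r / 2 : ℝ) ∈ U := hrU (by
      rw [mem_ball, dist_eq_norm, add_sub_cancel_left, Complex.norm_real, Real.norm_of_nonneg (by positivity)]
      linarith)
    have h2 := hi h1 hz ((hw _ h1).trans (hw _ hz).symm)
    have : ((r / 2 : ℝ) : ℂ) = 0 := by linear_combination h2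
    rw [Complex.ofReal_eq_zero] at this
    linarith
  · exact h s hs hso

/-- A domain with logarithms other than the plane carries a bounded injective holomorphic function
of the form `1 / (√(z - a) - c)`. -/
lemma HasLogs.exists_bounded_injOn {U : Set ℂ} (hU : IsOpen U) (hc : IsConnected U)
    (hlog : HasLogs U) {a : ℂ} (ha : a ∉ U) :
    ∃ (β : ℂ → ℂ) (c : ℂ) (M : ℝ), DifferentiableOn ℂ β U ∧ InjOn β U ∧ (∀ z ∈ U, ‖β z‖ ≤ M) ∧
      ∀ z ∈ U, β z ≠ 0 ∧ z = a + (c + (β z)⁻¹) ^ 2 := by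
  have hne : ∀ z ∈ U, z - a ≠ 0 := fun z hz h => ha (sub_eq_zero.1 h ▸ hz)
  obtain ⟨s, hs, hsq⟩ := hlog.exists_sq_eq hU (f := fun z => z - a) (by fun_prop) hne
  have hinj : InjOn s U := by
    intro z hz w hw h
    have h1 := hsq z hz
    have h2 := hsq w hw
    rw [h] at h1
    linear_combination h2 - h1
  obtain ⟨z₀, hz₀⟩ := hc.nonempty
  obtain ⟨r, hr, hball⟩ := Metric.isOpen_iff.1 (isOpen_image_of_injOn hU hc hs hinj subset_rfl hU)
    (s z₀) (mem_image_of_mem s hz₀)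
  have hfar : ∀ z ∈ U, r ≤ ‖s z - -s z₀‖ := by
    intro z hz
    by_contra! h
    obtain ⟨w, hw, hsw⟩ := hball (a := - s z) (by
      rwa [mem_ball, dist_eq_norm, ← norm_neg, show -(-s z - s z₀) = s z - -s z₀ by ring])
    have h1 := hsq z hz
    have h2 := hsq w hw
    rw [hsw] at h2
    have h3 : w = z := by linear_combination h1 - h2
    rw [h3] at hsw
    have h4 : s z = 0 := by linear_combination hsw / 2
    rw [h4] at h1
    exact hne z hz (by rw [← h1]; simp)
  have hs0 : ∀ z ∈ U, s z - -s z₀ ≠ 0 := fun z hz =>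
    norm_pos_iff.1 (hr.trans_le (hfar z hz))
  refine ⟨fun z => (s z - -s z₀)⁻¹, -s z₀, r⁻¹, (hs.sub_const _).inv hs0, ?_, ?_, ?_⟩
  · intro z hz w hw h
    exact hinj hz hw (sub_left_injective (inv_injective h))
  · intro z hz
    rw [norm_inv]
    exact inv_anti₀ hr (hfar z hz)
  · intro z hz
    refine ⟨inv_ne_zero (hs0 z hz), ?_⟩
    rw [inv_inv]
    linear_combination - hsq z hz

/-- The normalised injective holomorphic maps into the unit disc. -/
def discMaps (U : Set ℂ) (z₀ : ℂ) : Set (ℂ → ℂ) :=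
  {f | DifferentiableOn ℂ f U ∧ InjOn f U ∧ MapsTo f U (ball 0 1) ∧ f z₀ = 0}

/-- Locally uniform Lipschitz bound for holomorphic maps into the unit disc. -/
lemma norm_sub_le_of_mapsTo_ball {U : Set ℂ} {f : ℂ → ℂ} (hf : DifferentiableOn ℂ f U)
    (hm : MapsTo f U (ball 0 1)) {z : ℂ} {r : ℝ} (hr : 0 < r) (hrU : ball z (2 * r) ⊆ U)
    {x y : ℂ} (hx : x ∈ ball z r) (hy : y ∈ ball z r) : ‖f x - f y‖ ≤ 2 / r * ‖x - y‖ := by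
  have hsub : ∀ w ∈ ball z r, closedBall w (r / 2) ⊆ ball z (2 * r) := by
    intro w hw v hv
    rw [mem_ball] at *
    rw [mem_closedBall] at hv
    have := dist_triangle v w z
    linarith
  refine Convex.norm_image_sub_le_of_norm_deriv_le (𝕜 := ℂ) (s := ball z r) (fun w hw => ?_)
    (fun w hw => ?_) (convex_ball z r) hy hx
  · exact hf.differentiableAt (mem_of_superset (isOpen_ball.mem_nhds hw)
      ((ball_subset_ball (by linarith)).trans hrU))
  · have h := Complex.norm_deriv_le_of_forall_mem_sphere_norm_le (c := w) (R := r / 2) (C := 1) (f := f)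
      (by positivity) ?_ ?_
    · rw [one_div_div] at h
      exact h
    · refine DifferentiableOn.diffContOnCl (hf.mono ?_)
      rw [closure_ball _ (by positivity)]
      exact (hsub w hw).trans hrU
    · intro v hv
      exact (mem_ball_zero_iff.1 (hm (hrU (hsub w hw (sphere_subset_closedBall hv))))).le

/-- Ultrafilter version of Montel's theorem for maps into the unit disc. -/
lemma exists_tendstoLocallyUniformlyOn {U : Set ℂ} (hU : IsOpen U) {F : ℕ → ℂ → ℂ}
    (hF : ∀ n, DifferentiableOn ℂ (F n) U) (hm : ∀ n, MapsTo (F n) U (ball 0 1))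
    (l : Ultrafilter ℕ) :
    ∃ g : ℂ → ℂ, TendstoLocallyUniformlyOn F g l U ∧ ∀ z ∈ U, ‖g z‖ ≤ 1 := by
  have hg : ∀ z : ℂ, ∃ y : ℂ, z ∈ U → ‖y‖ ≤ 1 ∧ Tendsto (fun n => F n z) l (𝓝 y) := by
    intro z
    by_cases hz : z ∈ U
    · obtain ⟨y, hy, hly⟩ := (isCompact_closedBall (0 : ℂ) 1).ultrafilter_le_nhds
        (l.map fun n => F n z) (by
          rw [le_principal_iff, Ultrafilter.mem_coe, Ultrafilter.mem_map]
          exact Filter.univ_mem' fun n => ball_subset_closedBall (hm n hz))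
      exact ⟨y, fun _ => ⟨mem_closedBall_zero_iff.1 hy, hly⟩⟩
    · exact ⟨0, fun h => absurd h hz⟩
  choose g hg using hg
  refine ⟨g, ?_, fun z hz => (hg z hz).1⟩
  rw [Metric.tendstoLocallyUniformlyOn_iff]
  intro ε hε z hz
  obtain ⟨R, hR, hRU⟩ := Metric.isOpen_iff.1 hU z hz
  obtain ⟨r, hr, hrR⟩ : ∃ r > 0, 2 * r = R := ⟨R / 2, by positivity, by ring⟩
  have hrU : ball z (2 * r) ⊆ U := by rw [hrR]; exact hRU
  have hb : ball z r ⊆ U := (ball_subset_ball (by linarith)).trans hrU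
  have hlip : ∀ n, ∀ x ∈ ball z r, ‖F n x - F n z‖ ≤ 2 / r * ‖x - z‖ := fun n x hx =>
    norm_sub_le_of_mapsTo_ball (hF n) (hm n) hr hrU hx (mem_ball_self hr)
  have hlipg : ∀ x ∈ ball z r, ‖g x - g z‖ ≤ 2 / r * ‖x - z‖ := fun x hx =>
    le_of_tendsto (((hg x (hb hx)).2.sub (hg z hz).2).norm) (Eventually.of_forall fun n => hlip n x hx)
  set δ := min r (ε * r / 8) with hδ
  have hδ0 : 0 < δ := lt_min hr (by positivity)
  refine ⟨ball z δ, mem_nhdsWithin_of_mem_nhds (ball_mem_nhds z hδ0), ?_⟩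
  have h1 : ∀ᶠ n in (l : Filter ℕ), dist (F n z) (g z) < ε / 4 :=
    (hg z hz).2 (Metric.ball_mem_nhds _ (by positivity))
  filter_upwards [h1] with n hn x hx
  have hxr : x ∈ ball z r := ball_subset_ball (min_le_left _ _) hx
  have h2 : 2 / r * ‖x - z‖ ≤ ε / 4 := by
    rw [mem_ball, dist_eq_norm] at hx
    have h3 : ‖x - z‖ ≤ ε * r / 8 := hx.le.trans (min_le_right _ _)
    calc 2 / r * ‖x - z‖ ≤ 2 / r * (ε * r / 8) := by gcongr
      _ = ε / 4 := by field_simp; norm_num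
  have h4 := (hlip n x hxr).trans h2
  have h5 := (hlipg x hxr).trans h2
  rw [← dist_eq_norm] at h4 h5
  have h6 := dist_triangle4 (g x) (g z) (F n z) (F n x)
  rw [dist_comm (g z), dist_comm (F n z) (F n x)] at h6
  linarith

/-- Ultrafilter version of Hurwitz's theorem: a nonconstant locally uniform limit of injective
holomorphic functions is injective. -/
lemma injOn_of_tendstoLocallyUniformlyOn {U : Set ℂ} (hU : IsOpen U) (hc : IsConnected U)
    {F : ℕ → ℂ → ℂ} (hF : ∀ n, DifferentiableOn ℂ (F n) U) (hi : ∀ n, InjOn (F n) U)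
    {l : Filter ℕ} [l.NeBot] {g : ℂ → ℂ} (hg : TendstoLocallyUniformlyOn F g l U)
    (hnc : ¬ ∃ w, ∀ z ∈ U, g z = w) : InjOn g U := by
  have hgd : DifferentiableOn ℂ g U :=
    hg.differentiableOn (Eventually.of_forall hF) hU
  have hga := hgd.analyticOnNhd hU
  intro z₁ hz₁ z₂ hz₂ h12
  by_contra hne
  rcases (hga z₂ hz₂).eventually_eq_or_eventually_ne (analyticAt_const (v := g z₂)) with h | h
  · exact hnc ⟨g z₂, hga.eqOn_of_preconnected_of_eventuallyEq analyticOnNhd_const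
      hc.isPreconnected hz₂ h⟩
  rw [eventually_nhdsWithin_iff] at h
  have h1 : ∀ᶠ z in 𝓝 z₂, z ∈ U ∧ z ≠ z₁ ∧ (z ∈ ({z₂} : Set ℂ)ᶜ → g z ≠ g z₂) := by
    filter_upwards [hU.mem_nhds hz₂, isOpen_ne.mem_nhds (Ne.symm hne), h] with z a b c
    exact ⟨a, b, c⟩
  obtain ⟨ρ, hρ, hball⟩ := Metric.nhds_basis_closedBall.mem_iff.1 h1
  have hcU : closedBall z₂ ρ ⊆ U := fun z hz => (hball hz).1
  have hsU : sphere z₂ ρ ⊆ U := sphere_subset_closedBall.trans hcU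
  have hsne : (sphere z₂ ρ).Nonempty := NormedSpace.sphere_nonempty.2 hρ.le
  obtain ⟨y, hy, hmin⟩ := (isCompact_sphere z₂ ρ).exists_isMinOn hsne
    (f := fun z => ‖g z - g z₂‖) ((hgd.continuousOn.mono hsU).sub continuousOn_const).norm
  set m := ‖g y - g z₂‖ with hm
  have hm0 : 0 < m := by
    rw [hm, norm_pos_iff, sub_ne_zero]
    refine (hball (sphere_subset_closedBall hy)).2.2 fun h => ?_
    rw [mem_singleton_iff] at h
    rw [h, mem_sphere, dist_self] at hy
    exact hρ.ne hy
  have hK : IsCompact (insert z₁ (closedBall z₂ ρ)) := (isCompact_closedBall z₂ ρ).insert z₁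
  have hunif := (tendstoLocallyUniformlyOn_iff_forall_isCompact hU).1 hg _
    (insert_subset hz₁ hcU) hK
  obtain ⟨n, hn⟩ := (Metric.tendstoUniformlyOn_iff.1 hunif (m / 16) (by positivity)).exists
  simp only [dist_eq_norm] at hn
  have hn2 := hn z₂ (Or.inr (mem_closedBall_self hρ.le))
  have hn1 := hn z₁ (Or.inl rfl)
  have hd : DiffContOnCl ℂ (F n) (ball z₂ ρ) := by
    refine DifferentiableOn.diffContOnCl ((hF n).mono ?_)
    rwa [closure_ball _ hρ.ne']
  have hsub := hd.ball_subset_image_closedBall (ε := m / 2) hρ (fun z hz => ?_) ?_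
  · obtain ⟨w, hw, hwz⟩ := hsub (a := F n z₁) (by
      rw [mem_ball, dist_eq_norm]
      calc ‖F n z₁ - F n z₂‖ = ‖(g z₂ - F n z₂) - (g z₁ - F n z₁)‖ := by rw [h12]; congr 1; ring
        _ ≤ ‖g z₂ - F n z₂‖ + ‖g z₁ - F n z₁‖ := norm_sub_le _ _
        _ < m / 2 / 2 := by linarith)
    have := hi n (hcU hw) hz₁ hwz
    exact (hball hw).2.1 this
  · have h2 : m ≤ ‖g z - g z₂‖ := hmin hz
    have h3 := hn z (Or.inr (sphere_subset_closedBall hz))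
    have h4 : ‖g z - g z₂‖ ≤ ‖F n z - F n z₂‖ + ‖g z - F n z‖ + ‖g z₂ - F n z₂‖ := by
      calc ‖g z - g z₂‖ = ‖((F n z - F n z₂) + (g z - F n z)) - (g z₂ - F n z₂)‖ := by
            congr 1; ring
        _ ≤ _ := (norm_sub_le _ _).trans (by gcongr; exact norm_add_le _ _)
    linarith
  · have hev : ∀ᶠ z in 𝓝[≠] z₂, F n z ≠ F n z₂ := by
      filter_upwards [mem_nhdsWithin_of_mem_nhds (hU.mem_nhds hz₂), self_mem_nhdsWithin]
        with z hzU hz h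
      exact hz (hi n hzU hz₂ h)
    exact hev.frequently.filter_mono nhdsWithin_le_nhds

/-- The extremal problem for normalised disc maps has a solution. -/
lemma exists_extremal_discMap {U : Set ℂ} (hU : IsOpen U) (hc : IsConnected U) {z₀ : ℂ}
    (hz₀ : z₀ ∈ U) (h : ∃ f ∈ discMaps U z₀, deriv f z₀ ≠ 0) :
    ∃ g ∈ discMaps U z₀, deriv g z₀ ≠ 0 ∧ ∀ f ∈ discMaps U z₀, ‖deriv f z₀‖ ≤ ‖deriv g z₀‖ := by
  obtain ⟨f₀, hf₀, hd₀⟩ := h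
  obtain ⟨r, hr, hrU⟩ := Metric.nhds_basis_closedBall.mem_iff.1 (hU.mem_nhds hz₀)
  set S : Set ℝ := (fun f : ℂ → ℂ => ‖deriv f z₀‖) '' discMaps U z₀ with hS
  have hSb : BddAbove S := by
    refine ⟨1 / r, ?_⟩
    rintro _ ⟨f, ⟨hf, -, hm, -⟩, rfl⟩
    refine Complex.norm_deriv_le_of_forall_mem_sphere_norm_le hr ?_ ?_
    · refine DifferentiableOn.diffContOnCl (hf.mono ?_)
      rwa [closure_ball _ hr.ne']
    · intro v hv
      exact (mem_ball_zero_iff.1 (hm (hrU (sphere_subset_closedBall hv)))).le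
  have hSne : S.Nonempty := ⟨_, f₀, hf₀, rfl⟩
  have hpos : 0 < sSup S := (norm_pos_iff.2 hd₀).trans_le (le_csSup hSb ⟨f₀, hf₀, rfl⟩)
  obtain ⟨u, -, hu, huS⟩ := exists_seq_tendsto_sSup hSne hSb
  choose F hF hFu using huS
  obtain ⟨g, hg, hg1⟩ := exists_tendstoLocallyUniformlyOn hU (fun n => (hF n).1)
    (fun n => (hF n).2.2.1) (Filter.hyperfilter ℕ)
  have hle : ((Filter.hyperfilter ℕ : Ultrafilter ℕ) : Filter ℕ) ≤ atTop := by
    rw [← Nat.cofinite_eq_atTop]; exact Filter.hyperfilter_le_cofinite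
  have hgd : DifferentiableOn ℂ g U :=
    hg.differentiableOn (Eventually.of_forall fun n => (hF n).1) hU
  have hder := (hg.deriv (Eventually.of_forall fun n => (hF n).1) hU).tendsto_at hz₀
  have hsup : ‖deriv g z₀‖ = sSup S := by
    refine tendsto_nhds_unique hder.norm ((hu.mono_left hle).congr fun n => ?_)
    rw [← hFu n]; rfl
  have hnc : ¬ ∃ w, ∀ z ∈ U, g z = w := by
    rintro ⟨w, hw⟩
    have : deriv g z₀ = 0 := by
      have he : g =ᶠ[𝓝 z₀] fun _ => w := by
        filter_upwards [hU.mem_nhds hz₀] with z hz using hw z hz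
      rw [he.deriv_eq]; simp
    rw [this, norm_zero] at hsup
    exact hpos.ne hsup
  have hgi : InjOn g U := injOn_of_tendstoLocallyUniformlyOn hU hc (fun n => (hF n).1)
    (fun n => (hF n).2.1) hg hnc
  refine ⟨g, ⟨hgd, hgi, ?_, ?_⟩, ?_, ?_⟩
  · have ho := isOpen_image_of_injOn hU hc hgd hgi subset_rfl hU
    have hsub : g '' U ⊆ interior (closedBall 0 1) := by
      refine interior_maximal ?_ ho
      rintro _ ⟨z, hz, rfl⟩
      exact mem_closedBall_zero_iff.2 (hg1 z hz)
    rw [interior_closedBall _ one_ne_zero] at hsub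
    exact mapsTo_iff_image_subset.2 hsub
  · refine tendsto_nhds_unique (hg.tendsto_at hz₀) ?_
    simp only [fun n => (hF n).2.2.2]
    exact tendsto_const_nhds
  · rw [← norm_pos_iff, hsup]; exact hpos
  · intro f hf
    rw [hsup]
    exact le_csSup hSb ⟨f, hf, rfl⟩

section DiscAutomorphism

open ComplexConjugate

/-- The disc automorphism exchanging `w` and `0` up to sign. -/
noncomputable def discShift (w z : ℂ) : ℂ := (z - w) / (1 - conj w * z)

variable {w z : ℂ}

lemma discShift_denom_ne (hw : ‖w‖ < 1) (hz : ‖z‖ < 1) : 1 - conj w * z ≠ 0 := by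
  intro h
  have h1 : ‖conj w * z‖ = 1 := by
    rw [← sub_eq_zero.1 h, norm_one]
  rw [norm_mul, Complex.norm_conj] at h1
  nlinarith [norm_nonneg w, norm_nonneg z]

lemma norm_discShift_lt (hw : ‖w‖ < 1) (hz : ‖z‖ < 1) : ‖discShift w z‖ < 1 := by
  have h0 := discShift_denom_ne hw hz
  rw [discShift, norm_div, div_lt_one (norm_pos_iff.2 h0)]
  have h1 : Complex.normSq w < 1 := by
    rw [Complex.normSq_eq_norm_sq]; nlinarith [norm_nonneg w]
  have h2 : Complex.normSq z < 1 := by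
    rw [Complex.normSq_eq_norm_sq]; nlinarith [norm_nonneg z]
  have h3 : Complex.normSq (1 - conj w * z) - Complex.normSq (z - w) =
      (1 - Complex.normSq w) * (1 - Complex.normSq z) := by
    simp only [Complex.normSq_apply, Complex.sub_re, Complex.sub_im, Complex.mul_re,
      Complex.mul_im, Complex.conj_re, Complex.conj_im, Complex.one_re, Complex.one_im]
    ring
  have h4 : 0 < (1 - Complex.normSq w) * (1 - Complex.normSq z) :=
    mul_pos (by linarith) (by linarith)
  rw [← abs_norm, ← abs_norm (1 - conj w * z), ← sq_lt_sq, ← Complex.normSq_eq_norm_sq,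
    ← Complex.normSq_eq_norm_sq]
  linarith

lemma injOn_discShift (hw : ‖w‖ < 1) : InjOn (discShift w) (ball 0 1) := by
  intro z hz z' hz' h
  rw [mem_ball_zero_iff] at hz hz'
  rw [discShift, discShift, div_eq_div_iff (discShift_denom_ne hw hz) (discShift_denom_ne hw hz')] at h
  have h1 : (z - z') * (1 - conj w * w) = 0 := by linear_combination h
  rcases mul_eq_zero.1 h1 with h2 | h2
  · exact sub_eq_zero.1 h2
  · exact absurd h2 (discShift_denom_ne hw hw)

lemma hasDerivAt_discShift (hw : ‖w‖ < 1) (hz : ‖z‖ < 1) :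
    HasDerivAt (discShift w) ((1 - conj w * w) / (1 - conj w * z) ^ 2) z := by
  have h := ((hasDerivAt_id z).sub_const w).div
    (((hasDerivAt_id z).const_mul (conj w)).const_sub 1) (discShift_denom_ne hw hz)
  have e : (1 - conj w * w) / (1 - conj w * z) ^ 2 = (1 * (1 - conj w * id z) -
      (id z - w) * -(conj w * 1)) / (1 - conj w * id z) ^ 2 := by
    simp only [id]; ring
  rw [e]
  exact h

/-- The square root trick: a normalised disc map omitting a value is not extremal. -/
lemma HasLogs.exists_larger_deriv {U : Set ℂ} (hU : IsOpen U) (hlog : HasLogs U) {z₀ : ℂ}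
    (hz₀ : z₀ ∈ U) {g : ℂ → ℂ} (hg : g ∈ discMaps U z₀) (hd : deriv g z₀ ≠ 0)
    (hw : ‖w‖ < 1) (hwg : w ∉ g '' U) :
    ∃ f ∈ discMaps U z₀, ‖deriv g z₀‖ < ‖deriv f z₀‖ := by
  obtain ⟨hgd, hgi, hgm, hg0⟩ := hg
  have hgn : ∀ z ∈ U, ‖g z‖ < 1 := fun z hz => mem_ball_zero_iff.1 (hgm hz)
  have hne : ∀ z ∈ U, discShift w (g z) ≠ 0 := by
    intro z hz h
    rw [discShift, div_eq_zero_iff, or_iff_left (discShift_denom_ne hw (hgn z hz)),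
      sub_eq_zero] at h
    exact hwg ⟨z, hz, h⟩
  have hga : ∀ z ∈ U, HasDerivAt g (deriv g z) z := fun z hz =>
    (hgd.differentiableAt (hU.mem_nhds hz)).hasDerivAt
  have hT : DifferentiableOn ℂ (fun z => discShift w (g z)) U := fun z hz =>
    ((hasDerivAt_discShift hw (hgn z hz)).comp z (hga z hz)).differentiableAt.differentiableWithinAt
  obtain ⟨s, hs, hsq⟩ := hlog.exists_sq_eq hU hT hne
  have hsn : ∀ z ∈ U, ‖s z‖ < 1 := by
    intro z hz
    have h1 : ‖s z‖ ^ 2 < 1 := by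
      rw [← norm_pow, hsq z hz]; exact norm_discShift_lt hw (hgn z hz)
    by_contra! h
    nlinarith
  have hsa : ∀ z ∈ U, HasDerivAt s (deriv s z) z := fun z hz =>
    (hs.differentiableAt (hU.mem_nhds hz)).hasDerivAt
  set b := s z₀ with hb
  have hbn : ‖b‖ < 1 := hsn z₀ hz₀
  have hb2 : b ^ 2 = -w := by rw [hb, hsq z₀ hz₀, hg0, discShift]; simp
  have hb0 : b ≠ 0 := by
    intro h
    have : s z₀ ^ 2 ≠ 0 := by rw [hsq z₀ hz₀]; exact hne z₀ hz₀
    rw [← hb, h] at this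
    simp at this
  have hder : 2 * b * deriv s z₀ = (1 - conj w * w) * deriv g z₀ := by
    have h1 : HasDerivAt (fun z => s z ^ 2) (2 * b * deriv s z₀) z₀ := by
      simpa using (hsa z₀ hz₀).fun_pow 2
    have h2 := (hasDerivAt_discShift hw (hgn z₀ hz₀)).comp z₀ (hga z₀ hz₀)
    rw [hg0] at h2
    have h3 : (fun z => s z ^ 2) =ᶠ[𝓝 z₀] discShift w ∘ g := by
      filter_upwards [hU.mem_nhds hz₀] with z hz using hsq z hz
    have := h1.unique (h2.congr_of_eventuallyEq h3)
    rw [this]; simp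
  have hGd := (hasDerivAt_discShift hbn hbn).comp z₀ (hsa z₀ hz₀)
  refine ⟨fun z => discShift b (s z), ⟨?_, ?_, ?_, ?_⟩, ?_⟩
  · exact fun z hz => ((hasDerivAt_discShift hbn (hsn z hz)).comp z
      (hsa z hz)).differentiableAt.differentiableWithinAt
  · intro z hz z' hz' h
    have h1 := injOn_discShift hbn (mem_ball_zero_iff.2 (hsn z hz))
      (mem_ball_zero_iff.2 (hsn z' hz')) h
    have h2 := hsq z hz
    rw [h1, hsq z' hz'] at h2
    exact (hgi hz' hz (injOn_discShift hw (hgm hz') (hgm hz) h2)).symm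
  · exact fun z hz => mem_ball_zero_iff.2 (norm_discShift_lt hbn (hsn z hz))
  · simp [← hb, discShift]
  · have h1 : deriv (fun z => discShift b (s z)) z₀ = _ := hGd.deriv
    rw [h1]
    have hbb : 1 - conj b * b = ((1 - ‖b‖ ^ 2 : ℝ) : ℂ) := by
      rw [Complex.conj_mul']; push_cast; ring
    have hww : 1 - conj w * w = ((1 - ‖b‖ ^ 4 : ℝ) : ℂ) := by
      have : ‖w‖ = ‖b‖ ^ 2 := by rw [← norm_pow, hb2, norm_neg]
      rw [Complex.conj_mul', this]; push_cast; ring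
    have hbp : 0 < ‖b‖ := norm_pos_iff.2 hb0
    have hpos : 0 < 1 - ‖b‖ ^ 2 := by nlinarith
    have hn : 2 * ‖b‖ * ‖deriv s z₀‖ = (1 - ‖b‖ ^ 4) * ‖deriv g z₀‖ := by
      have := congrArg norm hder
      rw [hww, norm_mul, norm_mul, norm_mul, Complex.norm_real,
        Real.norm_of_nonneg (by nlinarith : 0 ≤ 1 - ‖b‖ ^ 4)] at this
      simpa using this
    have hdp : 0 < ‖deriv g z₀‖ := norm_pos_iff.2 hd
    rw [norm_mul, norm_div, norm_pow, hbb, Complex.norm_real, Real.norm_of_nonneg hpos.le]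
    have h2 : (1 - ‖b‖ ^ 2) / (1 - ‖b‖ ^ 2) ^ 2 * ‖deriv s z₀‖ =
        (1 + ‖b‖ ^ 2) / (2 * ‖b‖) * ‖deriv g z₀‖ := by
      have h3 : ‖deriv s z₀‖ = (1 - ‖b‖ ^ 4) * ‖deriv g z₀‖ / (2 * ‖b‖) := by
        rw [← hn]; field_simp
      rw [h3]
      have h4 : (1 - ‖b‖ ^ 4) = (1 - ‖b‖ ^ 2) * (1 + ‖b‖ ^ 2) := by ring
      rw [h4]
      field_simp
    rw [h2]
    have h5 : 1 < (1 + ‖b‖ ^ 2) / (2 * ‖b‖) := by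
      rw [one_lt_div (by positivity)]; nlinarith [sq_pos_of_pos (sub_pos.2 hbn)]
    nlinarith

end DiscAutomorphism

/-- The inverse of an injective holomorphic function is holomorphic. -/
lemma differentiableOn_of_leftInvOn {U : Set ℂ} (hU : IsOpen U) (hc : IsConnected U) {g φ : ℂ → ℂ}
    (hg : DifferentiableOn ℂ g U) (hi : InjOn g U) (hφ : ∀ z ∈ U, φ (g z) = z) :
    DifferentiableOn ℂ φ (g '' U) := by
  have hopen : ∀ s ⊆ U, IsOpen s → IsOpen (g '' s) := fun s hs hso =>
    isOpen_image_of_injOn hU hc hg hi hs hso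
  have hcont : ∀ z ∈ U, ContinuousAt φ (g z) := by
    intro z hz N hN
    rw [hφ z hz] at hN
    obtain ⟨O, hON, hO, hzO⟩ := _root_.mem_nhds_iff.1 hN
    rw [mem_map]
    filter_upwards [(hopen (O ∩ U) inter_subset_right (hO.inter hU)).mem_nhds ⟨z, ⟨hzO, hz⟩, rfl⟩]
    rintro _ ⟨v, hv, rfl⟩
    rw [mem_preimage, hφ v hv.2]
    exact hON hv.1
  have hdiff : ∀ z ∈ U, deriv g z ≠ 0 → DifferentiableAt ℂ φ (g z) := by
    intro z hz hd
    have h1 : HasDerivAt g (deriv g z) (φ (g z)) := by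
      rw [hφ z hz]; exact (hg.differentiableAt (hU.mem_nhds hz)).hasDerivAt
    refine (HasDerivAt.of_local_left_inverse (hcont z hz) h1 hd ?_).differentiableAt
    filter_upwards [(hopen U subset_rfl hU).mem_nhds ⟨z, hz, rfl⟩]
    rintro _ ⟨v, hv, rfl⟩
    rw [hφ v hv]
  rintro _ ⟨z, hz, rfl⟩
  refine (Complex.analyticAt_of_differentiable_on_punctured_nhds_of_continuousAt ?_
    (hcont z hz)).differentiableAt.differentiableWithinAt
  have hga : AnalyticOnNhd ℂ (deriv g) U := (hg.analyticOnNhd hU).deriv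
  rcases (hga z hz).eventually_eq_zero_or_eventually_ne_zero with h | h
  · exfalso
    have h0 := hga.eqOn_zero_of_preconnected_of_eventuallyEq_zero hc.isPreconnected hz h
    obtain ⟨r, hr, hrU⟩ := Metric.isOpen_iff.1 hU z hz
    have h1 : z + (r / 2 : ℝ) ∈ U := hrU (by
      rw [mem_ball, dist_eq_norm, add_sub_cancel_left, Complex.norm_real,
        Real.norm_of_nonneg (by positivity)]
      linarith)
    have h2 := hi h1 hz (hU.is_const_of_deriv_eq_zero hc.isPreconnected hg h0 h1 hz)
    have : ((r / 2 : ℝ) : ℂ) = 0 := by linear_combination h2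
    rw [Complex.ofReal_eq_zero] at this
    linarith
  · rw [eventually_nhdsWithin_iff] at h ⊢
    have h2 : Tendsto φ (𝓝 (g z)) (𝓝 z) := by
      have := hcont z hz
      rwa [ContinuousAt, hφ z hz] at this
    filter_upwards [h2.eventually h, (hopen U subset_rfl hU).mem_nhds ⟨z, hz, rfl⟩]
    rintro _ hv ⟨v, hvU, rfl⟩ hne
    rw [hφ v hvU] at hv
    refine hdiff v hvU (hv ?_)
    rintro rfl
    exact hne rfl

/-- The Riemann mapping theorem, together with a bounded injective function of the form
`1 / (√(z - a) - c)`, transported to the disc. -/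
theorem HasLogs.exists_riemannMap {U : Set ℂ} (hU : IsOpen U) (hc : IsConnected U)
    (hlog : HasLogs U) {a : ℂ} (ha : a ∉ U) :
    ∃ (φ g β : ℂ → ℂ) (c : ℂ) (M : ℝ), DifferentiableOn ℂ φ (ball 0 1) ∧ ContinuousOn g U ∧
      MapsTo φ (ball 0 1) U ∧ MapsTo g U (ball 0 1) ∧ (∀ z ∈ U, φ (g z) = z) ∧
      (∀ w ∈ ball (0 : ℂ) 1, g (φ w) = w) ∧
      DifferentiableOn ℂ β (ball 0 1) ∧ InjOn β (ball 0 1) ∧ (∀ w ∈ ball (0 : ℂ) 1, ‖β w‖ ≤ M) ∧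
      ∀ w ∈ ball (0 : ℂ) 1, β w ≠ 0 ∧ φ w = a + (c + (β w)⁻¹) ^ 2 := by
  obtain ⟨β, c, M, hβd, hβi, hβM, hβ⟩ := hlog.exists_bounded_injOn hU hc ha
  obtain ⟨z₀, hz₀, hd⟩ : ∃ z₀ ∈ U, deriv β z₀ ≠ 0 := by
    by_contra! h
    obtain ⟨z, hz⟩ := hc.nonempty
    have ho := isOpen_image_of_injOn hU hc hβd hβi subset_rfl hU
    have : β '' U = {β z} := by
      ext w
      constructor
      · rintro ⟨v, hv, rfl⟩
        exact hU.is_const_of_deriv_eq_zero hc.isPreconnected hβd h hv hz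
      · rintro rfl
        exact ⟨z, hz, rfl⟩
    rw [this] at ho
    exact not_isOpen_singleton _ ho
  have hM : 0 ≤ M := (norm_nonneg _).trans (hβM z₀ hz₀)
  have hk : ((2 * M + 1 : ℝ) : ℂ) ≠ 0 := by
    rw [Complex.ofReal_ne_zero]; positivity
  have hmem : (fun z => (β z - β z₀) / ((2 * M + 1 : ℝ) : ℂ)) ∈ discMaps U z₀ := by
    refine ⟨(hβd.sub_const _).div_const _, ?_, ?_, by simp⟩
    · intro z hz w hw h
      exact hβi hz hw (sub_left_injective ((div_left_inj' hk).1 h))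
    · intro z hz
      rw [mem_ball_zero_iff, norm_div, Complex.norm_real, Real.norm_of_nonneg (by positivity),
        div_lt_one (by positivity)]
      have := norm_sub_le (β z) (β z₀)
      linarith [hβM z hz, hβM z₀ hz₀]
  obtain ⟨g, hg, hgd, hext⟩ := exists_extremal_discMap hU hc hz₀ ⟨_, hmem, by
    rw [deriv_div_const, deriv_sub_const]
    exact div_ne_zero hd hk⟩
  have himg : g '' U = ball 0 1 := by
    refine Subset.antisymm (mapsTo_iff_image_subset.1 hg.2.2.1) fun w hw => ?_
    by_contra hwg
    obtain ⟨f, hf, hlt⟩ := hlog.exists_larger_deriv hU hz₀ hg hgd (mem_ball_zero_iff.1 hw) hwg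
    exact absurd (hext f hf) (not_le.2 hlt)
  have hinv : ∀ w : ℂ, ∃ z : ℂ, w ∈ ball (0 : ℂ) 1 → z ∈ U ∧ g z = w := by
    intro w
    by_cases hw : w ∈ ball (0 : ℂ) 1
    · have := hw
      rw [← himg] at this
      obtain ⟨z, hz, h⟩ := this
      exact ⟨z, fun _ => ⟨hz, h⟩⟩
    · exact ⟨0, fun h => absurd h hw⟩
  choose φ hφ using hinv
  have hφg : ∀ z ∈ U, φ (g z) = z := fun z hz =>
    hg.2.1 (hφ _ (hg.2.2.1 hz)).1 hz (hφ _ (hg.2.2.1 hz)).2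
  have hφd : DifferentiableOn ℂ φ (ball 0 1) := by
    rw [← himg]; exact differentiableOn_of_leftInvOn hU hc hg.1 hg.2.1 hφg
  have hφm : MapsTo φ (ball 0 1) U := fun w hw => (hφ w hw).1
  refine ⟨φ, g, fun w => β (φ w), c, M, hφd, hg.1.continuousOn, hφm, hg.2.2.1, hφg,
    fun w hw => (hφ w hw).2, hβd.comp hφd hφm, ?_, fun w hw => hβM _ (hφm hw),
    fun w hw => hβ _ (hφm hw)⟩
  intro w hw v hv h
  have := hβi (hφm hw) (hφm hv) h
  rw [← (hφ w hw).2, this, (hφ v hv).2]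

/-- The horizontal strip of height `π`. -/
def strip : Set ℂ := {w | w.im ∈ Ioo (-(Real.pi / 2)) (Real.pi / 2)}

lemma isOpen_strip : IsOpen strip := isOpen_Ioo.preimage Complex.continuous_im

section LengthArea

open MeasureTheory

lemma abs_det_smul_one (a : ℂ) : |(a • (1 : ℂ →L[ℝ] ℂ)).det| = ‖a‖ ^ 2 := by
  have h : (a • (1 : ℂ →L[ℝ] ℂ)).det = Algebra.norm ℝ a := by
    rw [Algebra.norm_apply]
    rfl
  rw [h, Algebra.norm_complex_apply, Complex.normSq_eq_norm_sq, abs_of_nonneg (by positivity)]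

/-- The area of the image of a bounded injective holomorphic function is finite. -/
lemma lintegral_norm_deriv_sq_lt_top {f : ℂ → ℂ} {S : Set ℂ} (hS : IsOpen S)
    (hf : DifferentiableOn ℂ f S) (hi : InjOn f S) {M : ℝ} (hM : ∀ w ∈ S, ‖f w‖ ≤ M) :
    ∫⁻ w in S, ENNReal.ofReal (‖deriv f w‖ ^ 2) < ⊤ := by
  have h := lintegral_image_eq_lintegral_abs_det_fderiv_mul (s := S) (f := f) volume
    hS.measurableSet (f' := fun w => deriv f w • (1 : ℂ →L[ℝ] ℂ))
    (fun w hw => (hf.differentiableAt (hS.mem_nhds hw)).hasDerivAt.complexToReal_fderiv.hasFDerivWithinAt)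
    hi (fun _ => 1)
  simp only [abs_det_smul_one, mul_one] at h
  rw [← h, setLIntegral_const, one_mul]
  have hsub : f '' S ⊆ closedBall 0 M := by
    rintro _ ⟨w, hw, rfl⟩
    exact mem_closedBall_zero_iff.2 (hM w hw)
  exact (measure_mono hsub).trans_lt measure_closedBall_lt_top

/-- Length bound from a bound of the energy along a vertical segment. -/
lemma norm_sub_le_of_lintegral_le {f : ℂ → ℂ} (hf : DifferentiableOn ℂ f strip) {t k : ℝ}
    (hk : 0 < k)
    (h : ∫⁻ y in Ioo (-(Real.pi / 2)) (Real.pi / 2), ENNReal.ofReal (‖deriv f ⟨t, y⟩‖ ^ 2) ≤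
      ENNReal.ofReal (k ^ 2)) {y₁ y₂ : ℝ} (h₁ : y₁ ∈ Ioo (-(Real.pi / 2)) (Real.pi / 2))
    (h₂ : y₂ ∈ Ioo (-(Real.pi / 2)) (Real.pi / 2)) (h12 : y₁ ≤ y₂) :
    ‖f ⟨t, y₂⟩ - f ⟨t, y₁⟩‖ ≤ 5 * k := by
  have hmk : ∀ y : ℝ, (⟨t, y⟩ : ℂ) = t + y * Complex.I := fun y => by
    apply Complex.ext <;> simp
  have hcm : Continuous fun y : ℝ => (⟨t, y⟩ : ℂ) := by
    simp only [hmk]; fun_prop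
  have hsub : Icc y₁ y₂ ⊆ Ioo (-(Real.pi / 2)) (Real.pi / 2) := fun y hy =>
    ⟨h₁.1.trans_le hy.1, hy.2.trans_lt h₂.2⟩
  have hstrip : ∀ y ∈ Icc y₁ y₂, (⟨t, y⟩ : ℂ) ∈ strip := fun y hy => hsub hy
  have hdc : ContinuousOn (deriv f) strip :=
    ((hf.analyticOnNhd isOpen_strip).deriv).continuousOn
  have hdc' : ContinuousOn (fun y : ℝ => deriv f ⟨t, y⟩) (Icc y₁ y₂) :=
    hdc.comp hcm.continuousOn hstrip
  have hder : ∀ y ∈ uIcc y₁ y₂, HasDerivAt (fun y : ℝ => f ⟨t, y⟩)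
      (deriv f ⟨t, y⟩ * Complex.I) y := by
    intro y hy
    rw [uIcc_of_le h12] at hy
    have h3 : HasDerivAt (fun y : ℝ => (⟨t, y⟩ : ℂ)) Complex.I y := by
      simp only [hmk]
      simpa using ((Complex.ofRealCLM.hasDerivAt (x := y)).mul_const Complex.I).const_add (t : ℂ)
    have h4 := (hf.differentiableAt (isOpen_strip.mem_nhds (hstrip y hy))).hasDerivAt
    exact h4.comp y h3
  have hci : ContinuousOn (fun y : ℝ => deriv f ⟨t, y⟩ * Complex.I) (uIcc y₁ y₂) := by
    rw [uIcc_of_le h12]; exact hdc'.mul continuousOn_const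
  rw [← intervalIntegral.integral_eq_sub_of_hasDerivAt hder hci.intervalIntegrable]
  have hcn : ContinuousOn (fun y : ℝ => ‖deriv f ⟨t, y⟩‖) (Icc y₁ y₂) := hdc'.norm
  have hcn2 : ContinuousOn (fun y : ℝ => ‖deriv f ⟨t, y⟩‖ ^ 2) (Icc y₁ y₂) := hcn.pow 2
  have hI2 : ∫ y in y₁..y₂, ‖deriv f ⟨t, y⟩‖ ^ 2 ≤ k ^ 2 := by
    rw [intervalIntegral.integral_of_le h12, ← ENNReal.ofReal_le_ofReal_iff (by positivity),
      ofReal_integral_eq_lintegral_ofReal]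
    · refine (lintegral_mono_set ?_).trans h
      exact Ioc_subset_Icc_self.trans hsub
    · exact (hcn2.integrableOn_Icc).mono_set Ioc_subset_Icc_self
    · exact Eventually.of_forall fun y => by positivity
  have hpt : ∀ y ∈ Icc y₁ y₂, ‖deriv f ⟨t, y⟩ * Complex.I‖ ≤ k + ‖deriv f ⟨t, y⟩‖ ^ 2 / k := by
    intro y _
    rw [norm_mul, Complex.norm_I, mul_one]
    set x := ‖deriv f ⟨t, y⟩‖
    have : k + x ^ 2 / k - x = (k ^ 2 + x ^ 2 - k * x) / k := by field_simp
    have h5 : 0 ≤ (k ^ 2 + x ^ 2 - k * x) / k := div_nonneg (by nlinarith [sq_nonneg (k - x)]) hk.le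
    linarith
  calc ‖∫ y in y₁..y₂, deriv f ⟨t, y⟩ * Complex.I‖
      ≤ ∫ y in y₁..y₂, ‖deriv f ⟨t, y⟩ * Complex.I‖ :=
        intervalIntegral.norm_integral_le_integral_norm h12
    _ ≤ ∫ y in y₁..y₂, (k + ‖deriv f ⟨t, y⟩‖ ^ 2 / k) := by
        refine intervalIntegral.integral_mono_on h12 hci.norm.intervalIntegrable ?_ hpt
        refine ContinuousOn.intervalIntegrable ?_
        rw [uIcc_of_le h12]
        exact continuousOn_const.add (hcn2.div_const k)
    _ = k * (y₂ - y₁) + (∫ y in y₁..y₂, ‖deriv f ⟨t, y⟩‖ ^ 2) / k := by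
        rw [intervalIntegral.integral_add, intervalIntegral.integral_const,
          intervalIntegral.integral_div, smul_eq_mul, mul_comm]
        · exact intervalIntegrable_const
        · refine ContinuousOn.intervalIntegrable ?_
          rw [uIcc_of_le h12]
          exact hcn2.div_const k
    _ ≤ k * 4 + k ^ 2 / k := by
        have := h₁.1; have := h₂.2
        have := Real.pi_lt_four
        gcongr
        linarith
    _ = 5 * k := by field_simp; ring

/-- A bounded injective holomorphic function on the strip has small oscillation along suitable
vertical segments arbitrarily far to the left. -/
lemma exists_short_crosscut {f : ℂ → ℂ} (hf : DifferentiableOn ℂ f strip) (hi : InjOn f strip)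
    {M : ℝ} (hM : ∀ w ∈ strip, ‖f w‖ ≤ M) (T : ℝ) {η : ℝ} (hη : 0 < η) :
    ∃ t < T, ∀ z ∈ strip, ∀ w ∈ strip, z.re = t → w.re = t → ‖f z - f w‖ ≤ η := by
  by_contra! hcon
  set I := Ioo (-(Real.pi / 2)) (Real.pi / 2) with hI
  set c : ENNReal := ENNReal.ofReal ((η / 5) ^ 2) with hc
  have hbig : ∀ t < T, c ≤ ∫⁻ y in I, ENNReal.ofReal (‖deriv f ⟨t, y⟩‖ ^ 2) := by
    intro t ht
    by_contra! hlt
    obtain ⟨z, hz, w, hw, hzt, hwt, hlt'⟩ := hcon t ht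
    have key : ∀ z ∈ strip, ∀ w ∈ strip, z.re = t → w.re = t → w.im ≤ z.im → ‖f z - f w‖ ≤ η := by
      intro z hz w hw hzt hwt hle
      have := norm_sub_le_of_lintegral_le hf (k := η / 5) (by positivity) hlt.le hw hz hle
      have e1 : (⟨t, z.im⟩ : ℂ) = z := Complex.ext hzt.symm rfl
      have e2 : (⟨t, w.im⟩ : ℂ) = w := Complex.ext hwt.symm rfl
      rw [e1, e2] at this
      linarith
    rcases le_total w.im z.im with h | h
    · exact absurd (key z hz w hw hzt hwt h) (not_le.2 hlt')
    · rw [norm_sub_rev] at hlt'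
      exact absurd (key w hw z hz hwt hzt h) (not_le.2 hlt')
  have hfin := lintegral_norm_deriv_sq_lt_top isOpen_strip hf hi hM
  have hmeas : Measurable fun w : ℂ => ENNReal.ofReal (‖deriv f w‖ ^ 2) :=
    ((measurable_deriv f).norm.pow_const 2).ennreal_ofReal
  have hemb := Complex.measurableEquivRealProd.symm.measurableEmbedding
  have hpres := Complex.volume_preserving_equiv_real_prod.symm
  have h1 := hpres.setLIntegral_comp_preimage_emb hemb
    (fun w : ℂ => ENNReal.ofReal (‖deriv f w‖ ^ 2)) strip
  have hpre : Complex.measurableEquivRealProd.symm ⁻¹' strip = univ ×ˢ I := by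
    ext q
    simp [strip, hI, Complex.measurableEquivRealProd_symm_apply]
  rw [hpre] at h1
  rw [← h1] at hfin
  have h2 : ∫⁻ q in (Iio T) ×ˢ I, ENNReal.ofReal
      (‖deriv f (Complex.measurableEquivRealProd.symm q)‖ ^ 2) < ⊤ :=
    (lintegral_mono_set (prod_mono (subset_univ _) subset_rfl)).trans_lt hfin
  rw [Measure.volume_eq_prod, ← Measure.prod_restrict, lintegral_prod
    (fun q => ENNReal.ofReal (‖deriv f (Complex.measurableEquivRealProd.symm q)‖ ^ 2))
    (hmeas.comp Complex.measurableEquivRealProd.symm.measurable).aemeasurable] at h2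
  have h3 : ∫⁻ _ in Iio T, c ≤ ∫⁻ x in Iio T, ∫⁻ y in I, ENNReal.ofReal
      (‖deriv f (Complex.measurableEquivRealProd.symm (x, y))‖ ^ 2) :=
    setLIntegral_mono' measurableSet_Iio fun x hx => hbig x hx
  rw [setLIntegral_const, Real.volume_Iio, ENNReal.mul_top] at h3
  · exact absurd h2 (not_lt.2 h3)
  · rw [hc]
    have : 0 < (η / 5) ^ 2 := by positivity
    simpa using hη.ne'

end LengthArea

section StripMap

/-- The conformal map of the strip onto the disc whose left end corresponds to `ζ`. -/
noncomputable def stripMap (ζ w : ℂ) : ℂ := ζ * (1 - Complex.exp w) / (1 + Complex.exp w)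

/-- The inverse of `stripMap ζ`. -/
noncomputable def discLog (ζ z : ℂ) : ℂ := Complex.log ((ζ - z) / (ζ + z))

variable {ζ z w : ℂ}

lemma ne_neg_of_mem_ball (hζ : ‖ζ‖ = 1) (hz : z ∈ ball (0 : ℂ) 1) : ζ + z ≠ 0 := by
  intro h
  have : z = -ζ := by linear_combination h
  rw [this, mem_ball_zero_iff, norm_neg, hζ] at hz
  exact lt_irrefl _ hz

lemma re_div_pos (hζ : ‖ζ‖ = 1) (hz : z ∈ ball (0 : ℂ) 1) : 0 < ((ζ - z) / (ζ + z)).re := by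
  have h0 := ne_neg_of_mem_ball hζ hz
  rw [mem_ball_zero_iff] at hz
  have h1 : Complex.normSq ζ = 1 := by rw [Complex.normSq_eq_norm_sq, hζ]; norm_num
  have h2 : Complex.normSq z < 1 := by
    rw [Complex.normSq_eq_norm_sq]; nlinarith [norm_nonneg z]
  rw [Complex.div_re, ← add_div]
  refine div_pos ?_ (Complex.normSq_pos.2 h0)
  simp only [Complex.normSq_apply, Complex.sub_re, Complex.add_re, Complex.sub_im,
    Complex.add_im] at *
  nlinarith

lemma discLog_mem_strip (hζ : ‖ζ‖ = 1) (hz : z ∈ ball (0 : ℂ) 1) : discLog ζ z ∈ strip := by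
  have h := Complex.abs_arg_lt_pi_div_two_iff.2 (Or.inl (re_div_pos hζ hz))
  rw [abs_lt] at h
  simpa [strip, discLog, Complex.log_im] using h

lemma exp_discLog (hζ : ‖ζ‖ = 1) (hz : z ∈ ball (0 : ℂ) 1) :
    Complex.exp (discLog ζ z) = (ζ - z) / (ζ + z) := by
  refine Complex.exp_log fun h => ?_
  have := re_div_pos hζ hz
  rw [h] at this
  exact lt_irrefl _ this

lemma stripMap_discLog (hζ : ‖ζ‖ = 1) (hz : z ∈ ball (0 : ℂ) 1) :
    stripMap ζ (discLog ζ z) = z := by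
  have h0 := ne_neg_of_mem_ball hζ hz
  have hζ0 : ζ ≠ 0 := norm_pos_iff.1 (by rw [hζ]; exact one_pos)
  rw [stripMap, exp_discLog hζ hz]
  have h1 : 1 + (ζ - z) / (ζ + z) = 2 * ζ / (ζ + z) := by field_simp; ring
  have h2 : 1 - (ζ - z) / (ζ + z) = 2 * z / (ζ + z) := by field_simp; ring
  rw [h1, h2]
  field_simp

lemma re_exp_pos (hw : w ∈ strip) : 0 < (Complex.exp w).re := by
  rw [Complex.exp_re]
  exact mul_pos (Real.exp_pos _) (Real.cos_pos_of_mem_Ioo hw)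

lemma one_add_exp_ne (hw : w ∈ strip) : 1 + Complex.exp w ≠ 0 := by
  intro h
  have h1 := congrArg Complex.re h
  have := re_exp_pos hw
  simp only [Complex.add_re, Complex.one_re, Complex.zero_re] at h1
  linarith

lemma stripMap_mem_ball (hζ : ‖ζ‖ = 1) (hw : w ∈ strip) : stripMap ζ w ∈ ball (0 : ℂ) 1 := by
  have h0 := one_add_exp_ne hw
  have h1 := re_exp_pos hw
  rw [mem_ball_zero_iff, stripMap, norm_div, norm_mul, hζ, one_mul,
    div_lt_one (norm_pos_iff.2 h0), ← abs_norm, ← abs_norm (1 + Complex.exp w), ← sq_lt_sq,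
    ← Complex.normSq_eq_norm_sq, ← Complex.normSq_eq_norm_sq]
  simp only [Complex.normSq_apply, Complex.sub_re, Complex.add_re, Complex.sub_im,
    Complex.add_im, Complex.one_re, Complex.one_im]
  nlinarith

lemma discLog_stripMap (hζ : ‖ζ‖ = 1) (hw : w ∈ strip) : discLog ζ (stripMap ζ w) = w := by
  have h0 := one_add_exp_ne hw
  have hζ0 : ζ ≠ 0 := norm_pos_iff.1 (by rw [hζ]; exact one_pos)
  have h1 : (ζ - stripMap ζ w) / (ζ + stripMap ζ w) = Complex.exp w := by
    have h2 : ζ - stripMap ζ w = 2 * ζ * Complex.exp w / (1 + Complex.exp w) := by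
      rw [stripMap]; field_simp; ring
    have h3 : ζ + stripMap ζ w = 2 * ζ / (1 + Complex.exp w) := by
      rw [stripMap]; field_simp; ring
    rw [h2, h3]
    field_simp
  have hπ := Real.pi_pos
  have h4 := hw.1
  have h5 := hw.2
  rw [discLog, h1, Complex.log_exp] <;> linarith

lemma continuousOn_discLog (hζ : ‖ζ‖ = 1) : ContinuousOn (discLog ζ) (ball 0 1) := by
  refine ContinuousOn.clog (ContinuousOn.div (by fun_prop) (by fun_prop)
    fun z hz => ne_neg_of_mem_ball hζ hz) fun z hz => ?_
  rw [Complex.mem_slitPlane_iff]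
  exact Or.inl (re_div_pos hζ hz)

lemma differentiableOn_stripMap : DifferentiableOn ℂ (stripMap ζ) strip := by
  refine DifferentiableOn.div (by fun_prop) (by fun_prop) fun w hw => one_add_exp_ne hw

lemma norm_eq_exp_re_discLog (hζ : ‖ζ‖ = 1) (hz : z ∈ ball (0 : ℂ) 1) :
    ‖ζ - z‖ = Real.exp (discLog ζ z).re * ‖ζ + z‖ := by
  have h := congrArg norm (exp_discLog hζ hz)
  rw [Complex.norm_exp, norm_div] at h
  have h0 : ‖ζ + z‖ ≠ 0 := norm_ne_zero_iff.2 (ne_neg_of_mem_ball hζ hz)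
  rw [h]
  field_simp

lemma eventually_re_discLog_lt (hζ : ‖ζ‖ = 1) (t : ℝ) :
    ∀ᶠ z in 𝓝[ball 0 1] ζ, (discLog ζ z).re < t := by
  have h1 : Tendsto (fun z : ℂ => ‖ζ - z‖ - Real.exp t * ‖ζ + z‖) (𝓝 ζ)
      (𝓝 (‖ζ - ζ‖ - Real.exp t * ‖ζ + ζ‖)) := by
    apply Continuous.tendsto
    fun_prop
  have h2 : ‖ζ - ζ‖ - Real.exp t * ‖ζ + ζ‖ < 0 := by
    rw [sub_self, norm_zero, ← two_mul, norm_mul, hζ]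
    have := Real.exp_pos t
    simp
    linarith
  filter_upwards [nhdsWithin_le_nhds (h1.eventually (gt_mem_nhds h2)), self_mem_nhdsWithin]
    with z hz hzb
  rw [norm_eq_exp_re_discLog hζ hzb, ← sub_mul] at hz
  by_contra! h
  have h3 : Real.exp t ≤ Real.exp (discLog ζ z).re := Real.exp_le_exp.2 h
  have h4 := mul_nonneg (sub_nonneg.2 h3) (norm_nonneg (ζ + z))
  linarith

lemma norm_sub_lt_of_re_discLog_lt (hζ : ‖ζ‖ = 1) {t : ℝ} (hz : z ∈ ball (0 : ℂ) 1)
    (h : (discLog ζ z).re < t) : ‖ζ - z‖ < 2 * Real.exp t := by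
  rw [norm_eq_exp_re_discLog hζ hz]
  have h1 : ‖ζ + z‖ < 2 := by
    have := norm_add_le ζ z
    rw [mem_ball_zero_iff] at hz
    linarith
  have h2 := Real.exp_lt_exp.2 h
  have h3 := Real.exp_pos (discLog ζ z).re
  nlinarith [norm_nonneg (ζ + z)]

end StripMap

/-- A parametrized Jordan curve of period one. -/
structure IsJordanLoop {X : Type*} [TopologicalSpace X] (c : ℝ → X) : Prop where
  continuous : Continuous c
  add_one : ∀ t, c (t + 1) = c t
  inj : ∀ s t, c s = c t → ∃ n : ℤ, s = t + n

/-- The local connectivity properties of a Jordan domain at its boundary, together with the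
connectivity of its complement and of its punctured boundary. -/
structure IsTameDomain {X : Type*} [TopologicalSpace X] (Q : Set X) : Prop where
  isOpen : IsOpen Q
  isConnected : IsConnected Q
  isPreconnected_compl : IsPreconnected Qᶜ
  joined_near : ∀ q ∉ Q, ∀ N ∈ 𝓝 q, ∃ M ∈ 𝓝 q, ∀ x ∈ M ∩ Q, ∀ y ∈ M ∩ Q,
    ∃ A, IsPreconnected A ∧ A ⊆ Q ∩ N ∧ x ∈ A ∧ y ∈ A
  joined_away : ∀ q ∉ Q, ∀ q₀ ∈ Q, ∀ N ∈ 𝓝 q, ∃ M ∈ 𝓝 q, ∀ x ∈ Q \ N,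
    ∃ A, IsPreconnected A ∧ A ⊆ Q \ M ∧ x ∈ A ∧ q₀ ∈ A
  frontier_nontrivial : (frontier Q).Nontrivial
  isPreconnected_frontier_diff : ∀ p, IsPreconnected (frontier Q \ {p})

section

variable {X : Type*} [TopologicalSpace X]

lemma JoinedOff.mono {K L : Set X} {x y : X} (h : JoinedOff L x y) (hK : K ⊆ L) :
    JoinedOff K x y := by
  obtain ⟨C, hC, hCL, hx, hy⟩ := h
  exact ⟨C, hC, hCL.trans (compl_subset_compl.2 hK), hx, hy⟩

lemma JoinedOff.exists_of_component {Γ K : Set X} {x y z : X}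
    (h : JoinedOff (Γ ∪ K) y z) (hy : y ∈ connectedComponentIn Γᶜ x) :
    ∃ A, IsPreconnected A ∧ A ⊆ connectedComponentIn Γᶜ x \ K ∧ y ∈ A ∧ z ∈ A := by
  obtain ⟨A, hA, hAK, hyA, hzA⟩ := h
  refine ⟨A, hA, subset_sdiff.2 ⟨?_, ?_⟩, hyA, hzA⟩
  · rw [connectedComponentIn_eq hy]
    exact hA.subset_connectedComponentIn hyA fun a ha h => hAK ha (Or.inl h)
  · exact disjoint_left.2 fun a ha h => hAK ha (Or.inr h)

/-- Small neighbourhoods with connected complement. -/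
lemma exists_isOpen_isPreconnected_compl [CompactSpace X] [T2Space X] (hX : IsSphereLike X)
    {q : X} {N : Set X} (hN : N ∈ 𝓝 q) :
    ∃ V ⊆ N, IsOpen V ∧ q ∈ V ∧ IsPreconnected Vᶜ := by
  obtain ⟨e, he, hr⟩ := hX q
  have h1 := isCompact_preimage_chart he hr (K := (interior N)ᶜ)
    isOpen_interior.isClosed_compl (fun h => h (mem_interior_iff_mem_nhds.2 hN))
  obtain ⟨R, hR⟩ := h1.isBounded.subset_closedBall 0
  refine ⟨(e '' closedBall 0 R)ᶜ, ?_, ?_, ?_, ?_⟩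
  · intro x hx
    by_contra hxN
    have hxq : x ≠ q := by rintro rfl; exact hxN (mem_of_mem_nhds hN)
    obtain ⟨z, rfl⟩ := exists_chart_eq hr hxq
    exact hx ⟨z, hR fun h => hxN (interior_subset h), rfl⟩
  · exact ((isCompact_closedBall _ _).image he.continuous).isClosed.isOpen_compl
  · rintro ⟨z, -, h⟩
    exact chart_ne hr z h
  · rw [compl_compl]
    exact (convex_closedBall _ _).isPreconnected.image _ he.continuous.continuousOn

end

namespace IsJordanLoop

variable {X : Type*} [TopologicalSpace X] {c : ℝ → X}

lemma add_int (hc : IsJordanLoop c) (t : ℝ) (n : ℤ) : c (t + n) = c t := by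
  have := (Function.Periodic.int_mul (f := c) (c := 1) hc.add_one n) t
  simpa using this

lemma exists_mem_Ico (hc : IsJordanLoop c) (a s : ℝ) : ∃ t ∈ Ico a (a + 1), c t = c s := by
  refine ⟨s + (-⌊s - a⌋ : ℤ), ⟨?_, ?_⟩, hc.add_int _ _⟩ <;> push_cast
  · linarith [Int.floor_le (s - a)]
  · linarith [Int.lt_floor_add_one (s - a)]

lemma eq_of_abs_sub_lt (hc : IsJordanLoop c) {s t : ℝ} (h : c s = c t) (hst : |s - t| < 1) :
    s = t := by
  obtain ⟨n, hn⟩ := hc.inj s t h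
  have : |(n : ℝ)| < 1 := by rwa [show (n : ℝ) = s - t by linarith]
  have : |n| < 1 := by exact_mod_cast this
  have : n = 0 := by simpa [Int.abs_lt_one_iff] using this
  simpa [this] using hn

lemma isCompact_range (hc : IsJordanLoop c) : IsCompact (range c) := by
  have : range c = c '' Icc 0 1 := by
    refine subset_antisymm ?_ (image_subset_range _ _)
    rintro _ ⟨s, rfl⟩
    obtain ⟨t, ht, h⟩ := hc.exists_mem_Ico 0 s
    exact ⟨t, ⟨ht.1, by linarith [ht.2]⟩, h⟩
  rw [this]
  exact isCompact_Icc.image hc.continuous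

lemma range_diff_singleton (hc : IsJordanLoop c) (t : ℝ) :
    range c \ {c t} = c '' Ioo t (t + 1) := by
  ext x
  constructor
  · rintro ⟨⟨s, rfl⟩, hs⟩
    obtain ⟨u, hu, h⟩ := hc.exists_mem_Ico t s
    refine ⟨u, ⟨lt_of_le_of_ne hu.1 ?_, hu.2⟩, h⟩
    rintro rfl
    exact hs h.symm
  · rintro ⟨u, hu, rfl⟩
    refine ⟨mem_range_self _, fun h => ?_⟩
    have := hc.eq_of_abs_sub_lt h (by rw [abs_lt]; constructor <;> linarith [hu.1, hu.2])
    exact hu.1.ne' this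

/-- An arc does not separate the sphere. -/
lemma joinedOff_arc [CompactSpace X] [T2Space X] (hX : IsSphereLike X) (hc : IsJordanLoop c)
    {a b : ℝ} (hab : a ≤ b) (hb : b < a + 1) {x y : X} (hx : x ∉ c '' Icc a b)
    (hy : y ∉ c '' Icc a b) : JoinedOff (c '' Icc a b) x y := by
  by_contra hcon
  have key : ∀ u v : ℝ, a ≤ u → u ≤ v → v ≤ b → ∀ m, u ≤ m → m ≤ v →
      JoinedOff (c '' Icc u m) x y → JoinedOff (c '' Icc m v) x y →
      JoinedOff (c '' Icc u v) x y := by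
    intro u v hau huv hvb m hum hmv h1 h2
    have := JoinedOff.union hX (isCompact_Icc.image hc.continuous).isClosed
      (isCompact_Icc.image hc.continuous).isClosed ?_ h1 h2
    · rwa [← image_union, Icc_union_Icc_eq_Icc hum hmv] at this
    · have : c '' Icc u m ∩ c '' Icc m v = {c m} := by
        ext z
        constructor
        · rintro ⟨⟨s, hs, rfl⟩, ⟨t, ht, h⟩⟩
          have h3 := hc.eq_of_abs_sub_lt h
            (by rw [abs_lt]; constructor <;> linarith [hs.1, hs.2, ht.1, ht.2])
          have : s = m := le_antisymm hs.2 (h3 ▸ ht.1)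
          simp [this]
        · rintro rfl
          exact ⟨⟨m, ⟨hum, le_rfl⟩, rfl⟩, ⟨m, ⟨le_rfl, hmv⟩, rfl⟩⟩
      rw [this]
      exact isPreconnected_singleton
  -- an interval all of whose points have joined neighbourhoods is joined
  have loc : ∀ t ∈ Icc a b, ∃ ε > 0, ∀ u v, t - ε < u → v < t + ε →
      JoinedOff (c '' Icc u v) x y := by
    intro t ht
    have hxt : c t ≠ x := fun h => hx ⟨t, ht, h⟩
    have hyt : c t ≠ y := fun h => hy ⟨t, ht, h⟩
    have hN : ({x}ᶜ ∩ {y}ᶜ : Set X) ∈ 𝓝 (c t) :=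
      inter_mem (isOpen_compl_singleton.mem_nhds hxt) (isOpen_compl_singleton.mem_nhds hyt)
    obtain ⟨V, hVN, hV, htV, hVc⟩ := exists_isOpen_isPreconnected_compl hX hN
    obtain ⟨ε, hε, h⟩ := Metric.mem_nhds_iff.1
      (hc.continuous.continuousAt.preimage_mem_nhds (hV.mem_nhds htV))
    refine ⟨ε, hε, fun u v hu hv => ⟨Vᶜ, hVc, ?_, fun h => (hVN h).1 rfl, fun h => (hVN h).2 rfl⟩⟩
    apply compl_subset_compl.2
    rintro _ ⟨s, hs, rfl⟩
    refine h ?_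
    rw [mem_ball, Real.dist_eq, abs_lt]
    constructor <;> linarith [hs.1, hs.2]
  -- continuous induction
  let S : Set ℝ := {v | JoinedOff (c '' Icc a v) x y}
  have hS : ∀ v ∈ Icc a b, v ∈ S := by
    have ha : a ∈ S := by
      obtain ⟨ε, hε, h⟩ := loc a ⟨le_rfl, hab⟩
      exact h _ _ (by linarith) (by linarith)
    have hbdd : BddAbove {v | v ∈ Icc a b ∧ v ∈ S} := ⟨b, fun v hv => hv.1.2⟩
    set s := sSup {v | v ∈ Icc a b ∧ v ∈ S} with hs
    have hane : a ∈ {v | v ∈ Icc a b ∧ v ∈ S} := ⟨⟨le_rfl, hab⟩, ha⟩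
    have has : a ≤ s := le_csSup hbdd hane
    have hsb : s ≤ b := csSup_le ⟨a, hane⟩ fun v hv => hv.1.2
    obtain ⟨ε, hε, h⟩ := loc s ⟨has, hsb⟩
    obtain ⟨u, ⟨hu, huS⟩, hus⟩ := exists_lt_of_lt_csSup ⟨a, hane⟩ (show s - ε < s by linarith)
    have hus' : u ≤ s := le_csSup hbdd ⟨hu, huS⟩
    have h4 : ∀ v ∈ Icc u b, v < s + ε → v ∈ S := fun v hv hvs =>
      key a v le_rfl (hu.1.trans hv.1) hv.2 u hu.1 hv.1 huS (h u v hus hvs)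
    have h5 : b < s + ε := by
      by_contra hlt
      have := le_csSup hbdd (show s + ε / 2 ∈ {v | v ∈ Icc a b ∧ v ∈ S} from
        ⟨⟨by linarith, by linarith⟩, h4 _ ⟨by linarith, by linarith⟩ (by linarith)⟩)
      linarith
    intro v hv
    rcases le_total v u with hvu | hvu
    · exact JoinedOff.mono huS (image_mono (Icc_subset_Icc_right hvu))
    · exact h4 v ⟨hvu, hv.2⟩ (by linarith [hv.2])
  exact hcon (hS b ⟨hab, le_rfl⟩)

/-- The part of a Jordan curve outside a neighbourhood of one of its points lies in a
complementary arc. -/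
lemma exists_arc (hc : IsJordanLoop c) {t : ℝ} {N : Set X} (hN : N ∈ 𝓝 (c t)) :
    ∃ δ > 0, δ < 1 / 2 ∧ c '' Icc (t - δ) (t + δ) ⊆ N ∧
      range c ⊆ c '' Icc (t - δ) (t + δ) ∪ c '' Icc (t + δ) (t + 1 - δ) ∧
      c t ∉ c '' Icc (t + δ) (t + 1 - δ) := by
  obtain ⟨ε, hε, h⟩ := Metric.mem_nhds_iff.1
    (hc.continuous.continuousAt.preimage_mem_nhds hN)
  refine ⟨min (ε / 2) (1 / 4), by positivity, by
    linarith [min_le_right (ε / 2) (1 / 4 : ℝ)], ?_, ?_, ?_⟩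
  · rintro _ ⟨s, hs, rfl⟩
    refine h ?_
    rw [mem_ball, Real.dist_eq, abs_lt]
    constructor <;> linarith [hs.1, hs.2, min_le_left (ε / 2) (1 / 4 : ℝ)]
  · rintro _ ⟨s, rfl⟩
    obtain ⟨u, hu, h⟩ := hc.exists_mem_Ico (t - min (ε / 2) (1 / 4)) s
    rw [← h]
    rcases le_total u (t + min (ε / 2) (1 / 4)) with h1 | h1
    · exact Or.inl ⟨u, ⟨hu.1, h1⟩, rfl⟩
    · exact Or.inr ⟨u, ⟨h1, by linarith [hu.2]⟩, rfl⟩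
  · rintro ⟨s, hs, h⟩
    have hpos : 0 < min (ε / 2) (1 / 4 : ℝ) := by positivity
    have := hc.eq_of_abs_sub_lt h (by rw [abs_lt]; constructor <;> linarith [hs.1, hs.2])
    linarith [hs.1]

lemma range_subset_closure [CompactSpace X] [T2Space X] [LocallyConnectedSpace X]
    (hX : IsSphereLike X) (hc : IsJordanLoop c) {x : X} (hx : x ∉ range c) :
    range c ⊆ closure (connectedComponentIn (range c)ᶜ x) := by
  rintro _ ⟨t, rfl⟩
  set Q := connectedComponentIn (range c)ᶜ x with hQ
  have hcl : IsClosed (range c) := hc.isCompact_range.isClosed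
  have hQo : IsOpen Q := hcl.isOpen_compl.connectedComponentIn
  have hxQ : x ∈ Q := mem_connectedComponentIn hx
  rw [mem_closure_iff_nhds]
  by_contra! hcon
  obtain ⟨N, hN, hNQ⟩ := hcon
  obtain ⟨δ, hδ, hδ', h1, h2, h3⟩ := hc.exists_arc (interior_mem_nhds.2 hN)
  have hx3 : x ∉ c '' Icc (t + δ) (t + 1 - δ) := fun h => hx (image_subset_range _ _ h)
  obtain ⟨C, hC, hCs, hxC, htC⟩ := hc.joinedOff_arc hX (by linarith) (by linarith) hx3 h3
  have hsub : C ⊆ Q := by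
    refine hC.subset_of_closure_inter_subset hQo ⟨x, hxC, hxQ⟩ ?_
    rintro z ⟨hz, hzC⟩
    by_contra hzQ
    have hzΓ : z ∈ range c := by
      by_contra hzΓ
      have hzo : IsOpen (connectedComponentIn (range c)ᶜ z) := hcl.isOpen_compl.connectedComponentIn
      obtain ⟨w, hw1, hw2⟩ := mem_closure_iff.1 hz _ hzo (mem_connectedComponentIn hzΓ)
      apply hzQ
      rw [hQ, connectedComponentIn_eq hw2, ← connectedComponentIn_eq hw1]
      exact mem_connectedComponentIn hzΓ
    rcases h2 hzΓ with h | h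
    · obtain ⟨w, hw1, hw2⟩ := mem_closure_iff.1 hz _ isOpen_interior (h1 h)
      exact notMem_empty w (hNQ ▸ ⟨interior_subset hw1, hw2⟩)
    · exact hCs hzC h
  have htQ := hsub htC
  exact connectedComponentIn_subset _ _ htQ ⟨t, rfl⟩

lemma frontier_component [CompactSpace X] [T2Space X] [LocallyConnectedSpace X]
    (hX : IsSphereLike X) (hc : IsJordanLoop c) {x : X} (hx : x ∉ range c) :
    frontier (connectedComponentIn (range c)ᶜ x) = range c := by
  have hcl : IsClosed (range c) := hc.isCompact_range.isClosed
  have hQo : IsOpen (connectedComponentIn (range c)ᶜ x) := hcl.isOpen_compl.connectedComponentIn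
  rw [hQo.frontier_eq]
  refine subset_antisymm ?_ (subset_sdiff.2 ⟨hc.range_subset_closure hX hx, ?_⟩)
  · rintro z ⟨hz, hzQ⟩
    by_contra hzΓ
    have hzo : IsOpen (connectedComponentIn (range c)ᶜ z) := hcl.isOpen_compl.connectedComponentIn
    obtain ⟨w, hw1, hw2⟩ := mem_closure_iff.1 hz _ hzo (mem_connectedComponentIn hzΓ)
    apply hzQ
    rw [connectedComponentIn_eq hw2, ← connectedComponentIn_eq hw1]
    exact mem_connectedComponentIn hzΓ
  · exact disjoint_left.2 fun z hz hzQ => connectedComponentIn_subset _ _ hzQ hz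

/-- Jordan domains are tame. -/
theorem isTameDomain [CompactSpace X] [T2Space X] [LocallyConnectedSpace X]
    (hX : IsSphereLike X) (hc : IsJordanLoop c) {x : X} (hx : x ∉ range c) :
    IsTameDomain (connectedComponentIn (range c)ᶜ x) := by
  have hcl : IsClosed (range c) := hc.isCompact_range.isClosed
  have hfr := hc.frontier_component hX hx
  have harc : ∀ a b : ℝ, IsClosed (c '' Icc a b) := fun a b =>
    (isCompact_Icc.image hc.continuous).isClosed
  set Q := connectedComponentIn (range c)ᶜ x with hQ
  have hQo : IsOpen Q := hcl.isOpen_compl.connectedComponentIn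
  have hxQ : x ∈ Q := mem_connectedComponentIn hx
  have hQc : IsPreconnected Q := isPreconnected_connectedComponentIn
  have hjoin : ∀ y ∈ Q, ∀ z ∈ Q, JoinedOff (range c) y z := fun y hy z hz =>
    ⟨Q, hQc, connectedComponentIn_subset _ _, hy, hz⟩
  have hfront : ∀ q ∉ Q, q ∉ range c → q ∉ closure Q := fun q hq hqc h =>
    hqc (hfr ▸ hQo.frontier_eq ▸ ⟨h, hq⟩)
  refine ⟨hQo, ⟨⟨x, hxQ⟩, hQc⟩, ?_, ?_, ?_, ?_, ?_⟩
  · have hcQ : ∀ t, c t ∉ Q := fun t h => connectedComponentIn_subset _ _ h ⟨t, rfl⟩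
    refine isPreconnected_of_forall (c 0) fun y hy => ?_
    by_cases hyc : y ∈ range c
    · refine ⟨range c, ?_, mem_range_self _, hyc, isPreconnected_range hc.continuous⟩
      rintro _ ⟨t, rfl⟩
      exact hcQ t
    · refine ⟨closure (connectedComponentIn (range c)ᶜ y), ?_,
        hc.range_subset_closure hX hyc (mem_range_self _), subset_closure
          (mem_connectedComponentIn hyc), isPreconnected_connectedComponentIn.closure⟩
      intro w hw hwQ
      obtain ⟨v, hv1, hv2⟩ := mem_closure_iff.1 hw _ hQo hwQ
      apply hy
      rw [hQ, connectedComponentIn_eq hv1, ← connectedComponentIn_eq hv2]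
      exact mem_connectedComponentIn hyc
  · intro q hq N hN
    by_cases hqc : q ∈ range c
    · obtain ⟨t, rfl⟩ := hqc
      obtain ⟨δ, hδ, hδ', h1, h2, h3⟩ := hc.exists_arc (interior_mem_nhds.2 hN)
      set J := c '' Icc (t + δ) (t + 1 - δ) with hJ
      have hO : interior N ∩ Jᶜ ∈ 𝓝 (c t) :=
        inter_mem (interior_mem_nhds.2 hN) ((harc _ _).isOpen_compl.mem_nhds h3)
      obtain ⟨M, hMO, hM, htM, hMc⟩ :=
        locallyConnectedSpace_iff_subsets_isOpen_isConnected.1 inferInstance _ _ hO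
      refine ⟨M, hM.mem_nhds htM, fun y hy z hz => ?_⟩
      have hyz : JoinedOff ((interior N)ᶜ ∪ J) y z := by
        refine ⟨M, hMc.isPreconnected, ?_, hy.1, hz.1⟩
        rw [compl_union, compl_compl]
        exact hMO
      have := JoinedOff.union hX hcl (isOpen_interior.isClosed_compl.union (harc _ _)) ?_
        (hjoin y hy.2 z hz.2) hyz
      · obtain ⟨A, hA, hAs, h5, h6⟩ := this.exists_of_component hy.2
        refine ⟨A, hA, fun a ha => ⟨(hAs ha).1, ?_⟩, h5, h6⟩
        by_contra haN
        exact (hAs ha).2 (Or.inl fun h => haN (interior_subset h))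
      · have : range c ∩ ((interior N)ᶜ ∪ J) = J := by
          refine subset_antisymm ?_ (subset_inter (image_subset_range _ _) subset_union_right)
          rintro w ⟨hw, hwN | hwJ⟩
          · exact (h2 hw).resolve_left fun h => hwN (h1 h)
          · exact hwJ
        rw [← hJ, this]
        exact isPreconnected_Icc.image _ hc.continuous.continuousOn
    · refine ⟨(closure Q)ᶜ, isClosed_closure.isOpen_compl.mem_nhds (hfront q hq hqc), ?_⟩
      rintro y ⟨hy, hyQ⟩
      exact (hy (subset_closure hyQ)).elim
  · intro q hq q₀ hq₀ N hN
    by_cases hqc : q ∈ range c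
    · obtain ⟨t, rfl⟩ := hqc
      obtain ⟨V, hVN, hV, htV, hVc⟩ := exists_isOpen_isPreconnected_compl hX
        (inter_mem hN (isOpen_compl_singleton.mem_nhds (fun h : c t = q₀ => hq (h ▸ hq₀))))
      obtain ⟨δ, hδ, hδ', h1, h2, h3⟩ := hc.exists_arc (hV.mem_nhds htV)
      set J := c '' Icc (t + δ) (t + 1 - δ) with hJ
      set I := c '' Icc (t - δ) (t + δ) with hI
      obtain ⟨M, hM, hMcl, hMs⟩ := exists_mem_nhds_isClosed_subset
        (inter_mem (hV.mem_nhds htV) ((harc _ _).isOpen_compl.mem_nhds h3))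
      refine ⟨M, hM, fun y hy => ?_⟩
      have hVM : JoinedOff (M ∪ I) y q₀ := by
        refine ⟨Vᶜ, hVc, compl_subset_compl.2 (union_subset (fun z hz => (hMs hz).1) h1), 
          fun h => hy.2 (hVN h).1, fun h => (hVN h).2 rfl⟩
      have := JoinedOff.union hX hcl (hMcl.union (harc _ _)) ?_ (hjoin y hy.1 q₀ hq₀) hVM
      · obtain ⟨A, hA, hAs, h5, h6⟩ := this.exists_of_component hy.1
        exact ⟨A, hA, hAs.trans (sdiff_subset_sdiff_right subset_union_left), h5, h6⟩
      · have : range c ∩ (M ∪ I) = I := by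
          refine subset_antisymm ?_ (subset_inter (image_subset_range _ _) subset_union_right)
          rintro z ⟨hz, hzM | hzI⟩
          · exact (h2 hz).resolve_right (hMs hzM).2
          · exact hzI
        rw [this]
        exact isPreconnected_Icc.image _ hc.continuous.continuousOn
    · refine ⟨(closure Q)ᶜ, isClosed_closure.isOpen_compl.mem_nhds (hfront q hq hqc),
        fun y hy => ⟨Q, hQc, ?_, hy.1, hq₀⟩⟩
      exact fun z hz => ⟨hz, fun h => h (subset_closure hz)⟩
  · rw [hfr]
    refine ⟨c 0, mem_range_self _, c (1 / 2), mem_range_self _, fun h => ?_⟩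
    have := hc.eq_of_abs_sub_lt h (by norm_num [abs_lt])
    norm_num at this
  · intro p
    rw [hfr]
    by_cases hp : p ∈ range c
    · obtain ⟨t, rfl⟩ := hp
      rw [hc.range_diff_singleton]
      exact isPreconnected_Ioo.image _ hc.continuous.continuousOn
    · rw [sdiff_singleton_eq_self hp]
      exact isPreconnected_range hc.continuous

end IsJordanLoop

/-- A proper monotone parametrization of `Q` by the unit disc, which factors through a bounded
univalent function. -/
structure IsDiscMap {X : Type*} [TopologicalSpace X] (F : ℂ → X) (Q : Set X) : Prop where
  continuousOn : ContinuousOn F (ball 0 1)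
  mapsTo : MapsTo F (ball 0 1) Q
  surjOn : SurjOn F (ball 0 1) Q
  isCompact_preimage : ∀ K ⊆ Q, IsCompact K → IsCompact (ball 0 1 ∩ F ⁻¹' K)
  isPreconnected_preimage : ∀ A ⊆ Q, IsPreconnected A → IsPreconnected (ball 0 1 ∩ F ⁻¹' A)
  factor : ∃ (β : ℂ → ℂ) (P : ℂ → X) (M : ℝ), DifferentiableOn ℂ β (ball 0 1) ∧
    InjOn β (ball 0 1) ∧ (∀ w ∈ ball (0 : ℂ) 1, ‖β w‖ ≤ M) ∧ Continuous P ∧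
    ∀ w ∈ ball (0 : ℂ) 1, F w = P (β w)

namespace IsDiscMap

variable {X : Type*} [MetricSpace X] {F : ℂ → X} {Q : Set X} {ζ : ℂ}

lemma exists_small_crosscut (hF : IsDiscMap F Q) (hζ : ‖ζ‖ = 1) (T : ℝ) {ε : ℝ} (hε : 0 < ε) :
    ∃ t < T, ∀ z ∈ ball (0 : ℂ) 1, ∀ w ∈ ball (0 : ℂ) 1, (discLog ζ z).re = t →
      (discLog ζ w).re = t → dist (F z) (F w) < ε := by
  obtain ⟨β, P, M, hβ, hβi, hβM, hP, hFP⟩ := hF.factor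
  have huc : UniformContinuousOn P (closedBall 0 M) :=
    (isCompact_closedBall 0 M).uniformContinuousOn_of_continuous hP.continuousOn
  obtain ⟨η, hη, h⟩ := Metric.uniformContinuousOn_iff.1 huc ε hε
  have hmaps : MapsTo (stripMap ζ) strip (ball 0 1) := fun w hw => stripMap_mem_ball hζ hw
  obtain ⟨t, htT, ht⟩ := exists_short_crosscut (f := fun w => β (stripMap ζ w))
    (hβ.comp differentiableOn_stripMap hmaps)
    (fun z hz w hw hzw => by
      have := hβi (hmaps hz) (hmaps hw) hzw
      rw [← discLog_stripMap hζ hz, this, discLog_stripMap hζ hw])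
    (fun w hw => hβM _ (hmaps hw)) T (half_pos hη)
  refine ⟨t, htT, fun z hz w hw hzt hwt => ?_⟩
  rw [hFP z hz, hFP w hw]
  apply h _ (mem_closedBall_zero_iff.2 (hβM z hz)) _ (mem_closedBall_zero_iff.2 (hβM w hw))
  have := ht _ (discLog_mem_strip hζ hz) _ (discLog_mem_strip hζ hw) hzt hwt
  simp only [stripMap_discLog hζ hz, stripMap_discLog hζ hw] at this
  rw [dist_eq_norm]
  linarith

lemma exists_tendsto [CompactSpace X] (hF : IsDiscMap F Q) (hQ : IsTameDomain Q)
    (hζ : ‖ζ‖ = 1) : ∃ q ∉ Q, Tendsto F (𝓝[ball 0 1] ζ) (𝓝 q) := by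
  have h1 : ∀ n : ℕ, ∃ t < (-(n : ℝ)), ∀ z ∈ ball (0 : ℂ) 1, ∀ w ∈ ball (0 : ℂ) 1,
      (discLog ζ z).re = t → (discLog ζ w).re = t → dist (F z) (F w) < 1 / ((n : ℝ) + 1) :=
    fun n => hF.exists_small_crosscut hζ _ (by positivity)
  choose t ht hosc using h1
  have hstrip : ∀ n, ((t n : ℝ) : ℂ) ∈ strip := fun n => by
    simp [strip, Real.pi_pos]
  set z : ℕ → ℂ := fun n => stripMap ζ (t n) with hz
  have hzb : ∀ n, z n ∈ ball (0 : ℂ) 1 := fun n => stripMap_mem_ball hζ (hstrip n)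
  have hzt : ∀ n, (discLog ζ (z n)).re = t n := fun n => by
    rw [hz]; simp only; rw [discLog_stripMap hζ (hstrip n), Complex.ofReal_re]
  have hzlim : Tendsto z atTop (𝓝 ζ) := by
    rw [tendsto_iff_norm_sub_tendsto_zero]
    refine squeeze_zero (fun n => norm_nonneg _) (g := fun n : ℕ => 2 * Real.exp (-(n : ℝ)))
      (fun n => ?_) ?_
    · rw [norm_sub_rev]
      exact (norm_sub_lt_of_re_discLog_lt hζ (hzb n) (by rw [hzt]; exact ht n)).le
    · have : Tendsto (fun n : ℕ => Real.exp (-(n : ℝ))) atTop (𝓝 0) :=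
        Real.tendsto_exp_neg_atTop_nhds_zero.comp tendsto_natCast_atTop_atTop
      simpa using this.const_mul 2
  obtain ⟨q, -, φ, hφ, hlim⟩ := isCompact_univ.tendsto_subseq (x := fun n => F (z n))
    fun n => mem_univ _
  have hqQ : q ∉ Q := by
    intro hq
    obtain ⟨K, hK, hKQ, hKc⟩ := local_compact_nhds (hQ.isOpen.mem_nhds hq)
    have h2 := (hF.isCompact_preimage K hKQ hKc).isClosed
    have h3 : ζ ∈ ball (0 : ℂ) 1 ∩ F ⁻¹' K := by
      refine h2.mem_of_tendsto (hzlim.comp hφ.tendsto_atTop) ?_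
      filter_upwards [hlim hK] with n hn using ⟨hzb _, hn⟩
    rw [mem_inter_iff, mem_ball_zero_iff, hζ] at h3
    exact lt_irrefl _ h3.1
  refine ⟨q, hqQ, fun N hN => ?_⟩
  have h0 : (0 : ℂ) ∈ ball (0 : ℂ) 1 := by simp
  obtain ⟨M, hM, hMA⟩ := hQ.joined_away q hqQ (F 0) (hF.mapsTo h0) N hN
  obtain ⟨r, hr, hrM⟩ := Metric.mem_nhds_iff.1 hM
  have h4 : ∀ᶠ n in atTop, F (z (φ n)) ∈ ball q (r / 2) := hlim (ball_mem_nhds _ (half_pos hr))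
  have h5 : ∀ᶠ n in atTop, 1 / (((φ n : ℕ) : ℝ) + 1) < r / 2 :=
    ((tendsto_one_div_add_atTop_nhds_zero_nat (𝕜 := ℝ)).comp hφ.tendsto_atTop).eventually
      (gt_mem_nhds (half_pos hr))
  obtain ⟨n, hn4, hn5⟩ := (h4.and h5).exists
  rw [Filter.mem_map]
  filter_upwards [eventually_re_discLog_lt hζ (t (φ n)), self_mem_nhdsWithin] with w hw hwb
  by_contra hwN
  obtain ⟨A, hA, hAQ, hwA, h0A⟩ := hMA (F w) ⟨hF.mapsTo hwb, hwN⟩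
  have hconn := hF.isPreconnected_preimage A (hAQ.trans sdiff_subset) hA
  have hcont : ContinuousOn (fun w => (discLog ζ w).re) (ball 0 1 ∩ F ⁻¹' A) :=
    Complex.continuous_re.comp_continuousOn
      ((continuousOn_discLog hζ).mono inter_subset_left)
  have hζ0 : ζ ≠ 0 := norm_pos_iff.1 (by rw [hζ]; exact one_pos)
  have h00 : (discLog ζ 0).re = 0 := by simp [discLog, hζ0]
  obtain ⟨v, ⟨hvb, hvA⟩, hv⟩ := hconn.intermediate_value ⟨hwb, hwA⟩ ⟨h0, h0A⟩ hcont
    (show t (φ n) ∈ Icc _ _ from ⟨hw.le, by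
      rw [h00]; exact (ht _).le.trans (by simp)⟩)
  refine (hAQ hvA).2 (hrM ?_)
  have h6 := hosc (φ n) v hvb (z (φ n)) (hzb _) hv (hzt _)
  have h7 := dist_triangle (F v) (F (z (φ n))) q
  rw [mem_ball] at hn4 ⊢
  linarith

/-- The continuous extension to the closed disc. -/
theorem exists_extension [CompactSpace X] (hF : IsDiscMap F Q) (hQ : IsTameDomain Q) :
    ∃ G : ℂ → X, ContinuousOn G (closedBall 0 1) ∧ EqOn G F (ball 0 1) ∧
      MapsTo G (sphere 0 1) (frontier Q) ∧ SurjOn G (sphere 0 1) (frontier Q) := by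
  have hcl : closure (ball (0 : ℂ) 1) = closedBall 0 1 := closure_ball 0 one_ne_zero
  have heq : EqOn (extendFrom (ball 0 1) F) F (ball 0 1) := fun z hz =>
    extendFrom_eq (subset_closure hz) (hF.continuousOn z hz)
  have hcont : ContinuousOn (extendFrom (ball 0 1) F) (closedBall 0 1) := by
    refine continuousOn_extendFrom hcl.ge fun z hz => ?_
    rcases (mem_closedBall_zero_iff.1 hz).lt_or_eq with h | h
    · exact ⟨F z, hF.continuousOn z (mem_ball_zero_iff.2 h)⟩
    · obtain ⟨q, -, hq⟩ := hF.exists_tendsto hQ h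
      exact ⟨q, hq⟩
  refine ⟨_, hcont, heq, fun ζ hζ => ?_, fun q hq => ?_⟩
  · obtain ⟨q, hqQ, hq⟩ := hF.exists_tendsto hQ (mem_sphere_zero_iff_norm.1 hζ)
    have hζc : ζ ∈ closure (ball (0 : ℂ) 1) := hcl ▸ sphere_subset_closedBall hζ
    rw [extendFrom_eq hζc hq, hQ.isOpen.frontier_eq]
    have : (𝓝[ball 0 1] ζ).NeBot := mem_closure_iff_nhdsWithin_neBot.1 hζc
    refine ⟨mem_closure_of_tendsto hq ?_, hqQ⟩
    filter_upwards [self_mem_nhdsWithin] with z hz using hF.mapsTo hz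
  · rw [hQ.isOpen.frontier_eq] at hq
    have h1 : closure Q ⊆ extendFrom (ball 0 1) F '' closedBall 0 1 := by
      refine closure_minimal (fun x hx => ?_)
        ((isCompact_closedBall _ _).image_of_continuousOn hcont).isClosed
      obtain ⟨z, hz, rfl⟩ := hF.surjOn hx
      exact ⟨z, ball_subset_closedBall hz, heq hz⟩
    obtain ⟨z, hz, rfl⟩ := h1 hq.1
    refine ⟨z, ?_, rfl⟩
    rcases (mem_closedBall_zero_iff.1 hz).lt_or_eq with h | h
    · have h2 := heq (mem_ball_zero_iff.2 h)
      exact (hq.2 (h2 ▸ hF.mapsTo (mem_ball_zero_iff.2 h))).elim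
    · exact mem_sphere_zero_iff_norm.2 h

end IsDiscMap

lemma IsTameDomain.exists_connected_near {X : Type*} [TopologicalSpace X] {Q : Set X}
    (hQ : IsTameDomain Q) {q : X} (hq : q ∉ Q) {N : Set X} (hN : N ∈ 𝓝 q) :
    ∃ A ⊆ Q ∩ N, IsPreconnected A ∧ ∃ M ∈ 𝓝 q, M ∩ Q ⊆ A := by
  obtain ⟨M, hM, h⟩ := hQ.joined_near q hq N hN
  rcases (M ∩ Q).eq_empty_or_nonempty with h0 | ⟨x, hx⟩
  · exact ⟨∅, empty_subset _, isPreconnected_empty, M, hM, h0.subset⟩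
  · refine ⟨connectedComponentIn (Q ∩ N) x, connectedComponentIn_subset _ _,
      isPreconnected_connectedComponentIn, M, hM, fun y hy => ?_⟩
    obtain ⟨A, hA, hAs, hxA, hyA⟩ := h x hx y hy
    exact hA.subset_connectedComponentIn hxA hAs hyA

lemma ball_inter_ball_nonempty {η : ℂ} (hη : ‖η‖ = 1) {ε : ℝ} (hε : 0 < ε) :
    (ball (0 : ℂ) 1 ∩ ball η ε).Nonempty := by
  have : η ∈ closure (ball (0 : ℂ) 1) := by
    rw [closure_ball 0 one_ne_zero]; simp [hη]
  obtain ⟨z, h1, h2⟩ := mem_closure_iff.1 this _ isOpen_ball (mem_ball_self hε)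
  exact ⟨z, h2, h1⟩

lemma compl_closedBall_inter_ball_nonempty {η : ℂ} (hη : ‖η‖ = 1) {ε : ℝ} (hε : 0 < ε) :
    ((closedBall (0 : ℂ) 1)ᶜ ∩ ball η ε).Nonempty := by
  refine ⟨((1 + ε / 2 : ℝ) : ℂ) * η, ?_, ?_⟩
  · rw [mem_compl_iff, mem_closedBall_zero_iff, norm_mul, hη, Complex.norm_real, Real.norm_eq_abs,
      abs_of_pos (by positivity)]
    linarith
  · rw [mem_ball, dist_eq_norm, show ((1 + ε / 2 : ℝ) : ℂ) * η - η = ((ε / 2 : ℝ) : ℂ) * η by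
      push_cast; ring, norm_mul, hη, Complex.norm_real, Real.norm_eq_abs, abs_of_pos (by positivity)]
    linarith

lemma isPreconnected_compl_closedBall_zero_one : IsPreconnected (closedBall (0 : ℂ) 1)ᶜ := by
  have : (closedBall (0 : ℂ) 1)ᶜ =
      (fun z => Complex.exp z) '' {z | 0 < z.re} := by
    ext w
    simp only [mem_compl_iff, mem_closedBall_zero_iff, not_le, mem_image]
    constructor
    · intro h
      have hw : w ≠ 0 := norm_pos_iff.1 (by linarith)
      exact ⟨Complex.log w, by simpa [Complex.log_re] using Real.log_pos h, Complex.exp_log hw⟩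
    · rintro ⟨z, hz, rfl⟩
      rw [Complex.norm_exp]
      exact Real.one_lt_exp_iff.2 hz
  rw [this]
  exact (convex_halfSpace_re_gt 0).isPreconnected.image _ Complex.continuous_exp.continuousOn

/-- A connected set in the disc that touches the circle at `η` can be joined to infinity. -/
lemma joinedOff_image_of_touch {X : Type*} [TopologicalSpace X] [CompactSpace X] {e : ℂ → X} {p : X}
    (he : IsOpenEmbedding e) (hr : range e = {p}ᶜ) {K B : Set ℂ} (hKB : Disjoint K B)
    (hK : K ⊆ closedBall 0 1) (hB : IsPreconnected B) {η : ℂ} (hη : ‖η‖ = 1) {ε : ℝ} (hε : 0 < ε)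
    (hεB : ball 0 1 ∩ ball η ε ⊆ B) (hεK : Disjoint K (ball η ε)) {z : ℂ} (hz : z ∈ B) :
    JoinedOff (e '' K) (e z) p := by
  have h1 : IsPreconnected (B ∪ ball η ε) := by
    obtain ⟨w, hw⟩ := ball_inter_ball_nonempty hη hε
    exact IsPreconnected.union w (hεB hw) hw.2 hB (convex_ball _ _).isPreconnected
  have h2 : IsPreconnected ((B ∪ ball η ε) ∪ (closedBall (0 : ℂ) 1)ᶜ) := by
    obtain ⟨w, hw1, hw2⟩ := compl_closedBall_inter_ball_nonempty hη hε
    exact IsPreconnected.union w (Or.inr hw2) hw1 h1 isPreconnected_compl_closedBall_zero_one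
  set S := (B ∪ ball η ε) ∪ (closedBall (0 : ℂ) 1)ᶜ with hS
  have h3 : p ∈ closure (e '' S) := by
    refine mem_closure_of_tendsto (tendsto_chart_cocompact he hr) ?_
    filter_upwards [(isCompact_closedBall (0 : ℂ) 1).compl_mem_cocompact] with w hw
    exact ⟨w, Or.inr hw, rfl⟩
  refine ⟨insert p (e '' S), (h2.image _ he.continuous.continuousOn).subset_closure
    (subset_insert _ _) (insert_subset h3 subset_closure), ?_,
    mem_insert_of_mem _ ⟨z, Or.inl (Or.inl hz), rfl⟩, mem_insert _ _⟩
  rintro _ (rfl | ⟨w, hw, rfl⟩) ⟨v, hv, hvw⟩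
  · exact chart_ne hr v hvw
  · obtain rfl := he.injective hvw
    rcases hw with (hw | hw) | hw
    · exact hKB.ne_of_mem hv hw rfl
    · exact hεK.ne_of_mem hv hw rfl
    · exact hw (hK hv)

lemma not_joinedOff_image_sphere {X : Type*} [TopologicalSpace X] [T2Space X]
    {e : ℂ → X} {p : X}
    (he : IsOpenEmbedding e) (hr : range e = {p}ᶜ) {K : Set ℂ} (hK : sphere 0 1 ⊆ K) {z : ℂ}
    (hz : z ∈ ball (0 : ℂ) 1) : ¬ JoinedOff (e '' K) (e z) p := by
  rintro ⟨C, hC, hCK, hzC, hpC⟩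
  have : C ⊆ e '' ball 0 1 := by
    refine hC.subset_of_closure_inter_subset (he.isOpenMap _ isOpen_ball) ⟨e z, hzC, z, hz, rfl⟩ ?_
    rintro x ⟨hx, hxC⟩
    have h1 : closure (e '' ball 0 1) ⊆ e '' closedBall 0 1 :=
      closure_minimal (image_mono ball_subset_closedBall)
        ((isCompact_closedBall _ _).image he.continuous).isClosed
    obtain ⟨w, hw, rfl⟩ := h1 hx
    rcases (mem_closedBall_zero_iff.1 hw).lt_or_eq with h | h
    · exact ⟨w, mem_ball_zero_iff.2 h, rfl⟩
    · exact (hCK hxC ⟨w, hK (mem_sphere_zero_iff_norm.2 h), rfl⟩).elim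
  obtain ⟨w, -, hw⟩ := this hpC
  exact chart_ne hr w hw

/-- The boundary extension of a disc map identifies two boundary points only by collapsing one of
the arcs between them. -/
theorem IsDiscMap.eq_on_arc {X : Type*} [MetricSpace X] [CompactSpace X] (hX : IsSphereLike X)
    {F G : ℂ → X} {Q : Set X} (hF : IsDiscMap F Q) (hQ : IsTameDomain Q)
    (hG : ContinuousOn G (closedBall 0 1)) (hGF : EqOn G F (ball 0 1))
    (hGm : MapsTo G (sphere 0 1) (frontier Q)) (hGs : SurjOn G (sphere 0 1) (frontier Q))
    {J₁ J₂ : Set ℂ} (hJ₁ : IsClosed J₁) (hJ₂ : IsClosed J₂) (hJ : J₁ ∪ J₂ = sphere 0 1)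
    {ζ₁ ζ₂ : ℂ} (hζ : J₁ ∩ J₂ = {ζ₁, ζ₂}) (hζG : G ζ₁ = G ζ₂) :
    (∀ z ∈ J₁, G z = G ζ₁) ∨ ∀ z ∈ J₂, G z = G ζ₁ := by
  by_contra! hcon
  obtain ⟨⟨a₁, ha₁, hGa₁⟩, ⟨a₂, ha₂, hGa₂⟩⟩ := hcon
  set p := G ζ₁ with hp
  have hJ₁s : J₁ ⊆ sphere 0 1 := hJ ▸ subset_union_left
  have hJ₂s : J₂ ⊆ sphere 0 1 := hJ ▸ subset_union_right
  have hcl : ∀ J ⊆ sphere (0 : ℂ) 1, IsClosed J → IsClosed (G '' J) := fun J hJs hJc =>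
    (((isCompact_sphere 0 1).of_isClosed_subset hJc hJs).image_of_continuousOn
      (hG.mono (hJs.trans sphere_subset_closedBall))).isClosed
  obtain ⟨q, ⟨hq, hqp⟩, ⟨η₁, hη₁, hη₁q⟩, ⟨η₂, hη₂, hη₂q⟩⟩ : (frontier Q \ {p} ∩
      (G '' J₁ ∩ G '' J₂)).Nonempty := by
    refine isPreconnected_closed_iff.1 (hQ.isPreconnected_frontier_diff p) _ _
      (hcl J₁ hJ₁s hJ₁) (hcl J₂ hJ₂s hJ₂) ?_ ⟨G a₁, ⟨hGm (hJ₁s ha₁), hGa₁⟩, a₁, ha₁, rfl⟩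
      ⟨G a₂, ⟨hGm (hJ₂s ha₂), hGa₂⟩, a₂, ha₂, rfl⟩
    rintro x ⟨hx, -⟩
    obtain ⟨z, hz, rfl⟩ := hGs hx
    rw [← hJ] at hz
    exact hz.imp (fun h => ⟨z, h, rfl⟩) fun h => ⟨z, h, rfl⟩
  have hfr : ∀ x ∈ frontier Q, x ∉ Q := fun x hx => by
    rw [hQ.isOpen.frontier_eq] at hx; exact hx.2
  have hζ₁ : ζ₁ ∈ J₁ ∩ J₂ := hζ ▸ mem_insert _ _
  have hζ₂ : ζ₂ ∈ J₁ ∩ J₂ := hζ ▸ mem_insert_of_mem _ rfl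
  have hpQ : p ∉ Q := hfr _ (hGm (hJ₁s hζ₁.1))
  obtain ⟨Np, Nq, hNp, hNq, hpN, hqN, hdisj⟩ := t2_separation (Ne.symm hqp : p ≠ q)
  obtain ⟨Ap, hAp, hApc, Mp, hMp, hMAp⟩ := hQ.exists_connected_near hpQ (hNp.mem_nhds hpN)
  obtain ⟨Aq, hAq, hAqc, Mq, hMq, hMAq⟩ := hQ.exists_connected_near (hfr q hq) (hNq.mem_nhds hqN)
  have hnear : ∀ ζ ∈ sphere (0 : ℂ) 1, ∀ M ∈ 𝓝 (G ζ), ∃ ε > 0,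
      ∀ z ∈ closedBall (0 : ℂ) 1 ∩ ball ζ ε, G z ∈ M := by
    intro ζ hζ M hM
    obtain ⟨ε, hε, h⟩ := Metric.mem_nhdsWithin_iff.1
      ((hG ζ (sphere_subset_closedBall hζ)).preimage_mem_nhdsWithin hM)
    exact ⟨ε, hε, fun z hz => h ⟨hz.2, hz.1⟩⟩
  have hmemA : ∀ A M : Set X, M ∩ Q ⊆ A → ∀ ζ ε, (∀ z ∈ closedBall (0 : ℂ) 1 ∩ ball ζ ε, G z ∈ M) →
      ball 0 1 ∩ ball ζ ε ⊆ ball 0 1 ∩ F ⁻¹' A := by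
    rintro A M hMA ζ ε h z ⟨hz, hzζ⟩
    refine ⟨hz, hMA ⟨?_, hF.mapsTo hz⟩⟩
    rw [← hGF hz]
    exact h z ⟨ball_subset_closedBall hz, hzζ⟩
  set K := closure (ball 0 1 ∩ F ⁻¹' Ap) with hK
  have hKc : IsPreconnected K :=
    (hF.isPreconnected_preimage Ap (hAp.trans inter_subset_left) hApc).closure
  have hKb : K ⊆ closedBall 0 1 :=
    closure_minimal (inter_subset_left.trans ball_subset_closedBall) isClosed_closedBall
  have hKG : ∀ z ∈ K, G z ∉ Nq := by
    intro z hz hzN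
    have h1 : G z ∈ closure Np := by
      have h2 : ContinuousWithinAt G (ball 0 1 ∩ F ⁻¹' Ap) z :=
        (hG z (hKb hz)).mono (inter_subset_left.trans ball_subset_closedBall)
      refine closure_mono ?_ (h2.mem_closure_image hz)
      rintro _ ⟨w, hw, rfl⟩
      rw [hGF hw.1]
      exact (hAp hw.2).2
    obtain ⟨x, hx1, hx2⟩ := mem_closure_iff.1 h1 _ hNq hzN
    exact hdisj.ne_of_mem hx2 hx1 rfl
  have hζK : ∀ ζ ∈ sphere (0 : ℂ) 1, G ζ = p → ζ ∈ K := by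
    intro ζ hζs hζp
    obtain ⟨ε, hε, h⟩ := hnear ζ hζs Mp (hζp ▸ hMp)
    rw [hK, Metric.mem_closure_iff]
    intro δ hδ
    obtain ⟨w, hw1, hw2⟩ := ball_inter_ball_nonempty (mem_sphere_zero_iff_norm.1 hζs)
      (lt_min hε hδ)
    rw [mem_ball] at hw2
    exact ⟨w, hmemA Ap Mp hMAp ζ ε h ⟨hw1, hw2.trans_le (min_le_left _ _)⟩,
      by rw [dist_comm]; exact hw2.trans_le (min_le_right _ _)⟩
  have hKJ : (K ∪ J₁) ∩ (K ∪ J₂) = K := by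
    rw [← union_inter_distrib_left, hζ]
    refine union_eq_self_of_subset_right ?_
    rintro x (rfl | rfl)
    · exact hζK x (hJ₁s hζ₁.1) rfl
    · exact hζK x (hJ₁s hζ₂.1) hζG.symm
  obtain ⟨e, he, hr⟩ := hX p
  set B := ball 0 1 ∩ F ⁻¹' Aq with hB
  have hBc : IsPreconnected B := hF.isPreconnected_preimage Aq (hAq.trans inter_subset_left) hAqc
  have touch : ∀ η ∈ sphere (0 : ℂ) 1, G η = q → ∀ J ⊆ sphere (0 : ℂ) 1, IsClosed J → η ∉ J →
      ∀ z ∈ B, JoinedOff (e '' (K ∪ J)) (e z) p := by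
    intro η hη hηq J hJs hJc hηJ z hz
    obtain ⟨ε, hε, h⟩ := hnear η hη (Mq ∩ Nq) (hηq ▸ inter_mem hMq (hNq.mem_nhds hqN))
    obtain ⟨δ, hδ, hδJ⟩ := Metric.mem_nhds_iff.1 (hJc.isOpen_compl.mem_nhds hηJ)
    have h' : ∀ z ∈ closedBall (0 : ℂ) 1 ∩ ball η (min ε δ), G z ∈ Mq ∩ Nq := fun z hz =>
      h z ⟨hz.1, ball_subset_ball (min_le_left _ _) hz.2⟩
    refine joinedOff_image_of_touch he hr ?_ (union_subset hKb (hJs.trans sphere_subset_closedBall))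
      hBc (mem_sphere_zero_iff_norm.1 hη) (lt_min hε hδ)
      (hmemA Aq Mq hMAq η _ fun z hz => (h' z hz).1) ?_ hz
    · rw [disjoint_left]
      rintro w (hw | hw) hwB
      · refine hKG w hw ?_
        rw [hGF hwB.1]
        exact (hAq hwB.2).2
      · have h1 := hJs hw
        have h2 := hwB.1
        rw [mem_sphere_zero_iff_norm] at h1
        rw [mem_ball_zero_iff, h1] at h2
        exact lt_irrefl _ h2
    · rw [disjoint_left]
      rintro w (hw | hw) hwη
      · exact hKG w hw (h' w ⟨hKb hw, hwη⟩).2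
      · exact hδJ (ball_subset_ball (min_le_right _ _) hwη) hw
  have hnot : ∀ η, G η = q → η ∉ J₁ ∩ J₂ := by
    intro η hη hηJ
    rw [hζ] at hηJ
    apply hqp
    rcases hηJ with rfl | rfl
    · exact hη.symm
    · rw [mem_singleton_iff, ← hη]; exact hζG.symm
  obtain ⟨z, hz⟩ : B.Nonempty := by
    obtain ⟨ε, hε, h⟩ := hnear η₁ (hJ₁s hη₁) Mq (hη₁q ▸ hMq)
    exact (ball_inter_ball_nonempty (mem_sphere_zero_iff_norm.1 (hJ₁s hη₁)) hε).mono
      (hmemA Aq Mq hMAq η₁ ε h)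
  have hclosed : ∀ J ⊆ sphere (0 : ℂ) 1, IsClosed J → IsClosed (e '' (K ∪ J)) := fun J hJs hJc =>
    (((isCompact_closedBall (0 : ℂ) 1).of_isClosed_subset (isClosed_closure.union hJc)
      (union_subset hKb (hJs.trans sphere_subset_closedBall))).image he.continuous).isClosed
  have hjoin := JoinedOff.union hX (hclosed J₁ hJ₁s hJ₁) (hclosed J₂ hJ₂s hJ₂) (by
      rw [← image_inter he.injective, hKJ]
      exact hKc.image _ he.continuous.continuousOn)
    (touch η₂ (hJ₂s hη₂) hη₂q J₁ hJ₁s hJ₁ (fun h => hnot η₂ hη₂q ⟨h, hη₂⟩) z hz)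
    (touch η₁ (hJ₁s hη₁) hη₁q J₂ hJ₂s hJ₂ (fun h => hnot η₁ hη₁q ⟨hη₁, h⟩) z hz)
  rw [← image_union] at hjoin
  refine not_joinedOff_image_sphere he hr ?_ hz.1 hjoin
  rw [← hJ]
  exact union_subset_union subset_union_right subset_union_right

lemma tendsto_mul_zero_of_eventually_norm_le {ι : Type*} {l : Filter ι} {f g : ι → ℂ} {C : ℝ}
    (hf : ∀ᶠ x in l, ‖f x‖ ≤ C) (hg : Tendsto g l (𝓝 0)) :
    Tendsto (fun x => f x * g x) l (𝓝 0) :=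
  isBoundedUnder_le_mul_tendsto_zero (isBoundedUnder_of_eventually_le hf) hg

lemma AnalyticOnNhd.exists_eq_zero_of_prod_eq_zero {ι : Type*} {U : Set ℂ} (hU : IsPreconnected U)
    (hne : U.Nonempty) (T : Finset ι) {f : ι → ℂ → ℂ} (hf : ∀ i ∈ T, AnalyticOnNhd ℂ (f i) U)
    (h : ∀ z ∈ U, ∏ i ∈ T, f i z = 0) : ∃ i ∈ T, ∀ z ∈ U, f i z = 0 := by
  classical
  induction T using Finset.induction_on with
  | empty =>
    obtain ⟨z, hz⟩ := hne
    simpa using h z hz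
  | insert i T hi ih =>
    have hT : AnalyticOnNhd ℂ (fun z => ∏ i ∈ T, f i z) U := by
      have := Finset.analyticOnNhd_prod (𝕜 := ℂ) (f := f) (s := U) T
        fun j hj => hf j (Finset.mem_insert_of_mem hj)
      intro z hz
      have h2 := this z hz
      rwa [show (∏ n ∈ T, f n) = (fun z => ∏ i ∈ T, f i z) by ext; simp] at h2
    rcases AnalyticOnNhd.eq_zero_or_eq_zero_of_mul_eq_zero (hf i (Finset.mem_insert_self _ _)) hT
      (fun z hz => by rw [← h z hz, Finset.prod_insert hi]) hU with h1 | h1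
    · exact ⟨i, Finset.mem_insert_self _ _, h1⟩
    · obtain ⟨j, hj, h2⟩ := ih (fun j hj => hf j (Finset.mem_insert_of_mem hj)) h1
      exact ⟨j, Finset.mem_insert_of_mem hj, h2⟩

/-- A holomorphic function on the disc with zero boundary values vanishes. -/
lemma eq_zero_of_tendsto_zero_sphere {H : ℂ → ℂ} (hH : DifferentiableOn ℂ H (ball 0 1))
    (h : ∀ ζ ∈ sphere (0 : ℂ) 1, Tendsto H (𝓝[ball 0 1] ζ) (𝓝 0)) :
    ∀ z ∈ ball (0 : ℂ) 1, H z = 0 := by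
  classical
  have hcl : closure (ball (0 : ℂ) 1) = closedBall 0 1 := closure_ball 0 one_ne_zero
  have heq : EqOn (extendFrom (ball 0 1) H) H (ball 0 1) := fun z hz =>
    extendFrom_eq (subset_closure hz) (hH.continuousOn z hz)
  have hd : DiffContOnCl ℂ (extendFrom (ball 0 1) H) (ball 0 1) := by
    refine ⟨hH.congr heq, ?_⟩
    refine continuousOn_extendFrom le_rfl fun z hz => ?_
    rw [hcl] at hz
    rcases (mem_closedBall_zero_iff.1 hz).lt_or_eq with h1 | h1
    · exact ⟨H z, hH.continuousOn z (mem_ball_zero_iff.2 h1)⟩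
    · exact ⟨0, h z (mem_sphere_zero_iff_norm.2 h1)⟩
  intro z hz
  have := Complex.norm_le_of_forall_mem_frontier_norm_le isBounded_ball hd (C := 0) (fun ζ hζ => by
    rw [frontier_ball 0 one_ne_zero] at hζ
    rw [extendFrom_eq (hcl ▸ sphere_subset_closedBall hζ) (h ζ hζ), norm_zero]) (subset_closure hz)
  rw [heq hz] at this
  exact norm_le_zero_iff.1 this

/-- A bounded holomorphic function on the disc with zero boundary values on an arc vanishes. -/
lemma eq_zero_of_tendsto_zero_arc {G : ℂ → ℂ} (hG : DifferentiableOn ℂ G (ball 0 1)) {M : ℝ}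
    (hM : ∀ z ∈ ball (0 : ℂ) 1, ‖G z‖ ≤ M) {ζ₀ : ℂ} (hζ₀ : ‖ζ₀‖ = 1) {ε : ℝ} (hε : 0 < ε)
    (h : ∀ ζ ∈ sphere (0 : ℂ) 1 ∩ ball ζ₀ ε, Tendsto G (𝓝[ball 0 1] ζ) (𝓝 0)) :
    ∀ z ∈ ball (0 : ℂ) 1, G z = 0 := by
  obtain ⟨T, hT⟩ := (isCompact_sphere (0 : ℂ) 1).elim_finite_subcover
    (fun ω : sphere (0 : ℂ) 1 => {z : ℂ | (ω : ℂ) * z ∈ ball ζ₀ ε})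
    (fun ω => isOpen_ball.preimage (by fun_prop)) (fun z hz => by
      have hz1 : ‖z‖ = 1 := mem_sphere_zero_iff_norm.1 hz
      have hz0 : z ≠ 0 := norm_pos_iff.1 (by rw [hz1]; exact one_pos)
      refine mem_iUnion.2 ⟨⟨ζ₀ / z, by simp [hζ₀, hz1]⟩, ?_⟩
      show ζ₀ / z * z ∈ ball ζ₀ ε
      rw [div_mul_cancel₀ _ hz0]
      exact mem_ball_self hε)
  have hrot : ∀ ω : sphere (0 : ℂ) 1, ∀ z : ℂ, ‖(ω : ℂ) * z‖ = ‖z‖ := fun ω z => by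
    rw [norm_mul, mem_sphere_zero_iff_norm.1 ω.2, one_mul]
  have hmaps : ∀ ω : sphere (0 : ℂ) 1, MapsTo (fun z => (ω : ℂ) * z) (ball 0 1) (ball 0 1) :=
    fun ω z hz => by
      rw [mem_ball_zero_iff] at hz ⊢
      rwa [hrot]
  have hdiff : ∀ ω : sphere (0 : ℂ) 1, DifferentiableOn ℂ (fun z => G (ω * z)) (ball 0 1) :=
    fun ω => hG.comp (by fun_prop) (hmaps ω)
  have hzero := eq_zero_of_tendsto_zero_sphere (H := fun z => ∏ ω ∈ T, G (ω * z))
    (DifferentiableOn.fun_finsetProd fun ω _ => hdiff ω) (fun ζ hζ => by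
      classical
      obtain ⟨ω, hωT, hω⟩ : ∃ ω ∈ T, (ω : ℂ) * ζ ∈ ball ζ₀ ε := by simpa using hT hζ
      have h1 : Tendsto (fun z => G (ω * z)) (𝓝[ball 0 1] ζ) (𝓝 0) := by
        refine (h (ω * ζ) ⟨?_, hω⟩).comp ?_
        · rw [mem_sphere_zero_iff_norm, hrot]; exact mem_sphere_zero_iff_norm.1 hζ
        · exact (continuous_const_mul (ω : ℂ)).continuousWithinAt.tendsto_nhdsWithin (hmaps ω)
      simp only [← Finset.mul_prod_erase T _ hωT]
      refine Tendsto.congr (fun z => mul_comm _ _)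
        (tendsto_mul_zero_of_eventually_norm_le (C := M ^ (T.erase ω).card) ?_ h1)
      filter_upwards [self_mem_nhdsWithin] with z hz
      rw [norm_prod]
      calc ∏ b ∈ T.erase ω, ‖G (b * z)‖ ≤ ∏ b ∈ T.erase ω, M :=
            Finset.prod_le_prod (fun _ _ => norm_nonneg _) fun b _ => hM _ (hmaps b hz)
        _ = _ := Finset.prod_const _)
  obtain ⟨ω, -, hω⟩ := AnalyticOnNhd.exists_eq_zero_of_prod_eq_zero
    (convex_ball (0 : ℂ) 1).isPreconnected ⟨0, by simp⟩ T
    (fun ω _ => (hdiff ω).analyticOnNhd isOpen_ball) hzero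
  intro z hz
  have hω1 : ‖(ω : ℂ)‖ = 1 := mem_sphere_zero_iff_norm.1 ω.2
  have hω0 : (ω : ℂ) ≠ 0 := norm_pos_iff.1 (by rw [hω1]; exact one_pos)
  have := hω ((ω : ℂ)⁻¹ * z) (by
    rw [mem_ball_zero_iff] at hz ⊢
    rwa [norm_mul, norm_inv, hω1, inv_one, one_mul])
  rwa [mul_inv_cancel_left₀ hω0] at this

/-- A conformal map onto a domain in the sphere has no constant boundary arc. -/
lemma not_forall_tendsto_arc {X : Type*} [TopologicalSpace X] [CompactSpace X] [T2Space X]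
    {e : ℂ → X} {p : X} (he : IsOpenEmbedding e) (hr : range e = {p}ᶜ) {φ β : ℂ → ℂ} {a c : ℂ}
    {M : ℝ} (hφi : InjOn φ (ball 0 1)) (hβ : DifferentiableOn ℂ β (ball 0 1))
    (hβM : ∀ w ∈ ball (0 : ℂ) 1, ‖β w‖ ≤ M)
    (hφβ : ∀ w ∈ ball (0 : ℂ) 1, β w ≠ 0 ∧ φ w = a + (c + (β w)⁻¹) ^ 2)
    {ζ₀ : ℂ} (hζ₀ : ‖ζ₀‖ = 1) {ε : ℝ} (hε : 0 < ε) (q : X)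
    (h : ∀ ζ ∈ sphere (0 : ℂ) 1 ∩ ball ζ₀ ε,
      Tendsto (fun z => e (φ z)) (𝓝[ball 0 1] ζ) (𝓝 q)) : False := by
  have h0 : (0 : ℂ) ∈ ball (0 : ℂ) 1 := by simp
  by_cases hq : q = p
  · subst hq
    refine (hφβ 0 h0).1 (eq_zero_of_tendsto_zero_arc hβ hβM hζ₀ hε (fun ζ hζ => ?_) 0 h0)
    rw [Metric.tendsto_nhds]
    intro δ hδ
    have hK : (e '' closedBall 0 (‖a‖ + (‖c‖ + δ⁻¹) ^ 2))ᶜ ∈ 𝓝 q :=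
      ((isCompact_closedBall _ _).image he.continuous).isClosed.isOpen_compl.mem_nhds
        (by rintro ⟨z, -, hz⟩; exact chart_ne hr z hz)
    filter_upwards [h ζ hζ hK, self_mem_nhdsWithin] with z hz hzb
    by_contra hcon
    rw [dist_zero_right, not_lt] at hcon
    refine hz ⟨φ z, ?_, rfl⟩
    rw [mem_closedBall_zero_iff, (hφβ z hzb).2]
    have h1 : ‖(β z)⁻¹‖ ≤ δ⁻¹ := by
      rw [norm_inv]
      exact inv_anti₀ hδ hcon
    calc ‖a + (c + (β z)⁻¹) ^ 2‖ ≤ ‖a‖ + ‖c + (β z)⁻¹‖ ^ 2 := by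
          rw [← norm_pow]; exact norm_add_le _ _
      _ ≤ ‖a‖ + (‖c‖ + δ⁻¹) ^ 2 := by
          gcongr
          exact (norm_add_le _ _).trans (by gcongr)
  · obtain ⟨c₀, rfl⟩ := exists_chart_eq hr hq
    have hlim : ∀ ζ ∈ sphere (0 : ℂ) 1 ∩ ball ζ₀ ε, Tendsto φ (𝓝[ball 0 1] ζ) (𝓝 c₀) :=
      fun ζ hζ => he.isInducing.tendsto_nhds_iff.2 (h ζ hζ)
    have heq : ∀ z ∈ ball (0 : ℂ) 1,
        β z ^ 2 * (a - c₀) + (c * β z + 1) ^ 2 = β z ^ 2 * (φ z - c₀) := fun z hz => by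
      have := (hφβ z hz).1
      rw [(hφβ z hz).2]
      field_simp
      ring
    have hM0 : 0 ≤ M := (norm_nonneg _).trans (hβM 0 h0)
    have hzero := eq_zero_of_tendsto_zero_arc
      (G := fun z => β z ^ 2 * (a - c₀) + (c * β z + 1) ^ 2)
      (M := M ^ 2 * ‖a - c₀‖ + (‖c‖ * M + 1) ^ 2)
      (((hβ.fun_pow 2).mul_const _).add (((hβ.const_mul c).add_const 1).fun_pow 2))
      (fun z hz => by
        have := hβM z hz
        refine (norm_add_le _ _).trans ?_
        rw [norm_mul, norm_pow, norm_pow]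
        gcongr
        refine (norm_add_le _ _).trans ?_
        rw [norm_mul, norm_one]
        gcongr) hζ₀ hε (fun ζ hζ => by
        have h1 : Tendsto (fun z => β z ^ 2 * (φ z - c₀)) (𝓝[ball 0 1] ζ) (𝓝 0) := by
          refine tendsto_mul_zero_of_eventually_norm_le (C := M ^ 2) ?_ ?_
          · filter_upwards [self_mem_nhdsWithin] with z hz
            rw [norm_pow]
            have := hβM z hz
            gcongr
          · simpa using (hlim ζ hζ).sub_const c₀
        refine h1.congr' ?_
        filter_upwards [self_mem_nhdsWithin] with z hz using (heq z hz).symm)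
    have hconst : ∀ z ∈ ball (0 : ℂ) 1, φ z = c₀ := fun z hz => by
      have h1 := hzero z hz
      rw [heq z hz] at h1
      have := (mul_eq_zero.1 h1).resolve_left (pow_ne_zero 2 (hφβ z hz).1)
      linear_combination this
    have h2 : (1 / 2 : ℂ) ∈ ball (0 : ℂ) 1 := by norm_num
    have := hφi h0 h2 (by rw [hconst _ h0, hconst _ h2])
    norm_num at this

/-- A circle map of degree `d > 0` that only identifies points by collapsing arcs is monotone. -/
lemma monotone_of_collapse {a : ℝ → ℝ} (ha : Continuous a) {T D : ℝ} (hT : 0 < T) (hD : 0 < D)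
    (hper : ∀ t, a (t + T) = a t + D)
    (hP : ∀ s t, s < t → t < s + T → a s = a t →
      (∀ u ∈ Icc s t, a u = a s) ∨ ∀ u ∈ Icc t (s + T), a u = a t) : Monotone a := by
  have hshift : ∀ n : ℕ, ∀ t, a t ≤ a (t + n * T) := by
    intro n t
    induction n with
    | zero => simp
    | succ n ih =>
      rw [show t + ((n + 1 : ℕ) : ℝ) * T = (t + n * T) + T by push_cast; ring, hper]
      linarith
  by_contra hcon
  simp only [Monotone, not_forall, not_le] at hcon
  obtain ⟨s, t', hst', hlt'⟩ := hcon
  obtain ⟨t, hst, htT, hlt⟩ : ∃ t, s < t ∧ t < s + T ∧ a t < a s := by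
    set n := ⌊(t' - s) / T⌋₊ with hn
    have h0 : 0 ≤ (t' - s) / T := div_nonneg (by linarith) hT.le
    have h1 : n * T ≤ t' - s := (le_div_iff₀ hT).1 (Nat.floor_le h0)
    have h2 : t' - s < (n + 1) * T := (div_lt_iff₀ hT).1 (Nat.lt_floor_add_one _)
    have h3 := hshift n (t' - n * T)
    rw [sub_add_cancel] at h3
    refine ⟨t' - n * T, lt_of_le_of_ne (by linarith) ?_, by linarith, by linarith⟩
    intro h
    rw [← h] at h3
    linarith
  obtain ⟨y, hy1, hy2⟩ := exists_between hlt
  have hsT := hper s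
  obtain ⟨u, hu, hau⟩ := intermediate_value_Ioo' hst.le ha.continuousOn ⟨hy1, hy2⟩
  obtain ⟨v, hv, hav⟩ := intermediate_value_Ioo htT.le ha.continuousOn
    (show y ∈ Ioo _ _ from ⟨hy1, by linarith⟩)
  rcases hP u v (hu.2.trans hv.1) (by linarith [hv.2, hu.1]) (hau.trans hav.symm) with h | h
  · have := h t ⟨hu.2.le, hv.1.le⟩
    linarith
  · have := h (s + T) ⟨hv.2.le, by linarith [hu.1]⟩
    linarith

lemma not_collapse_of_periodic {a : ℝ → ℝ} (ha : Continuous a) {T : ℝ}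
    (hper : ∀ t, a (t + T) = a t)
    (hP : ∀ s t, s < t → t < s + T → a s = a t →
      (∀ u ∈ Icc s t, a u = a s) ∨ ∀ u ∈ Icc t (s + T), a u = a t) {s t : ℝ} (hst : s < t)
    (htT : t < s + T) (hlt : a s < a t) : False := by
  obtain ⟨y, hy1, hy2⟩ := exists_between hlt
  obtain ⟨u, hu, hau⟩ := intermediate_value_Ioo hst.le ha.continuousOn ⟨hy1, hy2⟩
  obtain ⟨v, hv, hav⟩ := intermediate_value_Ioo' htT.le ha.continuousOn
    (show y ∈ Ioo _ _ from ⟨by rw [hper]; exact hy1, hy2⟩)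
  rcases hP u v (hu.2.trans hv.1) (by linarith [hv.2, hu.1]) (hau.trans hav.symm) with h | h
  · have := h t ⟨hu.2.le, hv.1.le⟩
    linarith
  · have := h (s + T) ⟨hv.2.le, by linarith [hu.1]⟩
    rw [hper] at this
    linarith

/-- The radial extension to the disc of a degree one monotone circle map, straightened in the
interior. -/
lemma exists_disc_extension {α : ℝ → ℝ} (hα : Continuous α) (hmono : Monotone α)
    (hper : ∀ t, α (t + 2 * Real.pi) = α t + 2 * Real.pi) :
    ∃ H : ℂ → ℂ, Continuous H ∧ BijOn H (ball 0 1) (ball 0 1) ∧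
      ∀ θ : ℝ, H (Complex.exp (θ * Complex.I)) = Complex.exp (α θ * Complex.I) := by
  set k : ℝ → ℝ := fun θ => α θ - θ with hk
  have hkc : Continuous k := by fun_prop
  have hkp : Function.Periodic k (2 * Real.pi) := fun θ => by
    simp only [hk, hper]; ring
  obtain ⟨C, hC⟩ : ∃ C, ∀ θ, |k θ| ≤ C := by
    obtain ⟨C, hC⟩ := (hkp.compact_of_continuous (by positivity) hkc).isBounded.exists_norm_le
    exact ⟨C, fun θ => hC _ (mem_range_self _)⟩
  set κ : ℂ → ℝ := fun z => Function.Periodic.lift hkp (Complex.arg z : Real.Angle) with hκ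
  have hlift : Continuous (Function.Periodic.lift hkp : Real.Angle → ℝ) :=
    hkc.quotient_lift _
  have hκc : ∀ z ≠ 0, ContinuousAt κ z := fun z hz =>
    hlift.continuousAt.comp (Complex.continuousAt_arg_coe_angle hz)
  have hκv : ∀ r > 0, ∀ θ : ℝ, κ ((r : ℝ) * Complex.exp (θ * Complex.I)) = k θ := by
    intro r hr θ
    have : ((Complex.arg ((r : ℝ) * Complex.exp (θ * Complex.I)) : ℝ) : Real.Angle) = θ := by
      rw [Complex.arg_real_mul _ hr, Complex.arg_exp_mul_I]
      simp
    simp only [hκ, this]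
    rfl
  set H : ℂ → ℂ := fun z => z * Complex.exp ((‖z‖ * κ z : ℝ) * Complex.I) with hH
  have hnorm : ∀ z, ‖H z‖ = ‖z‖ := fun z => by
    rw [hH]; simp only [norm_mul, Complex.norm_exp_ofReal_mul_I, mul_one]
  have hval : ∀ r > 0, ∀ θ : ℝ, H ((r : ℝ) * Complex.exp (θ * Complex.I)) =
      r * Complex.exp ((((1 - r) * θ + r * α θ : ℝ) : ℂ) * Complex.I) := by
    intro r hr θ
    simp only [hH]
    rw [hκv r hr, norm_mul, Complex.norm_exp_ofReal_mul_I, Complex.norm_real, Real.norm_eq_abs,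
      abs_of_pos hr, mul_one, mul_assoc, ← Complex.exp_add]
    congr 2
    simp only [hk]
    push_cast
    ring
  have hcont : Continuous H := by
    rw [continuous_iff_continuousAt]
    intro z
    by_cases hz : z = 0
    · subst hz
      have h0 : H 0 = 0 := by simp [hH]
      rw [ContinuousAt, h0, tendsto_zero_iff_norm_tendsto_zero]
      simp only [hnorm]
      simpa using (continuous_norm (E := ℂ)).tendsto 0
    · have := hκc z hz
      fun_prop
  have hpolar : ∀ z : ℂ, z = (‖z‖ : ℝ) * Complex.exp (Complex.arg z * Complex.I) := fun z =>
    (Complex.norm_mul_exp_arg_mul_I z).symm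
  have hmapsnorm : MapsTo H (ball 0 1) (ball 0 1) := fun z hz => by
    rw [mem_ball_zero_iff] at hz ⊢
    rwa [hnorm]
  refine ⟨H, hcont, ⟨hmapsnorm, ?_, ?_⟩, fun θ => ?_⟩
  · intro z hz w hw hzw
    have hnn : ‖z‖ = ‖w‖ := by rw [← hnorm z, hzw, hnorm]
    rcases (norm_nonneg z).eq_or_lt with h0 | h0
    · rw [norm_eq_zero.1 h0.symm, norm_eq_zero.1 (hnn.symm.trans h0.symm)]
    set r := ‖z‖ with hr
    have hr1 : r < 1 := mem_ball_zero_iff.1 hz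
    have hs : StrictMono fun θ : ℝ => (1 - r) * θ + r * α θ := by
      intro s t hst
      have h1 := mul_lt_mul_of_pos_left hst (show 0 < 1 - r by linarith)
      have h2 := mul_le_mul_of_nonneg_left (hmono hst.le) h0.le
      simp only
      linarith
    have hshift : ∀ n : ℤ, ∀ θ, α (θ + n * (2 * Real.pi)) = α θ + n * (2 * Real.pi) := by
      intro n θ
      have := (hkp.int_mul n) θ
      simp only [hk] at this
      linarith
    rw [hpolar z, hpolar w, ← hnn, hval r h0, hval r h0] at hzw
    have h1 := mul_left_cancel₀ (by exact_mod_cast h0.ne') hzw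
    obtain ⟨n, hn⟩ := Complex.exp_eq_exp_iff_exists_int.1 h1
    have h2 : ((1 - r) * z.arg + r * α z.arg) = ((1 - r) * w.arg + r * α w.arg) +
        n * (2 * Real.pi) := by
      have h3 := congrArg Complex.im hn
      simpa using h3
    have h3 : z.arg = w.arg + n * (2 * Real.pi) := by
      apply hs.injective
      simp only [hshift, h2]
      ring
    rw [hpolar z, hpolar w, ← hnn, h3]
    congr 1
    rw [Complex.exp_eq_exp_iff_exists_int]
    exact ⟨n, by push_cast; ring⟩
  · intro w hw
    rcases (norm_nonneg w).eq_or_lt with h0 | h0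
    · refine ⟨0, by simp, ?_⟩
      rw [norm_eq_zero.1 h0.symm]; simp [hH]
    set r := ‖w‖ with hr
    have hsurj : Function.Surjective fun θ : ℝ => (1 - r) * θ + r * α θ := by
      have hge : ∀ θ, |((1 - r) * θ + r * α θ) - θ| ≤ r * C := fun θ => by
        rw [show ((1 - r) * θ + r * α θ) - θ = r * k θ by simp only [hk]; ring, abs_mul,
          abs_of_pos h0]
        exact mul_le_mul_of_nonneg_left (hC θ) h0.le
      refine Continuous.surjective (by fun_prop) ?_ ?_
      · refine tendsto_atTop_mono (fun θ => ?_) (tendsto_atTop_add_const_right _ (-(r * C)) tendsto_id)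
        have := (abs_le.1 (hge θ)).1
        simp only [id]
        linarith
      · refine tendsto_atBot_mono (fun θ => ?_) (tendsto_atBot_add_const_right _ (r * C) tendsto_id)
        have := (abs_le.1 (hge θ)).2
        simp only [id]
        linarith
    obtain ⟨θ, hθ⟩ := hsurj w.arg
    refine ⟨r * Complex.exp (θ * Complex.I), ?_, ?_⟩
    · rw [mem_ball_zero_iff, norm_mul, Complex.norm_exp_ofReal_mul_I, mul_one, Complex.norm_real,
        norm_norm]
      exact mem_ball_zero_iff.1 hw
    · simp only at hθ
      rw [hval r h0, hθ]
      exact (hpolar w).symm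
  · have := hval 1 one_pos θ
    simpa using this

/-- A circle map that only identifies points by collapsing arcs lifts to a monotone or antitone
real function. -/
lemma exists_lift_of_collapse {μ : ℝ → ℂ} (hμ : Continuous μ) (hμ1 : ∀ θ, ‖μ θ‖ = 1)
    (hper : ∀ θ, μ (θ + 2 * Real.pi) = μ θ) (hne : ∀ w, ∃ θ, μ θ ≠ w)
    (hP : ∀ s t, s < t → t < s + 2 * Real.pi → μ s = μ t →
      (∀ u ∈ Icc s t, μ u = μ s) ∨ ∀ u ∈ Icc t (s + 2 * Real.pi), μ u = μ t) :
    ∃ α : ℝ → ℝ, Continuous α ∧ (∀ θ, μ θ = Complex.exp (α θ * Complex.I)) ∧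
      ((Monotone α ∧ ∀ θ, α (θ + 2 * Real.pi) = α θ + 2 * Real.pi) ∨
        (Antitone α ∧ ∀ θ, α (θ + 2 * Real.pi) = α θ - 2 * Real.pi)) := by
  have hpi := Real.two_pi_pos
  obtain ⟨L, hL, hLμ⟩ := exists_continuous_log hμ fun θ => norm_pos_iff.1 (by rw [hμ1]; norm_num)
  have hLre : ∀ θ, (L θ).re = 0 := fun θ => by
    have h1 := hμ1 θ
    rwa [← hLμ, Complex.norm_exp, Real.exp_eq_one_iff] at h1
  set α : ℝ → ℝ := fun θ => (L θ).im with hα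
  have hαc : Continuous α := Complex.continuous_im.comp hL
  have hLα : ∀ θ, L θ = α θ * Complex.I := fun θ => by
    apply Complex.ext <;> simp [hα, hLre]
  have hμα : ∀ θ, μ θ = Complex.exp (α θ * Complex.I) := fun θ => by rw [← hLα, hLμ]
  have hconst : ∀ s t w, (∀ u ∈ Icc s t, μ u = w) → ∀ u ∈ Icc s t, ∀ v ∈ Icc s t, α u = α v := by
    intro s t w h u hu v hv
    have := eqOn_add_const_of_exp_eq (K := Icc s t) isPreconnected_Icc (L := L)
      (M := fun _ => L u) hL.continuousOn continuousOn_const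
      (fun z hz => by rw [hLμ, hLμ, h z hz, h u hu]) hu hv
    simp only [sub_self] at this
    simp only [hα]
    rw [sub_eq_zero.1 this.symm]
  have hPα : ∀ s t, s < t → t < s + 2 * Real.pi → (∃ n : ℤ, α t = α s + n * (2 * Real.pi)) →
      (∀ u ∈ Icc s t, α u = α s) ∨ ∀ u ∈ Icc t (s + 2 * Real.pi), α u = α t := by
    rintro s t hst hts ⟨n, hn⟩
    have h1 : μ s = μ t := by
      rw [hμα, hμα, Complex.exp_eq_exp_iff_exists_int]
      exact ⟨-n, by rw [hn]; push_cast; ring⟩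
    rcases hP s t hst hts h1 with h | h
    · exact Or.inl fun u hu => hconst _ _ _ h u hu s ⟨le_rfl, hst.le⟩
    · exact Or.inr fun u hu => hconst _ _ _ h u hu t ⟨le_rfl, hts.le⟩
  have hP0 : ∀ s t, s < t → t < s + 2 * Real.pi → α s = α t →
      (∀ u ∈ Icc s t, α u = α s) ∨ ∀ u ∈ Icc t (s + 2 * Real.pi), α u = α t :=
    fun s t h1 h2 h3 => hPα s t h1 h2 ⟨0, by simp [h3]⟩
  obtain ⟨d, hd⟩ : ∃ d : ℤ, ∀ θ, α (θ + 2 * Real.pi) = α θ + d * (2 * Real.pi) := by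
    have h0 : Complex.exp (L (0 + 2 * Real.pi)) = Complex.exp (L 0) := by
      rw [hLμ, hLμ, hper]
    obtain ⟨d, hd⟩ := Complex.exp_eq_exp_iff_exists_int.1 h0
    refine ⟨d, fun θ => ?_⟩
    have := eqOn_add_const_of_exp_eq (K := univ) isPreconnected_univ
      (L := fun θ => L (θ + 2 * Real.pi)) (M := L) (by fun_prop) hL.continuousOn
      (fun z _ => by rw [hLμ, hLμ, hper]) (mem_univ θ) (mem_univ 0)
    have h2 : L (θ + 2 * Real.pi) = L θ + d * (2 * Real.pi * Complex.I) := by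
      linear_combination this + hd
    have h3 := congrArg Complex.im h2
    simpa using h3
  obtain ⟨θ₀, hθ₀⟩ := hne (μ 0)
  have hmono_deg : ∀ β : ℝ → ℝ, Continuous β → Monotone β → ∀ d : ℤ, 0 < d →
      (∀ θ, β (θ + 2 * Real.pi) = β θ + d * (2 * Real.pi)) →
      (∀ s t, s < t → t < s + 2 * Real.pi → (∃ n : ℤ, β t = β s + n * (2 * Real.pi)) →
        (∀ u ∈ Icc s t, β u = β s) ∨ ∀ u ∈ Icc t (s + 2 * Real.pi), β u = β t) → d = 1 := by
    intro β hβ hβm d hd0 hβd hβP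
    by_contra hd1
    have hd2 : (2 : ℝ) ≤ d := by exact_mod_cast (show (2 : ℤ) ≤ d by omega)
    have h0 := hβd 0
    rw [zero_add] at h0
    have h2pi : 2 * (2 * Real.pi) ≤ d * (2 * Real.pi) := mul_le_mul_of_nonneg_right hd2 hpi.le
    obtain ⟨u, hu, hβu⟩ := intermediate_value_Ioo hpi.le hβ.continuousOn
      (show β 0 + 2 * Real.pi ∈ Ioo _ _ from ⟨by linarith, by linarith⟩)
    rcases hβP 0 u hu.1 (by linarith [hu.2]) ⟨1, by simp [hβu]⟩ with h | h
    · have := h u ⟨hu.1.le, le_rfl⟩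
      linarith
    · have := h (2 * Real.pi) ⟨hu.2.le, by linarith⟩
      linarith
  refine ⟨α, hαc, hμα, ?_⟩
  rcases lt_trichotomy d 0 with hdlt | hd0 | hdgt
  · right
    have hdn : ∀ θ, α (-(θ + 2 * Real.pi)) = α (-θ) + (-d : ℤ) * (2 * Real.pi) := fun θ => by
      have := hd (-(θ + 2 * Real.pi))
      rw [show -(θ + 2 * Real.pi) + 2 * Real.pi = -θ by ring] at this
      push_cast
      linarith
    have hrefl : ∀ s t, s < t → t < s + 2 * Real.pi → 
        (∃ n : ℤ, α (-t) = α (-s) + n * (2 * Real.pi)) →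
        (∀ u ∈ Icc s t, α (-u) = α (-s)) ∨ ∀ u ∈ Icc t (s + 2 * Real.pi), α (-u) = α (-t) := by
      rintro s t hst hts ⟨n, hn⟩
      rcases hPα (-t) (-s) (by linarith) (by linarith) ⟨-n, by rw [hn]; push_cast; ring⟩ with h | h
      · exact Or.inl fun u hu => (h (-u) ⟨by linarith [hu.2], by linarith [hu.1]⟩).trans
          (h (-s) ⟨by linarith, le_rfl⟩).symm
      · refine Or.inr fun u hu => ?_
        have h1 := h (-u + 2 * Real.pi) ⟨by linarith [hu.2], by linarith [hu.1]⟩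
        have h2 := h (-t + 2 * Real.pi) ⟨by linarith, le_rfl⟩
        rw [hd] at h1 h2
        linarith
    have hdpos : (0 : ℝ) < (-d : ℤ) := by exact_mod_cast (show (0 : ℤ) < -d by omega)
    have hm : Monotone fun θ => α (-θ) :=
      monotone_of_collapse (by fun_prop) hpi (mul_pos hdpos hpi) hdn fun s t h1 h2 h3 =>
        hrefl s t h1 h2 ⟨0, by simp [h3]⟩
    have hd1 := hmono_deg (fun θ => α (-θ)) (by fun_prop) hm (-d) (by omega) hdn hrefl
    refine ⟨fun s t hst => ?_, fun θ => ?_⟩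
    · have := hm (neg_le_neg hst)
      simpa using this
    · rw [hd, show d = -1 by omega]
      push_cast
      ring
  · exfalso
    have hdp : ∀ θ, α (θ + 2 * Real.pi) = α θ := fun θ => by rw [hd, hd0]; simp
    obtain ⟨t, ht1, ht2⟩ : ∃ t ∈ Ioo 0 (2 * Real.pi), μ t ≠ μ 0 := by
      obtain ⟨t, ht, hμt⟩ := (show Function.Periodic μ (2 * Real.pi) from hper).exists_mem_Ico₀ hpi θ₀
      refine ⟨t, ⟨lt_of_le_of_ne ht.1 ?_, ht.2⟩, hμt ▸ hθ₀⟩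
      rintro rfl
      exact hθ₀ hμt
    have hαt : α t ≠ α 0 := fun h => ht2 (by rw [hμα, hμα, h])
    rcases hαt.lt_or_gt with h | h
    · refine not_collapse_of_periodic hαc hdp hP0 (s := t) (t := 0 + 2 * Real.pi) (by linarith [ht1.2])
        (by linarith [ht1.1]) (by rw [hdp]; exact h)
    · exact not_collapse_of_periodic hαc hdp hP0 ht1.1 (by linarith [ht1.2]) h
  · left
    have hdpos : (0 : ℝ) < d := by exact_mod_cast hdgt
    have hm : Monotone α := monotone_of_collapse hαc hpi (mul_pos hdpos hpi) hd hP0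
    have hd1 := hmono_deg α hαc hm d hdgt hd hPα
    exact ⟨hm, fun θ => by rw [hd, hd1]; simp⟩

/-- A circle map that only identifies points by collapsing arcs extends to a map of the disc that
is bijective on the interior. -/
theorem exists_disc_extension_of_collapse {m : ℂ → ℂ} (hm : ContinuousOn m (sphere 0 1))
    (hm1 : MapsTo m (sphere 0 1) (sphere 0 1)) (hms : SurjOn m (sphere 0 1) (sphere 0 1))
    (hP : ∀ s t : ℝ, s < t → t < s + 2 * Real.pi →
      m (Complex.exp (s * Complex.I)) = m (Complex.exp (t * Complex.I)) →
      (∀ u ∈ Icc s t, m (Complex.exp ((u : ℝ) * Complex.I)) = m (Complex.exp (s * Complex.I))) ∨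
      ∀ u ∈ Icc t (s + 2 * Real.pi),
        m (Complex.exp ((u : ℝ) * Complex.I)) = m (Complex.exp (t * Complex.I))) :
    ∃ H : ℂ → ℂ, Continuous H ∧ BijOn H (ball 0 1) (ball 0 1) ∧ EqOn H m (sphere 0 1) := by
  have hE : ∀ θ : ℝ, Complex.exp (θ * Complex.I) ∈ sphere (0 : ℂ) 1 := fun θ => by simp
  have hpolar : ∀ z ∈ sphere (0 : ℂ) 1, z = Complex.exp (Complex.arg z * Complex.I) := fun z hz => by
    have := (Complex.norm_mul_exp_arg_mul_I z).symm
    rwa [mem_sphere_zero_iff_norm.1 hz, Complex.ofReal_one, one_mul] at this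
  obtain ⟨α, hα, hαm, h⟩ := exists_lift_of_collapse
    (μ := fun θ : ℝ => m (Complex.exp (θ * Complex.I)))
    (hm.comp_continuous (by fun_prop) hE) (fun θ => mem_sphere_zero_iff_norm.1 (hm1 (hE θ)))
    (fun θ => by
      congr 1
      rw [Complex.exp_eq_exp_iff_exists_int]
      exact ⟨1, by push_cast; ring⟩)
    (fun w => by
      obtain ⟨v, hv, hvw⟩ : ∃ v ∈ sphere (0 : ℂ) 1, v ≠ w := by
        by_cases hw : w = 1
        · exact ⟨-1, by simp, by rw [hw]; norm_num⟩
        · exact ⟨1, by simp, fun h => hw h.symm⟩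
      obtain ⟨z, hz, rfl⟩ := hms hv
      refine ⟨z.arg, ?_⟩
      rwa [← hpolar z hz]) hP
  rcases h with ⟨hmono, hper⟩ | ⟨hanti, hper⟩
  · obtain ⟨H, hH, hbij, hval⟩ := exists_disc_extension hα hmono hper
    refine ⟨H, hH, hbij, fun z hz => ?_⟩
    rw [hpolar z hz, hval, hαm]
  · obtain ⟨H, hH, hbij, hval⟩ := exists_disc_extension (α := fun θ => α (-θ)) (by fun_prop)
      (fun s t hst => hanti (neg_le_neg hst)) (fun θ => by
        have := hper (-(θ + 2 * Real.pi))
        rw [show -(θ + 2 * Real.pi) + 2 * Real.pi = -θ by ring] at this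
        linarith)
    have hconj : BijOn (starRingEnd ℂ) (ball 0 1) (ball 0 1) := by
      refine ⟨fun z hz => by simpa using hz, (RingHom.injective _).injOn, fun z hz => ?_⟩
      exact ⟨starRingEnd ℂ z, by simpa using hz, by simp⟩
    refine ⟨fun z => H (starRingEnd ℂ z), hH.comp Complex.continuous_conj, hbij.comp hconj,
      fun z hz => ?_⟩
    have hc : starRingEnd ℂ z = Complex.exp ((-z.arg : ℝ) * Complex.I) := by
      conv_lhs => rw [hpolar z hz]
      rw [← Complex.exp_conj]
      simp
    change H (starRingEnd ℂ z) = m z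
    rw [hc, hval, neg_neg, ← hαm, ← hpolar z hz]

lemma IsPreconnected.preimage_of_isConnected_fibers {X Y : Type*} [TopologicalSpace X]
    [TopologicalSpace Y] {h : X → Y} (hcl : IsClosedMap h)
    (hfib : ∀ b, IsConnected (h ⁻¹' {b})) {A : Set Y} (hA : IsPreconnected A) :
    IsPreconnected (h ⁻¹' A) := by
  rw [isPreconnected_closed_iff] at hA ⊢
  rintro C₁ C₂ hC₁ hC₂ hsub ⟨x₁, hx₁, hx₁C⟩ ⟨x₂, hx₂, hx₂C⟩
  have hcover : A ⊆ h '' C₁ ∪ h '' C₂ := fun y hy => by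
    obtain ⟨x, rfl⟩ := (hfib y).nonempty
    rcases hsub (show x ∈ h ⁻¹' A from hy) with hx | hx
    · exact Or.inl ⟨x, hx, rfl⟩
    · exact Or.inr ⟨x, hx, rfl⟩
  obtain ⟨_, hy, ⟨z₁, hz₁, rfl⟩, ⟨z₂, hz₂, hz⟩⟩ := hA _ _ (hcl _ hC₁) (hcl _ hC₂) hcover
    ⟨h x₁, hx₁, x₁, hx₁C, rfl⟩ ⟨h x₂, hx₂, x₂, hx₂C, rfl⟩
  have hf : h ⁻¹' {h z₁} ⊆ h ⁻¹' A := fun x hx => by rw [mem_preimage, hx]; exact hy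
  obtain ⟨x, hx, hxC⟩ := isPreconnected_closed_iff.1 (hfib (h z₁)).isPreconnected C₁ C₂ hC₁ hC₂
    (hf.trans hsub) ⟨z₁, rfl, hz₁⟩ ⟨z₂, hz, hz₂⟩
  exact ⟨x, hf hx, hxC⟩

/-- A conformal parametrization of the open subset `U` of a topological sphere, together with its
expression in a chart through a bounded univalent function. -/
structure IsRiemannMap {X : Type*} [TopologicalSpace X] (Φ : ℂ → X) (ψ : X → ℂ) (U : Set X) :
    Prop where
  continuousOn : ContinuousOn Φ (ball 0 1)
  continuousOn_inv : ContinuousOn ψ U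
  mapsTo : MapsTo Φ (ball 0 1) U
  mapsTo_inv : MapsTo ψ U (ball 0 1)
  right_inv : ∀ x ∈ U, Φ (ψ x) = x
  left_inv : ∀ w ∈ ball (0 : ℂ) 1, ψ (Φ w) = w
  factor : ∃ (p : X) (e : ℂ → X) (φ β : ℂ → ℂ) (a c : ℂ) (M : ℝ), IsOpenEmbedding e ∧
    range e = {p}ᶜ ∧ (∀ w, Φ w = e (φ w)) ∧ DifferentiableOn ℂ β (ball 0 1) ∧
    InjOn β (ball 0 1) ∧ (∀ w ∈ ball (0 : ℂ) 1, ‖β w‖ ≤ M) ∧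
    ∀ w ∈ ball (0 : ℂ) 1, β w ≠ 0 ∧ φ w = a + (c + (β w)⁻¹) ^ 2

/-- The Riemann mapping theorem for simply connected domains of a topological sphere. -/
theorem exists_isRiemannMap {X : Type*} [TopologicalSpace X] [CompactSpace X] [T2Space X]
    [LocallyConnectedSpace X] (hX : IsSphereLike X) {U : Set X} (hU : IsOpen U)
    (hc : IsConnected U) (hcc : IsPreconnected Uᶜ) (hnt : Uᶜ.Nontrivial) :
    ∃ Φ ψ, IsRiemannMap Φ ψ U := by
  obtain ⟨p, hp, q, hq, hpq⟩ := hnt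
  obtain ⟨e, he, hr⟩ := hX p
  obtain ⟨a, rfl⟩ := exists_chart_eq hr hpq.symm
  have hlog : HasLogs (e ⁻¹' U) := fun f hf h0 =>
    hasLogOn_of_isPreconnected_compl he hr hU hc hcc hp hf h0
  obtain ⟨φ, g, β, c, M, hφ, hg, hφm, hgm, hφg, hgφ, hβ, hβi, hβM, hβe⟩ :=
    hlog.exists_riemannMap (hU.preimage he.continuous) (isConnected_preimage_chart he hr hc hp)
      (a := a) hq
  have hinv : ∀ z, Function.invFun e (e z) = z := Function.leftInverse_invFun he.injective
  have hUe : ∀ x ∈ U, ∃ z, e z = x := fun x hx =>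
    exists_chart_eq hr fun h => hp (h ▸ hx)
  have hUm : ∀ x ∈ U, Function.invFun e x ∈ e ⁻¹' U := fun x hx => by
    obtain ⟨z, rfl⟩ := hUe x hx
    rw [hinv]; exact hx
  refine ⟨fun w => e (φ w), fun x => g (Function.invFun e x),
    he.continuous.comp_continuousOn hφ.continuousOn, ?_, fun w hw => hφm hw,
    fun x hx => hgm (hUm x hx), fun x hx => ?_, fun w hw => ?_,
    p, e, φ, β, a, c, M, he, hr, fun _ => rfl, hβ, hβi, hβM, hβe⟩
  · refine hg.comp (fun x hx => ?_) hUm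
    obtain ⟨z, rfl⟩ := hUe x hx
    have : ContinuousAt (Function.invFun e) (e z) := by
      rw [ContinuousAt, hinv, ← he.map_nhds_eq, tendsto_map'_iff]
      simp only [Function.comp_def, hinv]
      exact tendsto_id
    exact this.continuousWithinAt
  · obtain ⟨z, rfl⟩ := hUe x hx
    simp only [hinv]
    rw [hφg z hx]
  · simp only [hinv]
    exact hgφ w hw

lemma IsRiemannMap.injOn {X : Type*} [TopologicalSpace X] {Φ : ℂ → X} {ψ : X → ℂ} {U : Set X}
    (hΦ : IsRiemannMap Φ ψ U) : InjOn Φ (ball 0 1) := fun z hz w hw h => by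
  rw [← hΦ.left_inv z hz, h, hΦ.left_inv w hw]

/-- Composing a Riemann map of the preimage of `Q` with a monotone map yields a disc map. -/
theorem IsRiemannMap.isDiscMap {X : Type*} [TopologicalSpace X] [CompactSpace X] [T2Space X]
    {Φ : ℂ → X} {ψ : X → ℂ} {Q : Set X} {h : X → X} (hΦ : IsRiemannMap Φ ψ (h ⁻¹' Q))
    (hcont : Continuous h) (hfib : ∀ b, IsConnected (h ⁻¹' {b})) :
    IsDiscMap (fun w => h (Φ w)) Q := by
  have hpre : ∀ A ⊆ Q, ball 0 1 ∩ (fun w => h (Φ w)) ⁻¹' A = ψ '' (h ⁻¹' A) := fun A hA => by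
    ext w
    constructor
    · rintro ⟨hw, hwA⟩
      exact ⟨Φ w, hwA, hΦ.left_inv w hw⟩
    · rintro ⟨x, hx, rfl⟩
      refine ⟨hΦ.mapsTo_inv (hA hx), ?_⟩
      rw [mem_preimage, hΦ.right_inv x (hA hx)]
      exact hx
  refine ⟨hcont.comp_continuousOn hΦ.continuousOn, fun w hw => hΦ.mapsTo hw, fun y hy => ?_,
    fun K hK hKc => ?_, fun A hA hAc => ?_, ?_⟩
  · obtain ⟨x, rfl⟩ := (hfib y).nonempty
    exact ⟨ψ x, hΦ.mapsTo_inv hy, by simp only; rw [hΦ.right_inv x hy]⟩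
  · rw [hpre K hK]
    exact (hKc.isClosed.preimage hcont).isCompact.image_of_continuousOn
      (hΦ.continuousOn_inv.mono (preimage_mono hK))
  · rw [hpre A hA]
    exact (hAc.preimage_of_isConnected_fibers hcont.isClosedMap hfib).image _
      (hΦ.continuousOn_inv.mono (preimage_mono hA))
  · obtain ⟨p, e, φ, β, a, c, M, he, hr, hφ, hβ, hβi, hβM, hβe⟩ := hΦ.factor
    classical
    set R : ℂ → X := Function.update (fun ρ => e (a + (c + ρ⁻¹) ^ 2)) 0 p with hR
    refine ⟨β, h ∘ R, M, hβ, hβi, hβM, hcont.comp ?_, fun w hw => ?_⟩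
    · refine continuous_iff_continuousAt.2 fun ρ => ?_
      by_cases hρ : ρ = 0
      · subst hρ
        rw [hR, continuousAt_update_same]
        refine (tendsto_chart_cocompact he hr).comp ?_
        rw [← Metric.cobounded_eq_cocompact]
        have h1 : Tendsto (fun ρ : ℂ => c + ρ⁻¹) (𝓝[≠] 0) (Bornology.cobounded ℂ) := by
          exact (tendsto_const_add_cobounded c).comp tendsto_inv₀_nhdsNE_zero
        exact (tendsto_const_add_cobounded a).comp ((tendsto_pow_cobounded_cobounded two_ne_zero).comp h1)
      · rw [hR, continuousAt_update_of_ne hρ]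
        exact he.continuous.continuousAt.comp (by fun_prop (disch := assumption))
    · rw [Function.comp, hR, Function.update_of_ne (hβe w hw).1, hφ, (hβe w hw).2]

section Arc

variable {s t : ℝ}

lemma isClosed_expArc (s t : ℝ) :
    IsClosed ((fun u : ℝ => Complex.exp (u * Complex.I)) '' Icc s t) :=
  (isCompact_Icc.image (by fun_prop)).isClosed

lemma exp_mul_I_eq_iff {u v : ℝ} : Complex.exp (u * Complex.I) = Complex.exp (v * Complex.I) ↔
    ∃ n : ℤ, u = v + n * (2 * Real.pi) := by
  rw [Complex.exp_eq_exp_iff_exists_int]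
  refine exists_congr fun n => ⟨fun h => ?_, fun h => by rw [h]; push_cast; ring⟩
  have h2 : (u : ℂ) * Complex.I = ((v + n * (2 * Real.pi) : ℝ) : ℂ) * Complex.I := by
    rw [h]; push_cast; ring
  exact_mod_cast mul_right_cancel₀ Complex.I_ne_zero h2

lemma eq_exp_arg_of_mem_sphere {z : ℂ} (hz : z ∈ sphere (0 : ℂ) 1) :
    Complex.exp (Complex.arg z * Complex.I) = z := by
  have := Complex.norm_mul_exp_arg_mul_I z
  rwa [mem_sphere_zero_iff_norm.1 hz, Complex.ofReal_one, one_mul] at this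

lemma expArc_union (hst : s ≤ t) (hts : t ≤ s + 2 * Real.pi) :
    (fun u : ℝ => Complex.exp (u * Complex.I)) '' Icc s t ∪
      (fun u : ℝ => Complex.exp (u * Complex.I)) '' Icc t (s + 2 * Real.pi) = sphere (0 : ℂ) 1 := by
  rw [← image_union, Icc_union_Icc_eq_Icc hst hts]
  refine Subset.antisymm (by rintro _ ⟨u, -, rfl⟩; simp) fun z hz => ?_
  obtain ⟨u, hu, hzu⟩ := (show Function.Periodic (fun u : ℝ => Complex.exp (u * Complex.I))
    (2 * Real.pi) from fun u => exp_mul_I_eq_iff.2 ⟨1, by simp⟩).exists_mem_Ico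
      Real.two_pi_pos z.arg s
  exact ⟨u, Ico_subset_Icc_self hu, hzu.symm.trans (eq_exp_arg_of_mem_sphere hz)⟩

lemma expArc_inter (hst : s ≤ t) (hts : t < s + 2 * Real.pi) :
    (fun u : ℝ => Complex.exp (u * Complex.I)) '' Icc s t ∩
      (fun u : ℝ => Complex.exp (u * Complex.I)) '' Icc t (s + 2 * Real.pi) =
      {Complex.exp (s * Complex.I), Complex.exp (t * Complex.I)} := by
  refine Subset.antisymm ?_ ?_
  · rintro _ ⟨⟨u, hu, rfl⟩, ⟨v, hv, hvu⟩⟩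
    obtain ⟨n, hn⟩ := exp_mul_I_eq_iff.1 hvu
    have hpi := Real.two_pi_pos
    have h0 : 0 ≤ n := by
      by_contra! h
      have : (n : ℝ) ≤ -1 := by exact_mod_cast (show n ≤ -1 by omega)
      nlinarith [hu.1, hu.2, hv.1, hv.2]
    have h1 : n ≤ 1 := by
      by_contra! h
      have : (2 : ℝ) ≤ n := by exact_mod_cast (show 2 ≤ n by omega)
      nlinarith [hu.1, hu.2, hv.1, hv.2]
    obtain rfl | rfl : n = 0 ∨ n = 1 := by omega
    · simp only [Int.cast_zero, zero_mul, add_zero] at hn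
      right
      rw [le_antisymm hu.2 (hn ▸ hv.1)]
      rfl
    · left
      rw [le_antisymm (by push_cast at hn; linarith [hv.2]) hu.1]
  · rintro _ (rfl | rfl)
    · exact ⟨⟨s, ⟨le_rfl, hst⟩, rfl⟩, s + 2 * Real.pi, ⟨hts.le, le_rfl⟩,
        exp_mul_I_eq_iff.2 ⟨1, by simp⟩⟩
    · exact ⟨⟨t, ⟨hst, le_rfl⟩, rfl⟩, t, ⟨le_rfl, hts.le⟩, rfl⟩

lemma exists_ball_subset_expArc (hst : s < t) (hts : t < s + 2 * Real.pi) :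
    ∃ ζ₀ : ℂ, ‖ζ₀‖ = 1 ∧ ∃ ε > 0, sphere 0 1 ∩ ball ζ₀ ε ⊆
      (fun u : ℝ => Complex.exp (u * Complex.I)) '' Icc s t := by
  have hmid : Complex.exp (((s + t) / 2 : ℝ) * Complex.I) ∉
      (fun u : ℝ => Complex.exp (u * Complex.I)) '' Icc t (s + 2 * Real.pi) := fun h => by
    have h2 : Complex.exp (((s + t) / 2 : ℝ) * Complex.I) ∈
        ({Complex.exp (s * Complex.I), Complex.exp (t * Complex.I)} : Set ℂ) := by
      rw [← expArc_inter hst.le hts]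
      exact ⟨⟨(s + t) / 2, ⟨by linarith, by linarith⟩, rfl⟩, h⟩
    have hpi := Real.two_pi_pos
    have key : ∀ v, |(s + t) / 2 - v| < 2 * Real.pi → (s + t) / 2 ≠ v →
        Complex.exp (((s + t) / 2 : ℝ) * Complex.I) ≠ Complex.exp (v * Complex.I) := by
      intro v hv hne heq
      obtain ⟨n, hn⟩ := exp_mul_I_eq_iff.1 heq
      have hn0 : n ≠ 0 := by rintro rfl; simp at hn; exact hne hn
      have h1 : (1 : ℝ) ≤ |(n : ℝ)| := by exact_mod_cast Int.one_le_abs hn0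
      rw [hn, add_sub_cancel_left, abs_mul, abs_of_pos hpi] at hv
      nlinarith
    rcases h2 with h2 | h2
    · exact key s (by rw [abs_lt]; constructor <;> linarith) (by linarith) h2
    · exact key t (by rw [abs_lt]; constructor <;> linarith) (by linarith) h2
  obtain ⟨ε, hε, hsub⟩ := Metric.isOpen_iff.1 (isClosed_expArc t (s + 2 * Real.pi)).isOpen_compl _ hmid
  refine ⟨_, Complex.norm_exp_ofReal_mul_I ((s + t) / 2), ε, hε, fun z hz => ?_⟩
  rw [← expArc_union hst.le hts.le] at hz
  exact hz.1.resolve_right (hsub hz.2)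

end Arc

section

variable {X : Type*} [MetricSpace X] [CompactSpace X] {Q : Set X} {F G : ℂ → X}

/-- Two boundary points with the same image cut off an arc on which the extension is constant. -/
lemma IsDiscMap.collapse (hX : IsSphereLike X) (hF : IsDiscMap F Q) (hQ : IsTameDomain Q)
    (hG : ContinuousOn G (closedBall 0 1)) (hGF : EqOn G F (ball 0 1))
    (hGm : MapsTo G (sphere 0 1) (frontier Q)) (hGs : SurjOn G (sphere 0 1) (frontier Q))
    {s t : ℝ} (hst : s < t) (hts : t < s + 2 * Real.pi)
    (h : G (Complex.exp (s * Complex.I)) = G (Complex.exp (t * Complex.I))) :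
    (∀ u ∈ Icc s t, G (Complex.exp ((u : ℝ) * Complex.I)) = G (Complex.exp (s * Complex.I))) ∨
      ∀ u ∈ Icc t (s + 2 * Real.pi),
        G (Complex.exp ((u : ℝ) * Complex.I)) = G (Complex.exp (t * Complex.I)) := by
  rcases hF.eq_on_arc hX hQ hG hGF hGm hGs (isClosed_expArc _ _) (isClosed_expArc _ _)
    (expArc_union hst.le hts.le) (expArc_inter hst.le hts) h with h1 | h1
  · exact Or.inl fun u hu => h1 _ ⟨u, hu, rfl⟩
  · exact Or.inr fun u hu => (h1 _ ⟨u, hu, rfl⟩).trans h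

/-- The boundary extension of a Riemann map onto a tame domain is injective on the circle. -/
lemma IsRiemannMap.injOn_sphere (hX : IsSphereLike X) (hQ : IsTameDomain Q) {Ψ : ℂ → X}
    {ψ : X → ℂ} (hΨ : IsRiemannMap Ψ ψ Q) (hd : IsDiscMap Ψ Q)
    (hG : ContinuousOn G (closedBall 0 1)) (hGF : EqOn G Ψ (ball 0 1))
    (hGm : MapsTo G (sphere 0 1) (frontier Q)) (hGs : SurjOn G (sphere 0 1) (frontier Q)) :
    InjOn G (sphere 0 1) := by
  have hnc : ∀ s t : ℝ, s < t → t < s + 2 * Real.pi → ∀ q,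
      ¬ ∀ u ∈ Icc s t, G (Complex.exp ((u : ℝ) * Complex.I)) = q := by
    intro s t hst hts q hq
    obtain ⟨ζ₀, hζ₀, ε, hε, hsub⟩ := exists_ball_subset_expArc hst hts
    obtain ⟨p, e, φ, β, a, c, M, he, hr, hφ, hβ, hβi, hβM, hβe⟩ := hΨ.factor
    refine not_forall_tendsto_arc he hr (φ := φ) (fun z hz w hw hzw => hΨ.injOn hz hw ?_) hβ hβM
      hβe hζ₀ hε q fun ζ hζ => ?_
    · rw [hφ, hφ, hzw]
    · obtain ⟨u, hu, rfl⟩ := hsub hζ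
      have h1 := (hG _ (sphere_subset_closedBall hζ.1)).mono ball_subset_closedBall
      rw [ContinuousWithinAt, hq u hu] at h1
      refine h1.congr' ?_
      filter_upwards [self_mem_nhdsWithin] with z hz
      rw [hGF hz, hφ]
  have key : ∀ s t : ℝ, s < t → t < s + 2 * Real.pi →
      G (Complex.exp (s * Complex.I)) ≠ G (Complex.exp (t * Complex.I)) := by
    intro s t hst hts h
    rcases hd.collapse hX hQ hG hGF hGm hGs hst hts h with h1 | h1
    · exact hnc s t hst hts _ h1
    · exact hnc t (s + 2 * Real.pi) hts (by linarith) _ h1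
  intro z hz w hw hzw
  rw [← eq_exp_arg_of_mem_sphere hz, ← eq_exp_arg_of_mem_sphere hw] at hzw ⊢
  have h1 := Complex.arg_mem_Ioc z
  have h2 := Complex.arg_mem_Ioc w
  rcases lt_trichotomy z.arg w.arg with h | h | h
  · exact absurd hzw (key _ _ h (by linarith [h1.1, h2.2]))
  · rw [h]
  · exact absurd hzw.symm (key _ _ h (by linarith [h2.1, h1.2]))

end

/-- A monotone map that is injective over the open set `Q` restricts to a homeomorphism there. -/
lemma exists_homeomorph_preimage {X Y : Type*} [TopologicalSpace X] [TopologicalSpace Y] {g : X → Y}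
    (hg : Continuous g) (hcl : IsClosedMap g) {U : Set X} {Q : Set Y} (hU : g ⁻¹' Q = U)
    (hb : BijOn g U Q) : ∃ e : U ≃ₜ Q, ∀ x : U, (e x : Y) = g x.val := by
  subst hU
  have h : IsHomeomorph (Q.restrictPreimage g) := by
    rw [isHomeomorph_iff_continuous_isClosedMap_bijective]
    refine ⟨hg.restrictPreimage, hcl.restrictPreimage Q, fun x y hxy => ?_, fun y => ?_⟩
    · exact Subtype.ext (hb.injOn x.2 y.2 (congrArg Subtype.val hxy))
    · obtain ⟨x, hx, hxy⟩ := hb.surjOn y.2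
      exact ⟨⟨x, hx⟩, Subtype.ext hxy⟩
  exact ⟨h.homeomorph, fun x => rfl⟩

/-- If two boundary parametrizations agree up to collapsing arcs, then the disc map `F` can be
replaced by a map that is bijective on the open disc and has the same boundary values. -/
lemma exists_bijOn_of_collapse {X : Type*} [TopologicalSpace X] [T2Space X] {Q K : Set X}
    {F G : ℂ → X} (hF : ContinuousOn F (sphere 0 1)) (hFm : MapsTo F (sphere 0 1) K)
    (hFs : SurjOn F (sphere 0 1) K) (hG : ContinuousOn G (closedBall 0 1))
    (hGb : BijOn G (ball 0 1) Q) (hGs : BijOn G (sphere 0 1) K)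
    (hP : ∀ s t : ℝ, s < t → t < s + 2 * Real.pi →
      F (Complex.exp (s * Complex.I)) = F (Complex.exp (t * Complex.I)) →
      (∀ u ∈ Icc s t, F (Complex.exp ((u : ℝ) * Complex.I)) = F (Complex.exp (s * Complex.I))) ∨
      ∀ u ∈ Icc t (s + 2 * Real.pi),
        F (Complex.exp ((u : ℝ) * Complex.I)) = F (Complex.exp (t * Complex.I))) :
    ∃ T : ℂ → X, ContinuousOn T (closedBall 0 1) ∧ BijOn T (ball 0 1) Q ∧ EqOn T F (sphere 0 1) := by
  have hE : ∀ θ : ℝ, Complex.exp (θ * Complex.I) ∈ sphere (0 : ℂ) 1 := fun θ => by simp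
  set r : X → ℂ := Function.invFunOn G (sphere 0 1)
  have hr : ∀ x ∈ K, r x ∈ sphere (0 : ℂ) 1 ∧ G (r x) = x := fun x hx =>
    ⟨Function.invFunOn_mem (hGs.surjOn hx), Function.invFunOn_eq (hGs.surjOn hx)⟩
  set m : ℂ → ℂ := fun z => r (F z) with hm
  have hm1 : MapsTo m (sphere 0 1) (sphere 0 1) := fun z hz => (hr _ (hFm hz)).1
  have hGm : ∀ z ∈ sphere (0 : ℂ) 1, G (m z) = F z := fun z hz => (hr _ (hFm hz)).2
  have hmc : ContinuousOn m (sphere 0 1) := by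
    have hcs : CompactSpace (sphere (0 : ℂ) 1) := isCompact_iff_compactSpace.1 (isCompact_sphere _ _)
    have hGe : IsClosedEmbedding ((sphere (0 : ℂ) 1).domRestrict G) :=
      (hG.mono sphere_subset_closedBall).domRestrict.isClosedEmbedding hGs.injOn.injective
    have h1 : Continuous (hm1.restrict m (sphere 0 1) (sphere 0 1)) := by
      rw [hGe.isEmbedding.continuous_iff]
      convert hF.domRestrict using 1
      ext z
      exact hGm z z.2
    exact continuousOn_iff_continuous_domRestrict.2 (continuous_subtype_val.comp h1)
  have hms : SurjOn m (sphere 0 1) (sphere 0 1) := fun w hw => by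
    obtain ⟨z, hz, hzw⟩ := hFs (hGs.mapsTo hw)
    exact ⟨z, hz, hGs.injOn (hm1 hz) hw ((hGm z hz).trans hzw)⟩
  obtain ⟨H, hH, hHb, hHm⟩ := exists_disc_extension_of_collapse hmc hm1 hms fun s t hst hts h => by
    have h2 : F (Complex.exp (s * Complex.I)) = F (Complex.exp (t * Complex.I)) := by
      rw [← hGm _ (hE s), ← hGm _ (hE t), h]
    exact (hP s t hst hts h2).imp (fun h3 u hu => congrArg r (h3 u hu))
      fun h3 u hu => congrArg r (h3 u hu)
  refine ⟨G ∘ H, hG.comp hH.continuousOn fun z hz => ?_, hGb.comp hHb, fun z hz => ?_⟩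
  · rcases (mem_closedBall_zero_iff.1 hz).lt_or_eq with h | h
    · exact ball_subset_closedBall (hHb.mapsTo (mem_ball_zero_iff.2 h))
    · have hz' := mem_sphere_zero_iff_norm.2 h
      rw [hHm hz']
      exact sphere_subset_closedBall (hm1 hz')
  · rw [Function.comp, hHm hz, hGm z hz]

/-- Gluing a new parametrization of `Q` into a monotone map. -/
theorem exists_replacement_of_bijOn {X : Type*} [MetricSpace X] [CompactSpace X] {Q : Set X}
    {h : X → X} (hcont : Continuous h) (hfib : ∀ b, IsConnected (h ⁻¹' {b})) (hQ : IsOpen Q)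
    {Φ : ℂ → X} {ψ : X → ℂ} (hΦ : IsRiemannMap Φ ψ (h ⁻¹' Q)) {F T : ℂ → X}
    (hF : ContinuousOn F (closedBall 0 1)) (hFΦ : EqOn F (fun w => h (Φ w)) (ball 0 1))
    (hT : ContinuousOn T (closedBall 0 1)) (hTb : BijOn T (ball 0 1) Q)
    (hTF : EqOn T F (sphere 0 1)) :
    ∃ g : X → X, Continuous g ∧ Function.Surjective g ∧ (∀ b, IsConnected (g ⁻¹' {b})) ∧
      (∀ x, x ∉ h ⁻¹' Q → g x = h x) ∧
      ∃ e : (h ⁻¹' Q) ≃ₜ Q, ∀ x : (h ⁻¹' Q), (e x : X) = g x.val := by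
  classical
  set U := h ⁻¹' Q with hU
  have hUo : IsOpen U := hQ.preimage hcont
  set g : X → X := fun x => if x ∈ U then T (ψ x) else h x with hg
  have hgU : ∀ x ∈ U, g x = T (ψ x) := fun x hx => if_pos hx
  have hgn : ∀ x ∉ U, g x = h x := fun x hx => if_neg hx
  have hgc : Continuous g := by
    refine continuous_iff_continuousAt.2 fun x => ?_
    by_cases hx : x ∈ U
    · have h1 : ContinuousAt (fun y => T (ψ y)) x :=
        ((hT.mono ball_subset_closedBall).comp hΦ.continuousOn_inv hΦ.mapsTo_inv).continuousAt
          (hUo.mem_nhds hx)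
      refine h1.congr ?_
      filter_upwards [hUo.mem_nhds hx] with y hy using (hgU y hy).symm
    · rw [ContinuousAt, hgn x hx, Metric.tendsto_nhds]
      intro ε hε
      set K : Set ℂ := closedBall 0 1 ∩ (fun z => dist (T z) (F z)) ⁻¹' Ici (ε / 2) with hK
      have hKc : IsCompact K := (isCompact_closedBall _ _).of_isClosed_subset
        ((continuous_dist.comp_continuousOn (hT.prodMk hF)).preimage_isClosed_of_isClosed
          isClosed_closedBall isClosed_Ici)
        inter_subset_left
      have hKb : K ⊆ ball 0 1 := fun z hz => by
        rcases (mem_closedBall_zero_iff.1 hz.1).lt_or_eq with h1 | h1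
        · exact mem_ball_zero_iff.2 h1
        · have h2 : ε / 2 ≤ dist (T z) (F z) := hz.2
          rw [hTF (mem_sphere_zero_iff_norm.2 h1), dist_self] at h2
          linarith
      have hcl : IsClosed (Φ '' K) :=
        (hKc.image_of_continuousOn (hΦ.continuousOn.mono hKb)).isClosed
      have hxK : x ∉ Φ '' K := by
        rintro ⟨z, hz, rfl⟩
        exact hx (hΦ.mapsTo (hKb hz))
      filter_upwards [hcl.isOpen_compl.mem_nhds hxK,
        Metric.tendsto_nhds.1 hcont.continuousAt (ε / 2) (half_pos hε)] with y hy hyx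
      by_cases hyU : y ∈ U
      · have hz := hΦ.mapsTo_inv hyU
        have h1 : dist (T (ψ y)) (F (ψ y)) < ε / 2 := by
          by_contra! hcon
          exact hy ⟨ψ y, ⟨ball_subset_closedBall hz, hcon⟩, hΦ.right_inv y hyU⟩
        rw [hFΦ hz] at h1
        simp only [hΦ.right_inv y hyU] at h1
        rw [hgU y hyU]
        linarith [dist_triangle (T (ψ y)) (h y) (h x)]
      · rw [hgn y hyU]
        linarith
  have hgb : BijOn g U Q := by
    refine ⟨fun x hx => ?_, fun x hx y hy hxy => ?_, fun q hq => ?_⟩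
    · rw [hgU x hx]
      exact hTb.mapsTo (hΦ.mapsTo_inv hx)
    · rw [hgU x hx, hgU y hy] at hxy
      rw [← hΦ.right_inv x hx, hTb.injOn (hΦ.mapsTo_inv hx) (hΦ.mapsTo_inv hy) hxy,
        hΦ.right_inv y hy]
    · obtain ⟨w, hw, rfl⟩ := hTb.surjOn hq
      exact ⟨Φ w, hΦ.mapsTo hw, by rw [hgU _ (hΦ.mapsTo hw), hΦ.left_inv w hw]⟩
  have hgQ : ∀ x, g x ∈ Q ↔ x ∈ U := fun x => by
    refine ⟨fun hx => ?_, fun hx => hgb.mapsTo hx⟩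
    by_contra hxU
    rw [hgn x hxU] at hx
    exact hxU hx
  have hgf : ∀ b, IsConnected (g ⁻¹' {b}) := fun b => by
    by_cases hb : b ∈ Q
    · obtain ⟨x, hx, rfl⟩ := hgb.surjOn hb
      have : g ⁻¹' {g x} = {x} := by
        ext y
        refine ⟨fun hy => hgb.injOn ((hgQ y).1 ?_) hx hy, fun hy => by rw [hy]; rfl⟩
        rw [show g y = g x from hy]
        exact hb
      rw [this]
      exact isConnected_singleton
    · have : g ⁻¹' {b} = h ⁻¹' {b} := by
        ext y
        by_cases hy : y ∈ U
        · have h1 : g y ≠ b := fun h1 => hb (h1 ▸ hgb.mapsTo hy)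
          have h2 : h y ≠ b := fun h2 => hb (h2 ▸ hy)
          simp [h1, h2]
        · simp [hgn y hy]
      rw [this]
      exact hfib b
  exact ⟨g, hgc, fun b => (hgf b).nonempty, hgf, hgn,
    exists_homeomorph_preimage hgc hgc.isClosedMap (Set.ext hgQ) hgb⟩

/-- Homeomorphic replacement over a tame domain of a topological sphere. -/
theorem IsTameDomain.exists_replacement {X : Type*} [MetricSpace X] [CompactSpace X]
    [LocallyConnectedSpace X] (hX : IsSphereLike X) {Q : Set X} (hQ : IsTameDomain Q)
    {h : X → X} (hcont : Continuous h) (hfib : ∀ b, IsConnected (h ⁻¹' {b})) :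
    ∃ g : X → X, Continuous g ∧ Function.Surjective g ∧ (∀ b, IsConnected (g ⁻¹' {b})) ∧
      (∀ x, x ∉ h ⁻¹' Q → g x = h x) ∧
      ∃ e : (h ⁻¹' Q) ≃ₜ Q, ∀ x : (h ⁻¹' Q), (e x : X) = g x.val := by
  have hnt : Qᶜ.Nontrivial := hQ.frontier_nontrivial.mono fun x hx => by
    rw [hQ.isOpen.frontier_eq] at hx
    exact hx.2
  have hsurj : Function.Surjective h := fun b => (hfib b).nonempty
  obtain ⟨Φ, ψ, hΦ⟩ := exists_isRiemannMap hX (hQ.isOpen.preimage hcont)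
    ⟨hQ.isConnected.nonempty.preimage hsurj,
      hQ.isConnected.isPreconnected.preimage_of_isConnected_fibers hcont.isClosedMap hfib⟩
    (hQ.isPreconnected_compl.preimage_of_isConnected_fibers hcont.isClosedMap hfib)
    (hnt.preimage hsurj)
  obtain ⟨Ψ, ψ', hΨ⟩ := exists_isRiemannMap hX hQ.isOpen hQ.isConnected hQ.isPreconnected_compl hnt
  have hFd := hΦ.isDiscMap hcont hfib
  have hΨd : IsDiscMap Ψ Q := IsRiemannMap.isDiscMap (h := id) hΨ continuous_id fun b =>
    isConnected_singleton
  obtain ⟨F, hF, hFΦ, hFm, hFs⟩ := hFd.exists_extension hQ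
  obtain ⟨G, hG, hGΨ, hGm, hGs⟩ := hΨd.exists_extension hQ
  have hGb : BijOn G (ball 0 1) Q :=
    (show BijOn Ψ (ball 0 1) Q from ⟨hΨ.mapsTo, hΨ.injOn, hΨd.surjOn⟩).congr hGΨ.symm
  obtain ⟨T, hT, hTb, hTF⟩ := exists_bijOn_of_collapse (hF.mono sphere_subset_closedBall) hFm hFs hG
    hGb ⟨hGm, hΨ.injOn_sphere hX hQ hΨd hG hGΨ hGm hGs, hGs⟩
    fun s t hst hts hs => hFd.collapse hX hQ hF hFΦ hFm hFs hst hts hs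
  exact exists_replacement_of_bijOn hcont hfib hQ.isOpen hΦ hF hFΦ hT hTb hTF

lemma isSphereLike_sphere :
    IsSphereLike (Metric.sphere (0 : EuclideanSpace ℝ (Fin 3)) 1) := by
  intro p
  have : Fact (Module.finrank ℝ (EuclideanSpace ℝ (Fin 3)) = 2 + 1) := ⟨by simp⟩
  let φ := stereographic' 2 p
  let L : ℂ ≃ₜ EuclideanSpace ℝ (Fin 2) := Complex.orthonormalBasisOneI.repr.toHomeomorph
  have htarget : φ.target = univ := stereographic'_target p
  have hs : φ.source = {p}ᶜ := stereographic'_source p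
  refine ⟨fun z => φ.symm (L z), ?_, ?_⟩
  · have h1 : IsOpenEmbedding φ.symm := by
      apply φ.symm.isOpenEmbedding
      exact htarget
    exact h1.comp L.isOpenEmbedding
  · rw [← hs, ← φ.symm_image_target_eq_source, htarget, image_univ]
    exact L.surjective.range_comp φ.symm

instance : LocallyConnectedSpace (Metric.sphere (0 : EuclideanSpace ℝ (Fin 3)) 1) := by
  have : Fact (Module.finrank ℝ (EuclideanSpace ℝ (Fin 3)) = 2 + 1) := ⟨by simp⟩
  exact ChartedSpace.locallyConnectedSpace (EuclideanSpace ℝ (Fin 2)) _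

/-- The unit circle of the Euclidean plane, parametrized with period one. -/
noncomputable def circlePoint (t : ℝ) : Metric.sphere (0 : EuclideanSpace ℝ (Fin 2)) 1 :=
  ⟨!₂[Real.cos (2 * Real.pi * t), Real.sin (2 * Real.pi * t)], by
    simp [EuclideanSpace.norm_eq]⟩

lemma continuous_circlePoint : Continuous circlePoint := by
  unfold circlePoint
  fun_prop

lemma circlePoint_eq_iff {s t : ℝ} : circlePoint s = circlePoint t ↔ ∃ n : ℤ, s = t + n := by
  have h1 : circlePoint s = circlePoint t ↔ Complex.exp ((2 * Real.pi * s : ℝ) * Complex.I) =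
      Complex.exp ((2 * Real.pi * t : ℝ) * Complex.I) := by
    rw [Complex.ext_iff, Complex.exp_ofReal_mul_I_re, Complex.exp_ofReal_mul_I_re,
      Complex.exp_ofReal_mul_I_im, Complex.exp_ofReal_mul_I_im, Subtype.ext_iff]
    constructor
    · intro h
      exact ⟨congrArg (fun v : EuclideanSpace ℝ (Fin 2) => v 0) h,
        congrArg (fun v : EuclideanSpace ℝ (Fin 2) => v 1) h⟩
    · rintro ⟨h, h'⟩
      simp only [circlePoint, h, h']
  rw [h1, exp_mul_I_eq_iff]
  refine exists_congr fun n => ⟨fun h => ?_, fun h => by rw [h]; ring⟩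
  exact mul_left_cancel₀ Real.two_pi_pos.ne' (h.trans (by ring))

lemma circlePoint_surjective : Function.Surjective circlePoint := by
  rintro ⟨v, hv⟩
  have hn : v 0 ^ 2 + v 1 ^ 2 = 1 := by
    have := EuclideanSpace.norm_sq_eq v
    rw [mem_sphere_zero_iff_norm.1 hv] at this
    simpa using this.symm
  have hz : (⟨v 0, v 1⟩ : ℂ) ∈ sphere (0 : ℂ) 1 := by
    rw [mem_sphere_zero_iff_norm, ← sq_eq_sq₀ (norm_nonneg _) zero_le_one, Complex.sq_norm,
      Complex.normSq_mk]
    linarith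
  have h := eq_exp_arg_of_mem_sphere hz
  refine ⟨(⟨v 0, v 1⟩ : ℂ).arg / (2 * Real.pi), Subtype.ext ?_⟩
  have h0 := congrArg Complex.re h
  have h1 := congrArg Complex.im h
  rw [Complex.exp_ofReal_mul_I_re] at h0
  rw [Complex.exp_ofReal_mul_I_im] at h1
  simp only [circlePoint]
  rw [mul_div_cancel₀ _ Real.two_pi_pos.ne']
  ext i
  fin_cases i
  · exact h0
  · exact h1

end

/-- Homeomorphic replacement in pre-cells (internal case): for a monotone self-map
`h` of the 2-sphere and a Jordan domain `Q ⊆ S²` with pre-cell `U = h⁻¹(Q)`, there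
is a monotone map `g` agreeing with `h` outside `U` whose restriction to `U` is a
homeomorphism of `U` onto `Q`. -/
theorem homeomorphic_replacement_in_precell
    (h : (Metric.sphere (0 : EuclideanSpace ℝ (Fin 3)) 1) →
         (Metric.sphere (0 : EuclideanSpace ℝ (Fin 3)) 1))
    (hcont : Continuous h) (hsurj : Function.Surjective h)
    (hfib : ∀ b, IsConnected (h ⁻¹' {b}))
    (Q : Set (Metric.sphere (0 : EuclideanSpace ℝ (Fin 3)) 1))
    (γ : (Metric.sphere (0 : EuclideanSpace ℝ (Fin 2)) 1) →
         (Metric.sphere (0 : EuclideanSpace ℝ (Fin 3)) 1))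
    (hγcont : Continuous γ) (hγinj : Function.Injective γ)
    (hQ : ∃ x ∈ (Set.range γ)ᶜ, Q = connectedComponentIn (Set.range γ)ᶜ x) :
    ∃ g : (Metric.sphere (0 : EuclideanSpace ℝ (Fin 3)) 1) →
          (Metric.sphere (0 : EuclideanSpace ℝ (Fin 3)) 1),
      Continuous g ∧ Function.Surjective g ∧ (∀ b, IsConnected (g ⁻¹' {b})) ∧
      (∀ x, x ∉ h ⁻¹' Q → g x = h x) ∧
      ∃ e : (h ⁻¹' Q) ≃ₜ Q, ∀ x : (h ⁻¹' Q), ((e x : _)) = g x.val := by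
  obtain ⟨x, hx, rfl⟩ := hQ
  have hc : IsJordanLoop (γ ∘ circlePoint) :=
    ⟨hγcont.comp continuous_circlePoint,
      fun t => congrArg γ (circlePoint_eq_iff.2 ⟨1, by simp⟩),
      fun s t hst => circlePoint_eq_iff.1 (hγinj hst)⟩
  have hr : Set.range (γ ∘ circlePoint) = Set.range γ := circlePoint_surjective.range_comp γ
  rw [← hr] at hx ⊢
  exact (hc.isTameDomain isSphereLike_sphere hx).exists_replacement isSphereLike_sphere hcont hfib
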